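/- Fix integers n, m ≥ 1, and for x ∈ ℝ^{2n}, t ∈ ℝ^m with x ≠ 0 and t ≠ 0 define V₁(x,t) = −(R/4)·(p_{1,1,0}(x,t)² + p_{1,0,1}(x,t)²)/p_{1,0,0}(x,t)² + (R/2)·(p_{1,2,0}(x,t) + p_{1,0,2}(x,t) + (n/R)·p_{1,1,0}(x,t) − ((m−1)/|t|)·p_{1,0,1}(x,t))/p_{1,0,0}(x,t) (this is the Schrödinger potential V₁ = −¼|∇_H p₁|²/p₁² − ½(ℒp₁)/p₁ arising from conjugating the sub-Riemannian Ornstein–Uhlenbeck operator ℒ^{p₁}). Then there exist constants c > 0, C > 0 and M > 0 such that for all (x,t) ∈ ℝ^{2n} × ℝ^m with x ≠ 0, t ≠ 0 and |x|² + |t| ≥ M, c·d(x,t)² ≤ V₁(x,t) ≤ C·d(x,t)². -/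

import Mathlib

open Real Complex MeasureTheory
open scoped Classical

/-- θ(y) = (2y − sin(2y))/(2 sin²(y)) for y ≠ 0, θ(0) = 0. -/
noncomputable def theta (y : ℝ) : ℝ :=
  if y = 0 then 0 else (2 * y - Real.sin (2 * y)) / (2 * Real.sin y ^ 2)

/-- The radial derivative p_{1,k₁,k₂} of the heat kernel at time 1 on an H-type group
with centre of dimension m, with R = |x|²/4 (integrand extended by continuity at λ = 0).
It is real-valued (we take real parts below). -/
noncomputable def pT (n m k₁ k₂ : ℕ) (hm : 0 < m)
    (x : EuclideanSpace ℝ (Fin (2 * n))) (t : EuclideanSpace ℝ (Fin m)) : ℂ :=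
  ((-1 : ℂ) ^ k₁ * Complex.I ^ k₂ / ((4 * (π : ℂ)) ^ n * (2 * (π : ℂ)) ^ m)) *
    ∫ lam : EuclideanSpace ℝ (Fin m),
      if lam = 0 then (if k₂ = 0 then Complex.exp (-((‖x‖ ^ 2 / 4 : ℝ) : ℂ)) else 0)
      else
        Complex.exp (Complex.I * ((‖t‖ : ℝ) : ℂ) * ((lam ⟨0, hm⟩ : ℝ) : ℂ)
            - ((‖x‖ ^ 2 / 4 * ‖lam‖ * Real.cosh ‖lam‖ / Real.sinh ‖lam‖ : ℝ) : ℂ)) *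
          (((‖lam‖ : ℝ) : ℂ) ^ (n + k₁) * ((Real.cosh ‖lam‖ : ℝ) : ℂ) ^ k₁
            / ((Real.sinh ‖lam‖ : ℝ) : ℂ) ^ (n + k₁)) *
          ((lam ⟨0, hm⟩ : ℝ) : ℂ) ^ k₂

/-- The Schrödinger potential V₁ = −¼|∇_H p₁|²/p₁² − ½(ℒp₁)/p₁ arising from conjugating
the sub-Riemannian Ornstein–Uhlenbeck operator ℒ^{p₁}, written in terms of the radial
derivatives p_{1,k₁,k₂} (which are real-valued), with R = |x|²/4. -/
noncomputable def potV (n m : ℕ) (hm : 0 < m)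
    (x : EuclideanSpace ℝ (Fin (2 * n))) (t : EuclideanSpace ℝ (Fin m)) : ℝ :=
  -(‖x‖ ^ 2 / 4 / 4) *
      ((pT n m 1 0 hm x t).re ^ 2 + (pT n m 0 1 hm x t).re ^ 2) /
      (pT n m 0 0 hm x t).re ^ 2 +
    (‖x‖ ^ 2 / 4 / 2) *
      ((pT n m 2 0 hm x t).re + (pT n m 0 2 hm x t).re +
        ((n : ℝ) / (‖x‖ ^ 2 / 4)) * (pT n m 1 0 hm x t).re -
        (((m : ℝ) - 1) / ‖t‖) * (pT n m 0 1 hm x t).re) /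
      (pT n m 0 0 hm x t).re

namespace OUPotential
open Filter Topology

/-- The function `r coth r`, extended by `1` at `0`. -/
noncomputable def psi (r : ℝ) : ℝ := if r = 0 then 1 else r * Real.cosh r / Real.sinh r

/-- The function `r / sinh r`, extended by `1` at `0`. -/
noncomputable def rs (r : ℝ) : ℝ := if r = 0 then 1 else r / Real.sinh r

/-- The squares of the positive zeros of `sin`. -/
noncomputable def ck (k : ℕ) : ℝ := ((k : ℝ) + 1) ^ 2 * Real.pi ^ 2

/-- Partial sums of the partial fraction expansion of `√z coth √z`. -/
noncomputable def psiN (N : ℕ) (z : ℝ) : ℝ := 1 + ∑ k ∈ Finset.range N, 2 * z / (z + ck k)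

lemma ck_pos (k : ℕ) : 0 < ck k := by unfold ck; positivity

lemma nine_lt_ck (k : ℕ) : 9 < ck k := by
  unfold ck
  have := Real.pi_gt_three
  have h1 : (1:ℝ) ≤ ((k : ℝ) + 1) ^ 2 := by
    have : (0:ℝ) ≤ k := by positivity
    nlinarith
  nlinarith

lemma mem_integerComplement_I {r : ℝ} (hr : r ≠ 0) :
    (Complex.I * r / Real.pi : ℂ) ∈ integerComplement := by
  rintro ⟨k, hk⟩
  have h := congrArg Complex.im hk
  rw [show (Complex.I * r / Real.pi : ℂ) = ((r / Real.pi : ℝ) : ℂ) * Complex.I by push_cast; ring] at h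
  rw [Complex.mul_I_im, Complex.ofReal_re, Complex.intCast_im] at h
  have : r / Real.pi ≠ 0 := div_ne_zero hr Real.pi_ne_zero
  exact this h.symm

lemma tendsto_psiN (r : ℝ) : Tendsto (fun N => psiN N (r ^ 2)) atTop (𝓝 (psi r)) := by
  by_cases hr : r = 0
  · simp [psi, psiN, hr]
  have hz := mem_integerComplement_I hr
  have h := tendsto_logDeriv_euler_cot_sub hz
  have hpi : (Real.pi : ℂ) ≠ 0 := by exact_mod_cast Real.pi_ne_zero
  have hrc : (r : ℂ) ≠ 0 := by exact_mod_cast hr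
  have hsin : (Real.sinh r : ℂ) ≠ 0 := by
    exact_mod_cast (Real.sinh_ne_zero.mpr hr)
  have h2 := (h.mul_const (Complex.I * r / Real.pi)).add_const 1
  have e1 : (Real.pi * Complex.cot (Real.pi * (Complex.I * r / Real.pi)) - 1 / (Complex.I * r / Real.pi))
      * (Complex.I * r / Real.pi) + 1 = ((psi r : ℝ) : ℂ) := by
    rw [show (Real.pi : ℂ) * (Complex.I * r / Real.pi) = r * Complex.I by field_simp]
    rw [Complex.cot, Complex.cos_mul_I, Complex.sin_mul_I]
    simp only [psi, hr, if_false]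
    push_cast
    rw [Complex.ofReal_sinh] at hsin
    field_simp
    ring
  rw [e1] at h2
  have h3 := (Complex.continuous_re.tendsto _).comp h2
  simp only [Complex.ofReal_re] at h3
  refine h3.congr (fun N => ?_)
  simp only [Function.comp]
  rw [Finset.sum_mul]
  have : ∀ k ∈ Finset.range N, cotTerm (Complex.I * r / Real.pi) k * (Complex.I * r / Real.pi)
      = ((2 * r ^ 2 / (r ^ 2 + ck k) : ℝ) : ℂ) := by
    intro k _
    rw [cotTerm_identity hz]
    have hc : ((r:ℂ) ^ 2 + (ck k : ℝ)) ≠ 0 := by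
      have := ck_pos k
      have h0 : (r ^ 2 + ck k) ≠ 0 := by positivity
      exact_mod_cast h0
    have e : (Complex.I * r / Real.pi + (k + 1)) * (Complex.I * r / Real.pi - (k + 1))
       = -(((r:ℂ) ^ 2 + (ck k : ℝ)) / Real.pi ^ 2) := by
      unfold ck; push_cast; field_simp; ring_nf; simp
    rw [e]
    push_cast
    field_simp
    ring_nf; simp
  rw [Finset.sum_congr rfl this]
  rw [← Complex.ofReal_sum, ← Complex.ofReal_one, ← Complex.ofReal_add, Complex.ofReal_re, psiN, add_comm]

lemma tendsto_prodN (r : ℝ) :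
    Tendsto (fun N => ∏ k ∈ Finset.range N, (1 + r ^ 2 / ck k)⁻¹) atTop (𝓝 (rs r)) := by
  by_cases hr : r = 0
  · simp [rs, hr]
  have hpi : (Real.pi : ℂ) ≠ 0 := by exact_mod_cast Real.pi_ne_zero
  have hrc : (r : ℂ) ≠ 0 := by exact_mod_cast hr
  have hsin : Real.sinh r ≠ 0 := Real.sinh_ne_zero.mpr hr
  have h := tendsto_euler_sin_prod' (x := Complex.I * r / Real.pi) (by
    simp [hr, Real.pi_ne_zero])
  rw [show (Real.pi : ℂ) * (Complex.I * r / Real.pi) = r * Complex.I by field_simp,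
    Complex.sin_mul_I] at h
  have e1 : Complex.sinh r * Complex.I / (r * Complex.I) = ((Real.sinh r / r : ℝ) : ℂ) := by
    push_cast; field_simp
  rw [e1] at h
  have h3 := (Complex.continuous_re.tendsto _).comp h
  simp only [Complex.ofReal_re] at h3
  have h4 := h3.inv₀ (div_ne_zero hsin hr)
  rw [inv_div] at h4
  simp only [rs, hr, if_false]
  refine h4.congr (fun N => ?_)
  simp only [Function.comp]
  rw [Finset.prod_inv_distrib]
  congr 1
  have : ∀ k ∈ Finset.range N, 1 + sineTerm (Complex.I * r / Real.pi) k
      = ((1 + r ^ 2 / ck k : ℝ) : ℂ) := by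
    intro k _
    have hk : ((k:ℂ) + 1) ≠ 0 := by exact_mod_cast Nat.succ_ne_zero k
    simp only [sineTerm, ck]
    push_cast
    field_simp
    ring_nf; simp
  rw [Finset.prod_congr rfl this, ← Complex.ofReal_prod, Complex.ofReal_re]

/-- Partial products of the expansion of `√z / sinh √z`. -/
noncomputable def prodN (N : ℕ) (z : ℝ) : ℝ := ∏ k ∈ Finset.range N, (1 + z / ck k)⁻¹

/-- The truncated radial profile of the Fourier transform of the heat kernel. -/
noncomputable def fN (n : ℕ) (R : ℝ) (N : ℕ) (z : ℝ) : ℝ :=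
  Real.exp (-(R * psiN N z)) * prodN N z ^ n

/-- The radial profile of the Fourier transform of the heat kernel. -/
noncomputable def fr (n : ℕ) (R : ℝ) (r : ℝ) : ℝ := Real.exp (-(R * psi r)) * rs r ^ n

lemma sum_inv_ck_le (N : ℕ) : ∑ k ∈ Finset.range N, 2 / ck k ≤ 1 / 2 := by
  have h : ∀ N : ℕ, ∑ k ∈ Finset.range (N + 1), 1 / ((k : ℝ) + 1) ^ 2 ≤ 2 - 1 / ((N : ℝ) + 1) := by
    intro N
    induction N with
    | zero => norm_num
    | succ N ih =>
      rw [Finset.sum_range_succ]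
      have : 1 / ((N : ℝ) + 1 + 1) ^ 2 ≤ 1 / ((N:ℝ) + 1) - 1 / ((N:ℝ) + 1 + 1) := by
        rw [div_sub_div _ _ (by positivity) (by positivity),
          div_le_div_iff₀ (by positivity) (by positivity)]
        nlinarith [(Nat.cast_nonneg N : (0:ℝ) ≤ N)]
      push_cast
      linarith
  have h2 : ∑ k ∈ Finset.range N, 1 / ((k : ℝ) + 1) ^ 2 ≤ 2 := by
    refine (Finset.sum_le_sum_of_subset_of_nonneg (Finset.range_mono (Nat.le_succ N))
      (fun _ _ _ => by positivity)).trans ((h N).trans ?_)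
    have : 0 ≤ 1 / ((N : ℝ) + 1) := by positivity
    linarith
  have h3 : ∑ k ∈ Finset.range N, 2 / ck k
      = 2 / Real.pi ^ 2 * ∑ k ∈ Finset.range N, 1 / ((k : ℝ) + 1) ^ 2 := by
    rw [Finset.mul_sum]
    refine Finset.sum_congr rfl (fun k _ => ?_)
    unfold ck
    field_simp
  rw [h3]
  have h4 : 2 / Real.pi ^ 2 ≤ 1 / 4 := by
    rw [div_le_div_iff₀ (by positivity) (by norm_num)]
    nlinarith [Real.pi_gt_three]
  nlinarith [show 0 ≤ 2 / Real.pi ^ 2 by positivity]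

lemma psiN_mono {z : ℝ} (hz : 0 ≤ z) : Monotone (fun N => psiN N z) := by
  refine monotone_nat_of_le_succ (fun N => ?_)
  simp only [psiN, Finset.sum_range_succ]
  have := ck_pos N
  have : 0 ≤ 2 * z / (z + ck N) := by positivity
  linarith

lemma one_le_psiN {z : ℝ} (hz : 0 ≤ z) (N : ℕ) : 1 ≤ psiN N z := by
  have := psiN_mono hz (Nat.zero_le N)
  simpa [psiN] using this

lemma psiN_le {z : ℝ} (hz : 0 ≤ z) (N : ℕ) : psiN N z ≤ 1 + z := by
  have h : ∑ k ∈ Finset.range N, 2 * z / (z + ck k) ≤ z * ∑ k ∈ Finset.range N, 2 / ck k := by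
    rw [Finset.mul_sum]
    refine Finset.sum_le_sum (fun k _ => ?_)
    have := ck_pos k
    rw [mul_div_assoc', mul_comm z 2]
    gcongr
    linarith
  have := sum_inv_ck_le N
  unfold psiN
  nlinarith

lemma one_le_psi (r : ℝ) : 1 ≤ psi r :=
  ge_of_tendsto' (tendsto_psiN r) (fun N => one_le_psiN (sq_nonneg r) N)

lemma psi_le (r : ℝ) : psi r ≤ 1 + r ^ 2 :=
  le_of_tendsto' (tendsto_psiN r) (fun N => psiN_le (sq_nonneg r) N)

lemma prodN_pos {z : ℝ} (hz : 0 ≤ z) (N : ℕ) : 0 < prodN N z := by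
  refine Finset.prod_pos (fun k _ => ?_)
  have := ck_pos k
  positivity

lemma prodN_anti {z : ℝ} (hz : 0 ≤ z) : Antitone (fun N => prodN N z) := by
  refine antitone_nat_of_succ_le (fun N => ?_)
  have h := prodN_pos hz N
  simp only [prodN, Finset.prod_range_succ] at h ⊢
  have := ck_pos N
  have h1 : (1 + z / ck N)⁻¹ ≤ 1 := inv_le_one_of_one_le₀ (by
    have : 0 ≤ z / ck N := by positivity
    linarith)
  nlinarith

lemma prodN_le_one {z : ℝ} (hz : 0 ≤ z) (N : ℕ) : prodN N z ≤ 1 := by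
  have := prodN_anti hz (Nat.zero_le N)
  simpa [prodN] using this

lemma prodN_le {z : ℝ} (hz : 0 ≤ z) (K : ℕ) :
    prodN K z ≤ (∏ k ∈ Finset.range K, ck k) * ((1 + z) ^ K)⁻¹ := by
  rw [← Finset.card_range K, ← inv_pow, ← Finset.prod_const, Finset.card_range, ← Finset.prod_mul_distrib]
  refine Finset.prod_le_prod (fun k _ => ?_) (fun k _ => ?_)
  · have := ck_pos k
    positivity
  · have := nine_lt_ck k
    rw [← div_eq_mul_inv, inv_le_comm₀ (by positivity) (by positivity), inv_div,
      div_le_iff₀ (by linarith)]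
    have : z / ck k * ck k = z := by field_simp
    nlinarith

lemma rs_nonneg (r : ℝ) : 0 ≤ rs r :=
  ge_of_tendsto' (tendsto_prodN r) (fun N => (prodN_pos (sq_nonneg r) N).le)

lemma rs_pos (r : ℝ) : 0 < rs r := by
  by_cases h : r = 0
  · simp [rs, h]
  · refine lt_of_le_of_ne (rs_nonneg r) (Ne.symm ?_)
    simp only [rs, h, if_false]
    exact div_ne_zero h (Real.sinh_ne_zero.mpr h)

lemma rs_le (r : ℝ) (K : ℕ) : rs r ≤ prodN K (r ^ 2) :=
  (prodN_anti (sq_nonneg r)).le_of_tendsto (tendsto_prodN r) K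

lemma rs_le_one (r : ℝ) : rs r ≤ 1 := (rs_le r 0).trans (by simp [prodN])

lemma tendsto_fN (n : ℕ) (R r : ℝ) : Tendsto (fun N => fN n R N (r ^ 2)) atTop (𝓝 (fr n R r)) := by
  have h1 := ((tendsto_psiN r).const_mul R).neg.rexp
  exact h1.mul ((tendsto_prodN r).pow n)

lemma fN_pos (n : ℕ) (R : ℝ) (N : ℕ) {z : ℝ} (hz : 0 ≤ z) : 0 < fN n R N z :=
  mul_pos (Real.exp_pos _) (pow_pos (prodN_pos hz N) n)

lemma fr_pos (n : ℕ) (R r : ℝ) : 0 < fr n R r :=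
  mul_pos (Real.exp_pos _) (pow_pos (rs_pos r) n)

lemma fN_le {n : ℕ} (hn : 1 ≤ n) {R : ℝ} (hR : 0 ≤ R) {N : ℕ} {z : ℝ} (hz : 0 ≤ z) :
    fN n R N z ≤ prodN N z := by
  have h1 : Real.exp (-(R * psiN N z)) ≤ 1 := by
    rw [Real.exp_le_one_iff]
    have := one_le_psiN hz N
    nlinarith
  have h2 : prodN N z ^ n ≤ prodN N z :=
    pow_le_of_le_one (prodN_pos hz N).le (prodN_le_one hz N) (by omega)
  unfold fN
  calc _ ≤ 1 * prodN N z ^ n := by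
        have := prodN_pos hz N
        gcongr
    _ ≤ _ := by linarith

lemma fr_le {n : ℕ} (hn : 1 ≤ n) {R : ℝ} (hR : 0 ≤ R) (r : ℝ) (K : ℕ) :
    fr n R r ≤ prodN K (r ^ 2) := by
  refine le_of_tendsto (tendsto_fN n R r) (eventually_atTop.mpr ⟨K, fun N hN => ?_⟩)
  exact (fN_le hn hR (sq_nonneg r)).trans (prodN_anti (sq_nonneg r) hN)

/-- An integrable majorant for all truncated profiles with polynomial weights. -/
noncomputable def maj (m q : ℕ) (lam : EuclideanSpace ℝ (Fin m)) : ℝ :=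
  (1 + ‖lam‖ ^ 2) ^ q * prodN (q + m + 1) (‖lam‖ ^ 2)

lemma continuous_prodN (N : ℕ) (m : ℕ) :
    Continuous (fun lam : EuclideanSpace ℝ (Fin m) => prodN N (‖lam‖ ^ 2)) := by
  unfold prodN
  refine continuous_finsetProd _ (fun k _ => ?_)
  refine Continuous.inv₀ (by fun_prop) (fun x => ?_)
  have := ck_pos k
  positivity

lemma integrable_maj (m q : ℕ) : Integrable (maj m q) := by
  have h := integrable_rpow_neg_one_add_norm_sq (E := EuclideanSpace ℝ (Fin m)) (μ := volume)
    (r := 2 * ((m : ℝ) + 1)) (by simp; linarith [(Nat.cast_nonneg m : (0:ℝ) ≤ m)])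
  refine (h.const_mul (∏ k ∈ Finset.range (q + m + 1), ck k)).mono' ?_ (Eventually.of_forall fun x => ?_)
  · exact (Continuous.mul (by fun_prop) (continuous_prodN _ m)).aestronglyMeasurable
  · have hx : 0 ≤ ‖x‖ ^ 2 := by positivity
    have hp := prodN_pos hx (q + m + 1)
    rw [Real.norm_of_nonneg (by unfold maj; positivity)]
    have h1 := prodN_le hx (q + m + 1)
    have e : (1 + ‖x‖ ^ 2) ^ (-(2 * ((m : ℝ) + 1)) / 2) = ((1 + ‖x‖ ^ 2) ^ (m + 1))⁻¹ := by
      rw [show -(2 * ((m : ℝ) + 1)) / 2 = -((m + 1 : ℕ) : ℝ) by push_cast; ring,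
        Real.rpow_neg (by positivity), Real.rpow_natCast]
    rw [e]
    unfold maj
    calc _ ≤ (1 + ‖x‖ ^ 2) ^ q * ((∏ k ∈ Finset.range (q + m + 1), ck k) * ((1 + ‖x‖ ^ 2) ^ (q + m + 1))⁻¹) := by
          gcongr
      _ = _ := by
          rw [show q + m + 1 = q + (m + 1) by ring, pow_add]
          field_simp

lemma maj_nonneg (m q : ℕ) (x : EuclideanSpace ℝ (Fin m)) : 0 ≤ maj m q x := by
  have hx : 0 ≤ ‖x‖ ^ 2 := by positivity
  have hp := prodN_pos hx (q + m + 1)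
  unfold maj; positivity

lemma fN_weight_le_maj {n : ℕ} (hn : 1 ≤ n) {R : ℝ} (hR : 0 ≤ R) {m q N : ℕ} (hN : q + m + 1 ≤ N)
    (x : EuclideanSpace ℝ (Fin m)) : (1 + ‖x‖ ^ 2) ^ q * fN n R N (‖x‖ ^ 2) ≤ maj m q x := by
  have hx : 0 ≤ ‖x‖ ^ 2 := by positivity
  unfold maj
  gcongr
  exact (fN_le hn hR hx).trans (prodN_anti hx hN)

lemma fr_weight_le_maj {n : ℕ} (hn : 1 ≤ n) {R : ℝ} (hR : 0 ≤ R) {m q : ℕ}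
    (x : EuclideanSpace ℝ (Fin m)) : (1 + ‖x‖ ^ 2) ^ q * fr n R ‖x‖ ≤ maj m q x := by
  unfold maj
  gcongr
  exact fr_le hn hR _ _

section

variable {m : ℕ}

/-- A rapidly decreasing radial-type weight: both `φ` and `φ'` have all polynomial moments and
`∂ᵢ φ = λᵢ φ'`. -/
structure IsWeight {m : ℕ} (φ φ' : EuclideanSpace ℝ (Fin m) → ℝ) : Prop where
  deriv : ∀ lam i, HasLineDerivAt ℝ φ (lam i * φ' lam) lam (EuclideanSpace.single i 1)
  int : ∀ q : ℕ, Integrable (fun lam => (1 + ‖lam‖ ^ 2) ^ q * φ lam)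
  int' : ∀ q : ℕ, Integrable (fun lam => (1 + ‖lam‖ ^ 2) ^ q * φ' lam)

lemma integrable_of_poly_bound {φ A : EuclideanSpace ℝ (Fin m) → ℝ}
    (hφ : ∀ q : ℕ, Integrable (fun lam => (1 + ‖lam‖ ^ 2) ^ q * φ lam))
    (hA : Measurable A) {C : ℝ} {q : ℕ} (hb : ∀ lam, |A lam| ≤ C * (1 + ‖lam‖ ^ 2) ^ q) :
    Integrable (fun lam => A lam * φ lam) := by
  have h0 : AEStronglyMeasurable φ := by simpa using (hφ 0).aestronglyMeasurable
  refine ((hφ q).norm.const_mul C).mono' (hA.aestronglyMeasurable.mul h0)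
    (Eventually.of_forall fun x => ?_)
  rw [norm_mul, norm_mul, ← mul_assoc, Real.norm_eq_abs, Real.norm_of_nonneg (r := _ ^ q) (by positivity)]
  gcongr
  exact hb x

/-- Components grow at most linearly. -/
lemma abs_coord_le (lam : EuclideanSpace ℝ (Fin m)) (i : Fin m) : |lam i| ≤ 1 + ‖lam‖ ^ 2 := by
  have h : |lam i| ≤ ‖lam‖ := by
    simpa using PiLp.norm_apply_le lam i
  nlinarith [sq_nonneg (‖lam‖ - 1), norm_nonneg lam]

lemma IsWeight.ibp {φ φ' : EuclideanSpace ℝ (Fin m) → ℝ} (h : IsWeight φ φ') (i : Fin m)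
    {A A' : EuclideanSpace ℝ (Fin m) → ℝ}
    (hA : ∀ lam, HasLineDerivAt ℝ A (A' lam) lam (EuclideanSpace.single i 1))
    (mA : Measurable A) (mA' : Measurable A') {C : ℝ} {q : ℕ}
    (bA : ∀ lam, |A lam| ≤ C * (1 + ‖lam‖ ^ 2) ^ q)
    (bA' : ∀ lam, |A' lam| ≤ C * (1 + ‖lam‖ ^ 2) ^ q) :
    Integrable (fun lam => A' lam * φ lam + A lam * lam i * φ' lam) ∧
    ∫ lam, (A' lam * φ lam + A lam * lam i * φ' lam) = 0 := by
  have i1 := integrable_of_poly_bound h.int mA bA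
  have i2 := integrable_of_poly_bound h.int mA' bA'
  have i3 : Integrable (fun lam => A lam * lam i * φ' lam) := by
    refine integrable_of_poly_bound (C := C) (q := q + 1) h.int' (mA.mul (by fun_prop)) (fun lam => ?_)
    rw [abs_mul, pow_succ, ← mul_assoc]
    have := bA lam
    have := abs_coord_le lam i
    have := abs_nonneg (A lam)
    exact mul_le_mul ‹_› ‹_› (abs_nonneg _) (by linarith)
  refine ⟨i2.add i3, ?_⟩
  have := integral_bilinear_hasLineDerivAt_right_eq_neg_left_of_integrable
    (μ := (volume : Measure (EuclideanSpace ℝ (Fin m))))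
    (f := fun _ : EuclideanSpace ℝ (Fin m) => (1:ℝ)) (f' := fun _ => 0)
    (g := fun lam => A lam * φ lam) (g' := fun lam => A' lam * φ lam + A lam * lam i * φ' lam)
    (v := EuclideanSpace.single i 1) (B := ContinuousLinearMap.mul ℝ ℝ) (by simp)
    (by simp only [ContinuousLinearMap.mul_apply', one_mul]; exact i2.add i3) (by simpa using i1)
    (fun x _ => by simpa [HasLineDerivAt] using hasDerivAt_const (0:ℝ) (1:ℝ))
    (fun x _ => by
      have h1 := hA x
      have h2 := h.deriv x i
      unfold HasLineDerivAt at *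
      refine (h1.mul h2).congr_deriv ?_
      simp; ring)
  simpa using this

/-- The line derivative of a coordinate. -/
lemma hasLineDerivAt_coord (lam : EuclideanSpace ℝ (Fin m)) (i j : Fin m) :
    HasLineDerivAt ℝ (fun x : EuclideanSpace ℝ (Fin m) => x j) (if j = i then 1 else 0) lam
      (EuclideanSpace.single i 1) := by
  unfold HasLineDerivAt
  have : (fun t : ℝ => (lam + t • EuclideanSpace.single i (1:ℝ)) j)
      = fun t => lam j + t * (if j = i then 1 else 0) := by
    ext t; simp
  rw [this]
  simpa using ((hasDerivAt_id (0:ℝ)).mul_const (if j = i then (1:ℝ) else 0)).const_add (lam j)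

lemma hasLineDerivAt_normSq (lam : EuclideanSpace ℝ (Fin m)) (i : Fin m) :
    HasLineDerivAt ℝ (fun x : EuclideanSpace ℝ (Fin m) => ‖x‖ ^ 2) (2 * lam i) lam
      (EuclideanSpace.single i 1) := by
  have h := (hasStrictFDerivAt_norm_sq lam).hasFDerivAt.hasLineDerivAt (EuclideanSpace.single i (1:ℝ))
  refine h.congr_deriv ?_
  simp [EuclideanSpace.inner_single_right]

lemma sum_coord_sq (lam : EuclideanSpace ℝ (Fin m)) : ∑ i, lam i * lam i = ‖lam‖ ^ 2 := by
  rw [EuclideanSpace.real_norm_sq_eq]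
  exact Finset.sum_congr rfl (fun i _ => (sq _).symm)

/-- Integration by parts against the first coordinate field. -/
lemma IsWeight.coord_identity {φ φ' : EuclideanSpace ℝ (Fin m) → ℝ} (h : IsWeight φ φ') (i0 : Fin m)
    (s : ℝ) :
    ∫ lam, (s * Real.cos (s * lam i0) * φ lam + lam i0 * Real.sin (s * lam i0) * φ' lam) = 0 := by
  have key := (h.ibp i0 (A := fun lam => Real.sin (s * lam i0))
    (A' := fun lam => s * Real.cos (s * lam i0)) (C := 1 + |s|) (q := 0) ?_ (by fun_prop) (by fun_prop)
    ?_ ?_).2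
  · rw [← key]
    congr 1; ext lam; ring
  · intro lam
    have h1 := hasLineDerivAt_coord lam i0 i0
    unfold HasLineDerivAt at *
    have := (h1.const_mul s).sin
    simpa [mul_comm] using this
  · intro lam
    have := Real.abs_sin_le_one (s * lam i0)
    have := abs_nonneg s
    simp; linarith
  · intro lam
    have h1 := Real.abs_cos_le_one (s * lam i0)
    have := abs_nonneg s
    rw [abs_mul]
    simp; nlinarith [abs_nonneg (Real.cos (s * lam i0))]

/-- Integration by parts against the Euler field. -/
lemma IsWeight.euler_identity {φ φ' : EuclideanSpace ℝ (Fin m) → ℝ} (h : IsWeight φ φ') (i0 : Fin m)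
    (s : ℝ) :
    ∫ lam, ((m * Real.cos (s * lam i0) - s * (lam i0 * Real.sin (s * lam i0))) * φ lam
      + ‖lam‖ ^ 2 * Real.cos (s * lam i0) * φ' lam) = 0 := by
  have key := fun i => h.ibp i (A := fun lam => lam i * Real.cos (s * lam i0))
    (A' := fun lam => Real.cos (s * lam i0) - (if i = i0 then s * (lam i0 * Real.sin (s * lam i0)) else 0))
    (C := 1 + |s|) (q := 1) ?_ (by fun_prop) ?_ ?_ ?_
  · have h2 := integral_finsetSum Finset.univ (fun i _ => (key i).1)
    rw [Finset.sum_congr rfl (fun i _ => (key i).2), Finset.sum_const_zero] at h2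
    rw [← h2]
    congr 1; ext lam
    rw [Finset.sum_add_distrib, ← Finset.sum_mul, ← Finset.sum_mul, Finset.sum_sub_distrib]
    simp only [Finset.sum_const, Finset.card_univ, Fintype.card_fin, nsmul_eq_mul,
      Finset.sum_ite_eq', Finset.mem_univ, if_true]
    rw [← sum_coord_sq lam, Finset.sum_mul]
    congr 2
    exact Finset.sum_congr rfl (fun i _ => by ring)
  · intro lam
    have h1 := hasLineDerivAt_coord lam i i0
    have h2 := hasLineDerivAt_coord lam i i
    unfold HasLineDerivAt at *
    refine (h2.mul (h1.const_mul s).cos).congr_deriv ?_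
    by_cases hi : i = i0
    · subst hi; simp; ring
    · have : ¬ i0 = i := fun h => hi h.symm
      simp [hi, this]
  · refine Measurable.sub (by fun_prop) ?_
    by_cases hi : i = i0
    · simp only [hi, if_true]; fun_prop
    · simp only [hi, if_false]; fun_prop
  · intro lam
    have h1 := Real.abs_cos_le_one (s * lam i0)
    have h2 := abs_coord_le lam i
    rw [abs_mul]
    have h3 := abs_nonneg s
    have : 0 ≤ |s| * (1 + ‖lam‖ ^ 2) := by positivity
    nlinarith [abs_nonneg (lam i), abs_nonneg (Real.cos (s * lam i0))]
  · intro lam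
    have h1 := Real.abs_cos_le_one (s * lam i0)
    have h4 := Real.abs_sin_le_one (s * lam i0)
    have h2 := abs_coord_le lam i0
    have h3 := abs_nonneg s
    have h5 : |lam i0 * Real.sin (s * lam i0)| ≤ 1 + ‖lam‖ ^ 2 := by
      rw [abs_mul]; nlinarith [abs_nonneg (lam i0)]
    have h6 : |s * (lam i0 * Real.sin (s * lam i0))| ≤ |s| * (1 + ‖lam‖ ^ 2) := by
      rw [abs_mul]; gcongr
    refine (abs_sub _ _).trans ?_
    split_ifs
    · nlinarith [sq_nonneg ‖lam‖]
    · simp only [abs_zero]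
      have : 0 ≤ |s| * (1 + ‖lam‖ ^ 2) := by positivity
      nlinarith [sq_nonneg ‖lam‖]

/-- Integration by parts against the field `|λ|² e₁ - λ₁ λ`, which is tangent to spheres. -/
lemma IsWeight.rotation_identity {φ φ' : EuclideanSpace ℝ (Fin m) → ℝ} (h : IsWeight φ φ') (i0 : Fin m)
    (s : ℝ) :
    ∫ lam, (s * ((‖lam‖ ^ 2 - lam i0 ^ 2) * Real.cos (s * lam i0))
      - (m - 1) * (lam i0 * Real.sin (s * lam i0))) * φ lam = 0 := by
  have key := fun i => h.ibp i
    (A := fun lam => ((if i = i0 then ‖lam‖ ^ 2 else 0) - lam i0 * lam i) * Real.sin (s * lam i0))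
    (A' := fun lam => ((if i = i0 then lam i0 else 0) - lam i0) * Real.sin (s * lam i0) +
      (if i = i0 then (‖lam‖ ^ 2 - lam i0 ^ 2) * (s * Real.cos (s * lam i0)) else 0))
    (C := 2 + 2 * |s|) (q := 2) ?_ ?_ ?_ ?_ ?_
  · have h2 := integral_finsetSum Finset.univ (fun i _ => (key i).1)
    rw [Finset.sum_congr rfl (fun i _ => (key i).2), Finset.sum_const_zero] at h2
    rw [← h2]
    congr 1; ext lam
    rw [Finset.sum_add_distrib, ← Finset.sum_mul, ← Finset.sum_mul, Finset.sum_add_distrib,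
      ← Finset.sum_mul, Finset.sum_sub_distrib]
    have : ∑ i, ((if i = i0 then ‖lam‖ ^ 2 else 0) - lam i0 * lam i) * Real.sin (s * lam i0) * lam i
        = 0 := by
      have e : ∀ i, ((if i = i0 then ‖lam‖ ^ 2 else 0) - lam i0 * lam i) * Real.sin (s * lam i0) * lam i
        = (if i = i0 then ‖lam‖ ^ 2 * Real.sin (s * lam i0) * lam i0 else 0)
          - lam i0 * Real.sin (s * lam i0) * (lam i * lam i) := by
        intro i
        split_ifs with hi
        · subst hi; ring
        · ring
      rw [Finset.sum_congr rfl (fun i _ => e i), Finset.sum_sub_distrib, ← Finset.mul_sum, sum_coord_sq]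
      simp; ring
    rw [this]
    simp only [Finset.sum_const, Finset.card_univ, Fintype.card_fin, nsmul_eq_mul,
      Finset.sum_ite_eq', Finset.mem_univ, if_true]
    ring
  · intro lam
    have h1 := hasLineDerivAt_coord lam i i0
    have h2 := hasLineDerivAt_coord lam i i
    have h3 := hasLineDerivAt_normSq lam i
    unfold HasLineDerivAt at *
    by_cases hi : i = i0
    · subst hi
      simp only [if_true]
      refine ((h3.sub (h1.mul h2)).mul (h1.const_mul s).sin).congr_deriv ?_
      simp; ring
    · have : ¬ i0 = i := fun h => hi h.symm
      simp only [hi, if_false]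
      refine (((hasDerivAt_const (0:ℝ) (0:ℝ)).sub (h1.mul h2)).mul (h1.const_mul s).sin).congr_deriv ?_
      simp [this]
  · by_cases hi : i = i0
    · simp only [hi, if_true]; fun_prop
    · simp only [hi, if_false]; fun_prop
  · by_cases hi : i = i0
    · simp only [hi, if_true]; fun_prop
    · simp only [hi, if_false]; fun_prop
  · intro lam
    have h4 := Real.abs_sin_le_one (s * lam i0)
    have h2 := abs_coord_le lam i0
    have h2' := abs_coord_le lam i
    have h3 := abs_nonneg s
    have h5 : |lam i0 * lam i| ≤ (1 + ‖lam‖ ^ 2) ^ 2 := by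
      rw [abs_mul, sq]; gcongr
    have h6 : |(if i = i0 then ‖lam‖ ^ 2 else 0 : ℝ)| ≤ (1 + ‖lam‖ ^ 2) ^ 2 := by
      split_ifs
      · rw [abs_of_nonneg (by positivity)]; nlinarith [sq_nonneg ‖lam‖]
      · simp; positivity
    have h7 := (abs_sub (if i = i0 then ‖lam‖ ^ 2 else 0 : ℝ) (lam i0 * lam i))
    rw [abs_mul]
    have : 0 ≤ |s| * (1 + ‖lam‖ ^ 2) ^ 2 := by positivity
    nlinarith [abs_nonneg ((if i = i0 then ‖lam‖ ^ 2 else 0 : ℝ) - lam i0 * lam i),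
      abs_nonneg (Real.sin (s * lam i0))]
  · intro lam
    have h4 := Real.abs_sin_le_one (s * lam i0)
    have h4' := Real.abs_cos_le_one (s * lam i0)
    have h2 := abs_coord_le lam i0
    have h3 := abs_nonneg s
    have hz : 1 + ‖lam‖ ^ 2 ≤ (1 + ‖lam‖ ^ 2) ^ 2 := by nlinarith [sq_nonneg ‖lam‖]
    have h5 : |(if i = i0 then lam i0 else 0) - lam i0| ≤ (1 + ‖lam‖ ^ 2) ^ 2 := by
      split_ifs
      · simp; positivity
      · simpa using h2.trans hz
    have h6 : |(‖lam‖ ^ 2 - lam i0 ^ 2)| ≤ 2 * (1 + ‖lam‖ ^ 2) ^ 2 := by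
      have e : lam i0 ^ 2 ≤ (1 + ‖lam‖ ^ 2) ^ 2 := by
        rw [← sq_abs]; gcongr
      rw [abs_le]; constructor <;> nlinarith [sq_nonneg ‖lam‖, sq_nonneg (lam i0)]
    have h7 : |(if i = i0 then (‖lam‖ ^ 2 - lam i0 ^ 2) * (s * Real.cos (s * lam i0)) else 0)|
        ≤ 2 * (1 + ‖lam‖ ^ 2) ^ 2 * |s| := by
      split_ifs
      · rw [abs_mul, abs_mul]
        refine mul_le_mul h6 ?_ (by positivity) (by positivity)
        nlinarith [abs_nonneg (Real.cos (s * lam i0))]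
      · simp; positivity
    refine (abs_add_le _ _).trans ?_
    rw [abs_mul]
    nlinarith [abs_nonneg ((if i = i0 then lam i0 else 0) - lam i0),
      abs_nonneg (Real.sin (s * lam i0))]

/-- The logarithmic Euler derivative `r f'(r)/f(r)` of the profile `fr`. -/
noncomputable def logEuler (n : ℕ) (R r : ℝ) : ℝ :=
  -R * (psi r - psi r ^ 2 + r ^ 2) + n * (1 - psi r)

lemma hasDerivAt_psi {r : ℝ} (hr : r ≠ 0) :
    HasDerivAt psi ((psi r - psi r ^ 2 + r ^ 2) / r) r := by
  have hs : Real.sinh r ≠ 0 := Real.sinh_ne_zero.mpr hr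
  have h := ((hasDerivAt_id r).mul (Real.hasDerivAt_cosh r)).div (Real.hasDerivAt_sinh r) hs
  refine (h.congr_of_eventuallyEq ?_).congr_deriv ?_
  · filter_upwards [isOpen_ne.mem_nhds hr] with x hx
    simp only [psi, if_neg hx]; rfl
  · simp only [psi, if_neg hr, id]
    field_simp
    simp
    ring

lemma hasDerivAt_rs {r : ℝ} (hr : r ≠ 0) :
    HasDerivAt rs (rs r * (1 - psi r) / r) r := by
  have hs : Real.sinh r ≠ 0 := Real.sinh_ne_zero.mpr hr
  have h := (hasDerivAt_id r).div (Real.hasDerivAt_sinh r) hs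
  refine (h.congr_of_eventuallyEq ?_).congr_deriv ?_
  · filter_upwards [isOpen_ne.mem_nhds hr] with x hx
    simp only [rs, if_neg hx]; rfl
  · simp only [psi, rs, if_neg hr, id]
    field_simp

lemma hasDerivAt_fr (n : ℕ) (R : ℝ) {r : ℝ} (hr : r ≠ 0) :
    HasDerivAt (fr n R) (fr n R r * logEuler n R r / r) r := by
  have h := (((hasDerivAt_psi hr).const_mul R).neg.exp).mul ((hasDerivAt_rs hr).pow n)
  refine h.congr_deriv ?_
  have hp := rs_pos r
  have e : (-fun y => R * psi y) r = -(R * psi r) := rfl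
  simp only [fr, logEuler, Pi.pow_apply, e]
  rcases Nat.eq_zero_or_pos n with rfl | hn
  · simp; ring
  · obtain ⟨k, rfl⟩ : ∃ k, n = k + 1 := ⟨n - 1, by omega⟩
    simp only [Nat.add_sub_cancel, pow_succ]
    field_simp

lemma exp_neg_sq_le_rs (r : ℝ) : Real.exp (-(r ^ 2 / 2)) ≤ rs r := by
  have h1 : psi r = rs r * Real.cosh r := by
    unfold psi rs; split_ifs with h
    · simp [h]
    · ring
  have h2 := one_le_psi r
  have h3 := Real.cosh_le_exp_half_sq r
  have h4 := rs_pos r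
  rw [Real.exp_neg, inv_le_iff_one_le_mul₀ (Real.exp_pos _)]
  calc 1 ≤ psi r := h2
    _ = rs r * Real.cosh r := h1
    _ ≤ _ := by gcongr

lemma abs_logEuler_le (n : ℕ) {R : ℝ} (hR : 0 ≤ R) (r : ℝ) :
    |logEuler n R r| ≤ (2 * R + n) * (1 + r ^ 2) * r ^ 2 := by
  have h1 := one_le_psi r
  have h2 := psi_le r
  have hn : (0:ℝ) ≤ n := Nat.cast_nonneg n
  have a1 : |1 - psi r| ≤ r ^ 2 := by rw [abs_le]; constructor <;> linarith
  have a2 : |psi r - psi r ^ 2 + r ^ 2| ≤ 2 * (1 + r ^ 2) * r ^ 2 := by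
    rw [abs_le]; constructor <;> nlinarith [sq_nonneg r, mul_nonneg (sq_nonneg r) (sq_nonneg r)]
  unfold logEuler
  refine (abs_add_le _ _).trans ?_
  rw [abs_mul, abs_mul, abs_neg, abs_of_nonneg hR, Nat.abs_cast]
  have : R * |psi r - psi r ^ 2 + r ^ 2| ≤ R * (2 * (1 + r ^ 2) * r ^ 2) := by gcongr
  have : n * |1 - psi r| ≤ n * r ^ 2 := by gcongr
  have : n * r ^ 2 ≤ n * (1 + r^2) * r ^ 2 := by
    have : 0 ≤ n * (r ^ 2 * r ^ 2) := by positivity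
    nlinarith
  linarith

lemma measurable_psi : Measurable psi :=
  Measurable.ite (measurableSet_singleton 0) measurable_const
    (by fun_prop)

lemma measurable_rs : Measurable rs :=
  Measurable.ite (measurableSet_singleton 0) measurable_const (by fun_prop)

lemma measurable_fr (n : ℕ) (R : ℝ) : Measurable (fr n R) :=
  ((measurable_psi.const_mul R).neg.exp).mul (measurable_rs.pow_const n)

lemma hasLineDerivAt_fr (n : ℕ) {R : ℝ} (hR : 0 ≤ R) (lam : EuclideanSpace ℝ (Fin m)) (i : Fin m) :
    HasLineDerivAt ℝ (fun x : EuclideanSpace ℝ (Fin m) => fr n R ‖x‖)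
      (lam i * (fr n R ‖lam‖ * logEuler n R ‖lam‖ / ‖lam‖ ^ 2)) lam (EuclideanSpace.single i 1) := by
  by_cases h0 : lam = 0
  · subst h0
    unfold HasLineDerivAt
    have e : (fun t : ℝ => fr n R ‖(0 : EuclideanSpace ℝ (Fin m)) + t • EuclideanSpace.single i (1:ℝ)‖)
        = fun t => fr n R |t| := by
      ext t; simp [norm_smul]
    rw [e]
    simp only [PiLp.zero_apply, zero_mul]
    rw [hasDerivAt_iff_isLittleO]
    have hO : (fun t : ℝ => fr n R |t| - fr n R |0| - (t - 0) • (0:ℝ)) =O[𝓝 0] fun t => t ^ 2 := by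
      refine Asymptotics.IsBigO.of_bound (Real.exp (-R) * (R + n / 2)) (Eventually.of_forall fun t => ?_)
      have f0 : fr n R |0| = Real.exp (-R) := by simp [fr, psi, rs]
      have h1 : fr n R |t| ≤ Real.exp (-R) := by
        have := pow_le_one₀ (n := n) (rs_nonneg |t|) (rs_le_one |t|)
        have h2 : Real.exp (-(R * psi |t|)) ≤ Real.exp (-R) := by
          rw [Real.exp_le_exp]; nlinarith [one_le_psi |t|]
        calc fr n R |t| ≤ Real.exp (-R) * 1 := mul_le_mul h2 this (pow_nonneg (rs_nonneg _) _) (Real.exp_pos _).le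
          _ = _ := mul_one _
      have h2 : Real.exp (-R) * (1 - (R + n / 2) * t ^ 2) ≤ fr n R |t| := by
        have e1 : Real.exp (-R) * Real.exp (-((R + n / 2) * t ^ 2)) ≤ fr n R |t| := by
          have : Real.exp (-R) * Real.exp (-((R + n / 2) * t ^ 2))
              = Real.exp (-(R * (1 + t ^ 2))) * Real.exp (-(t ^ 2 / 2)) ^ n := by
            rw [← Real.exp_nat_mul, ← Real.exp_add, ← Real.exp_add]; congr 1; ring
          rw [this]
          unfold fr
          have a := exp_neg_sq_le_rs |t|
          have b := psi_le |t|
          rw [sq_abs] at a b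
          gcongr
        refine le_trans ?_ e1
        gcongr
        linarith [Real.add_one_le_exp (-((R + n / 2) * t ^ 2))]
      rw [f0, smul_zero, sub_zero, Real.norm_eq_abs, Real.norm_of_nonneg (sq_nonneg t), abs_le]
      have : 0 ≤ Real.exp (-R) * (R + n / 2) * t ^ 2 := by positivity
      constructor <;> nlinarith
    have ho : (fun t : ℝ => t ^ 2) =o[𝓝 0] fun t : ℝ => t - 0 := by
      simpa using Asymptotics.isLittleO_pow_id (𝕜 := ℝ) (n := 2) (by norm_num)
    exact hO.trans_isLittleO ho
  · have hr : ‖lam‖ ≠ 0 := norm_ne_zero_iff.mpr h0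
    have h1 := hasLineDerivAt_normSq lam i
    have h3 : HasLineDerivAt ℝ (fun x : EuclideanSpace ℝ (Fin m) => ‖x‖) (lam i / ‖lam‖) lam
        (EuclideanSpace.single i 1) := by
      unfold HasLineDerivAt at *
      have h2 := h1.sqrt (by simpa using hr)
      simp only [Real.sqrt_sq (norm_nonneg _)] at h2
      refine h2.congr_deriv ?_
      simp
      field_simp
    unfold HasLineDerivAt at *
    have h4 : HasDerivAt (fr n R) (fr n R ‖lam‖ * logEuler n R ‖lam‖ / ‖lam‖)
        ‖lam + (0:ℝ) • EuclideanSpace.single i (1:ℝ)‖ := by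
      simpa using hasDerivAt_fr n R hr
    refine (h4.comp (0:ℝ) h3).congr_deriv ?_
    field_simp

lemma isWeight_fr {n : ℕ} (hn : 1 ≤ n) {R : ℝ} (hR : 0 ≤ R) :
    IsWeight (m := m) (fun lam => fr n R ‖lam‖)
      (fun lam => fr n R ‖lam‖ * logEuler n R ‖lam‖ / ‖lam‖ ^ 2) := by
  have hInt : ∀ q : ℕ, Integrable (fun lam : EuclideanSpace ℝ (Fin m) => (1 + ‖lam‖ ^ 2) ^ q * fr n R ‖lam‖) := by
    intro q
    refine (integrable_maj m q).mono' ?_ (Eventually.of_forall fun x => ?_)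
    · have := measurable_fr n R
      exact (Measurable.mul (by fun_prop) (this.comp measurable_norm)).aestronglyMeasurable
    · have := (fr_pos n R ‖x‖).le
      rw [Real.norm_of_nonneg (by positivity)]
      exact fr_weight_le_maj hn hR x
  refine ⟨fun lam i => hasLineDerivAt_fr n hR lam i, hInt, fun q => ?_⟩
  have := integrable_of_poly_bound (C := 2 * R + n) (q := q + 1) hInt
    (A := fun lam => (1 + ‖lam‖ ^ 2) ^ q * (logEuler n R ‖lam‖ / ‖lam‖ ^ 2)) ?_ ?_
  · refine this.congr (Eventually.of_forall fun x => ?_)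
    simp only; ring
  · refine Measurable.mul (by fun_prop) (Measurable.div ?_ (by fun_prop))
    have h1 : Measurable (logEuler n R) := by
      have := measurable_psi
      unfold logEuler
      fun_prop
    exact h1.comp measurable_norm
  · intro lam
    have h1 := abs_logEuler_le n hR ‖lam‖
    rw [abs_mul, abs_of_nonneg (by positivity : 0 ≤ (1 + ‖lam‖ ^ 2) ^ q), abs_div,
      abs_of_nonneg (by positivity : 0 ≤ ‖lam‖ ^ 2), show (2 * R + n) * (1 + ‖lam‖ ^ 2) ^ (q + 1)
        = (1 + ‖lam‖ ^ 2) ^ q * ((2 * R + n) * (1 + ‖lam‖ ^ 2)) by ring]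
    gcongr
    by_cases h : ‖lam‖ = 0
    · simp [h]; positivity
    · rwa [div_le_iff₀ (by positivity)]

/-- Cosine transform of `psi^k * fr`. -/
noncomputable def cosI (n : ℕ) (i0 : Fin m) (R s : ℝ) (k : ℕ) : ℝ :=
  ∫ lam : EuclideanSpace ℝ (Fin m), Real.cos (s * lam i0) * psi ‖lam‖ ^ k * fr n R ‖lam‖

/-- Minus the `s`-derivative of the cosine transform of `fr`. -/
noncomputable def sinI (n : ℕ) (i0 : Fin m) (R s : ℝ) : ℝ :=
  ∫ lam : EuclideanSpace ℝ (Fin m), lam i0 * Real.sin (s * lam i0) * fr n R ‖lam‖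

/-- Minus the second `s`-derivative of the cosine transform of `fr`. -/
noncomputable def cosI2 (n : ℕ) (i0 : Fin m) (R s : ℝ) : ℝ :=
  ∫ lam : EuclideanSpace ℝ (Fin m), lam i0 ^ 2 * Real.cos (s * lam i0) * fr n R ‖lam‖

lemma integrable_cosI {n : ℕ} (hn : 1 ≤ n) (i0 : Fin m) {R : ℝ} (hR : 0 ≤ R) (s : ℝ) (k : ℕ) :
    Integrable (fun lam : EuclideanSpace ℝ (Fin m) =>
      Real.cos (s * lam i0) * psi ‖lam‖ ^ k * fr n R ‖lam‖) := by
  refine integrable_of_poly_bound (C := 1) (q := k) (isWeight_fr hn hR).int ?_ (fun lam => ?_)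
  · exact Measurable.mul (by fun_prop) ((measurable_psi.comp measurable_norm).pow_const k)
  · have h1 := one_le_psi ‖lam‖
    rw [abs_mul, abs_of_nonneg (a := psi ‖lam‖ ^ k) (by positivity)]
    gcongr
    · exact Real.abs_cos_le_one _
    · exact psi_le _

lemma integrable_sinI {n : ℕ} (hn : 1 ≤ n) (i0 : Fin m) {R : ℝ} (hR : 0 ≤ R) (s : ℝ) :
    Integrable (fun lam : EuclideanSpace ℝ (Fin m) =>
      lam i0 * Real.sin (s * lam i0) * fr n R ‖lam‖) := by
  refine integrable_of_poly_bound (C := 1) (q := 1) (isWeight_fr hn hR).int (by fun_prop) (fun lam => ?_)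
  have h1 := abs_coord_le lam i0
  have h2 := Real.abs_sin_le_one (s * lam i0)
  rw [abs_mul, pow_one, mul_comm, mul_comm 1]
  rw [mul_comm (1 + _)]
  exact mul_le_mul h2 h1 (abs_nonneg _) zero_le_one

lemma integrable_cosI2 {n : ℕ} (hn : 1 ≤ n) (i0 : Fin m) {R : ℝ} (hR : 0 ≤ R) (s : ℝ) :
    Integrable (fun lam : EuclideanSpace ℝ (Fin m) =>
      lam i0 ^ 2 * Real.cos (s * lam i0) * fr n R ‖lam‖) := by
  refine integrable_of_poly_bound (C := 1) (q := 2) (isWeight_fr hn hR).int (by fun_prop) (fun lam => ?_)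
  have h1 := abs_coord_le lam i0
  have h2 := Real.abs_cos_le_one (s * lam i0)
  rw [abs_mul, abs_pow, mul_comm]
  exact mul_le_mul h2 (pow_le_pow_left₀ (abs_nonneg _) h1 2) (by positivity) zero_le_one

lemma integrable_cosZ {n : ℕ} (hn : 1 ≤ n) (i0 : Fin m) {R : ℝ} (hR : 0 ≤ R) (s : ℝ) :
    Integrable (fun lam : EuclideanSpace ℝ (Fin m) =>
      ‖lam‖ ^ 2 * Real.cos (s * lam i0) * fr n R ‖lam‖) := by
  refine integrable_of_poly_bound (C := 1) (q := 1) (isWeight_fr hn hR).int (by fun_prop) (fun lam => ?_)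
  have h2 := Real.abs_cos_le_one (s * lam i0)
  rw [abs_mul, mul_comm, abs_of_nonneg (by positivity : 0 ≤ ‖lam‖ ^ 2), pow_one]
  exact mul_le_mul h2 (by linarith) (by positivity) zero_le_one

/-- The heat equation for the radial heat kernel, on the Fourier side. -/
lemma heat_identity {n : ℕ} (hn : 1 ≤ n) (i0 : Fin m) {R s : ℝ} (hR : 0 ≤ R) (hs : s ≠ 0) :
    R * cosI n i0 R s 2 = s * sinI n i0 R s - (m + n) * cosI n i0 R s 0 + R * cosI n i0 R s 1
      + n * cosI n i0 R s 1 + R * cosI2 n i0 R s + R * (m - 1) / s * sinI n i0 R s := by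
  have hw := isWeight_fr (m := m) hn hR
  have h1 := hw.euler_identity i0 s
  have h2 := hw.rotation_identity i0 s
  have c0 := integrable_cosI hn i0 hR s 0
  have c1 := integrable_cosI hn i0 hR s 1
  have c2 := integrable_cosI hn i0 hR s 2
  have d0 := integrable_sinI hn i0 hR s
  have d2 := integrable_cosI2 hn i0 hR s
  have dz := integrable_cosZ hn i0 hR s
  set Z := ∫ lam : EuclideanSpace ℝ (Fin m), ‖lam‖ ^ 2 * Real.cos (s * lam i0) * fr n R ‖lam‖ with hZ
  have e2 : s * (Z - cosI2 n i0 R s) - (m - 1) * sinI n i0 R s = 0 := by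
    rw [← h2, hZ, cosI2, sinI, ← integral_sub dz d2, ← integral_const_mul, ← integral_const_mul,
      ← integral_sub]
    · congr 1; ext lam; ring
    · exact (dz.sub d2).const_mul s
    · exact d0.const_mul _
  have e1 : m * cosI n i0 R s 0 - s * sinI n i0 R s
      - R * cosI n i0 R s 1 + R * cosI n i0 R s 2 - R * Z + n * cosI n i0 R s 0
      - n * cosI n i0 R s 1 = 0 := by
    rw [← h1, hZ, cosI, cosI, cosI, sinI]
    simp only [← integral_const_mul]
    rw [← integral_sub (c0.const_mul _) (d0.const_mul _), ← integral_sub, ← integral_add, ← integral_sub,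
      ← integral_add, ← integral_sub]
    · congr 1; ext lam
      by_cases h : ‖lam‖ = 0
      · simp [h, psi]; ring
      · simp only [logEuler]
        field_simp
        ring
    · exact (((((c0.const_mul _).sub (d0.const_mul _)).sub (c1.const_mul _)).add (c2.const_mul _)).sub
        (dz.const_mul _)).add (c0.const_mul _)
    · exact c1.const_mul _
    · exact ((((c0.const_mul _).sub (d0.const_mul _)).sub (c1.const_mul _)).add (c2.const_mul _)).sub
        (dz.const_mul _)
    · exact c0.const_mul _
    · exact (((c0.const_mul _).sub (d0.const_mul _)).sub (c1.const_mul _)).add (c2.const_mul _)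
    · exact dz.const_mul _
    · exact ((c0.const_mul _).sub (d0.const_mul _)).sub (c1.const_mul _)
    · exact c2.const_mul _
    · exact (c0.const_mul _).sub (d0.const_mul _)
    · exact c1.const_mul _
  have e3 : Z = cosI2 n i0 R s + (m - 1) * sinI n i0 R s / s := by
    field_simp
    linarith
  rw [e3] at e1
  have : R * (m - 1) / s * sinI n i0 R s = R * ((m - 1) * sinI n i0 R s / s) := by ring
  rw [this]
  linarith

/-- The common integrand of the functions `pT`. -/
lemma pT_integrand (n k₁ k₂ : ℕ) (i0 : Fin m) (R s : ℝ) (lam : EuclideanSpace ℝ (Fin m)) :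
    (if lam = 0 then (if k₂ = 0 then Complex.exp (-((R : ℝ) : ℂ)) else 0)
      else
        Complex.exp (Complex.I * (s : ℂ) * ((lam i0 : ℝ) : ℂ)
            - ((R * ‖lam‖ * Real.cosh ‖lam‖ / Real.sinh ‖lam‖ : ℝ) : ℂ)) *
          (((‖lam‖ : ℝ) : ℂ) ^ (n + k₁) * ((Real.cosh ‖lam‖ : ℝ) : ℂ) ^ k₁
            / ((Real.sinh ‖lam‖ : ℝ) : ℂ) ^ (n + k₁)) *
          ((lam i0 : ℝ) : ℂ) ^ k₂) =
    Complex.exp (((s * lam i0 : ℝ) : ℂ) * Complex.I) *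
      ((psi ‖lam‖ ^ k₁ * fr n R ‖lam‖ * lam i0 ^ k₂ : ℝ) : ℂ) := by
  by_cases h : lam = 0
  · subst h
    rcases Nat.eq_zero_or_pos k₂ with rfl | hk
    · simp [psi, fr, rs]
    · have : k₂ ≠ 0 := by omega
      simp [this]
  · have hr : ‖lam‖ ≠ 0 := norm_ne_zero_iff.mpr h
    have hs : (Real.sinh ‖lam‖) ≠ 0 := Real.sinh_ne_zero.mpr hr
    have hsC : ((Real.sinh ‖lam‖ : ℝ) : ℂ) ≠ 0 := by exact_mod_cast hs
    rw [if_neg h, Complex.exp_sub]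
    simp only [psi, fr, rs, if_neg hr]
    rw [Real.exp_neg, show R * (‖lam‖ * Real.cosh ‖lam‖ / Real.sinh ‖lam‖)
      = R * ‖lam‖ * Real.cosh ‖lam‖ / Real.sinh ‖lam‖ by ring]
    rw [← Complex.ofReal_exp]
    push_cast [-Complex.ofReal_sinh, -Complex.ofReal_cosh, -Complex.ofReal_exp]
    rw [show Complex.I * (s:ℂ) * (lam i0 : ℂ) = (s:ℂ) * (lam i0 : ℂ) * Complex.I by ring]
    simp only [div_pow, pow_add, mul_pow]
    field_simp

lemma integrable_pT_integrand {n : ℕ} (hn : 1 ≤ n) (k₁ k₂ : ℕ) (i0 : Fin m) {R : ℝ} (hR : 0 ≤ R) (s : ℝ) :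
    Integrable (fun lam : EuclideanSpace ℝ (Fin m) => Complex.exp (((s * lam i0 : ℝ) : ℂ) * Complex.I) *
      ((psi ‖lam‖ ^ k₁ * fr n R ‖lam‖ * lam i0 ^ k₂ : ℝ) : ℂ)) := by
  have h : Integrable (fun lam : EuclideanSpace ℝ (Fin m) =>
      (psi ‖lam‖ ^ k₁ * lam i0 ^ k₂) * fr n R ‖lam‖) := by
    refine integrable_of_poly_bound (C := 1) (q := k₁ + k₂) (isWeight_fr hn hR).int ?_ (fun lam => ?_)
    · exact Measurable.mul ((measurable_psi.comp measurable_norm).pow_const _) (by fun_prop)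
    · have h1 := one_le_psi ‖lam‖
      rw [abs_mul, abs_of_nonneg (a := psi ‖lam‖ ^ k₁) (by positivity), abs_pow, pow_add, one_mul]
      gcongr
      · exact psi_le _
      · exact abs_coord_le lam i0
  refine (h.ofReal (𝕜 := ℂ)).mono ?_ (Eventually.of_forall fun x => ?_)
  · refine AEStronglyMeasurable.mul (by fun_prop) ?_
    refine (h.ofReal (𝕜 := ℂ)).aestronglyMeasurable.congr (Eventually.of_forall fun x => ?_)
    simp; ring
  · rw [norm_mul, Complex.norm_exp_ofReal_mul_I, one_mul]
    apply le_of_eq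
    congr 1
    simp; ring

/-- The normalising constant in `pT`. -/
noncomputable def pTconst (n m : ℕ) : ℝ := (4 * Real.pi) ^ n * (2 * Real.pi) ^ m

lemma pTconst_pos (n m : ℕ) : 0 < pTconst n m := by
  have := Real.pi_pos
  unfold pTconst; positivity

lemma pT_eq {n : ℕ} (k₁ k₂ : ℕ) (hm : 0 < m)
    (x : EuclideanSpace ℝ (Fin (2 * n))) (t : EuclideanSpace ℝ (Fin m)) :
    pT n m k₁ k₂ hm x t = ((-1 : ℂ) ^ k₁ * Complex.I ^ k₂) * (((pTconst n m)⁻¹ : ℝ) : ℂ) *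
      ∫ lam : EuclideanSpace ℝ (Fin m), Complex.exp (((‖t‖ * lam ⟨0, hm⟩ : ℝ) : ℂ) * Complex.I) *
      ((psi ‖lam‖ ^ k₁ * fr n (‖x‖ ^ 2 / 4) ‖lam‖ * lam ⟨0, hm⟩ ^ k₂ : ℝ) : ℂ) := by
  rw [pT]
  simp only [pT_integrand]
  congr 1
  rw [div_eq_mul_inv]
  congr 1
  simp [pTconst]

lemma re_exp_mul_I (a b : ℝ) : (Complex.exp ((a : ℂ) * Complex.I) * (b : ℂ)).re = Real.cos a * b := by
  rw [Complex.mul_re, Complex.exp_ofReal_mul_I_re]; simp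

lemma im_exp_mul_I (a b : ℝ) : (Complex.exp ((a : ℂ) * Complex.I) * (b : ℂ)).im = Real.sin a * b := by
  rw [Complex.mul_im, Complex.exp_ofReal_mul_I_im]; simp

lemma pT_re_zero {n : ℕ} (hn : 1 ≤ n) (k : ℕ) (hm : 0 < m)
    (x : EuclideanSpace ℝ (Fin (2 * n))) (t : EuclideanSpace ℝ (Fin m)) :
    (pT n m k 0 hm x t).re = (-1) ^ k * (pTconst n m)⁻¹ * cosI n ⟨0, hm⟩ (‖x‖ ^ 2 / 4) ‖t‖ k := by
  have h := integrable_pT_integrand hn k 0 (⟨0, hm⟩ : Fin m) (R := ‖x‖ ^ 2 / 4) (by positivity) ‖t‖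
  rw [pT_eq, pow_zero, mul_one, show ((-1 : ℂ) ^ k) = (((-1 : ℝ) ^ k : ℝ) : ℂ) by push_cast; rfl,
    ← Complex.ofReal_mul, Complex.re_ofReal_mul, cosI]
  congr 1
  have h2 := integral_re h
  simp only [RCLike.re_to_complex, re_exp_mul_I] at h2
  rw [← h2]
  congr 1; ext lam; simp; ring

lemma pT_re_one {n : ℕ} (hn : 1 ≤ n) (hm : 0 < m)
    (x : EuclideanSpace ℝ (Fin (2 * n))) (t : EuclideanSpace ℝ (Fin m)) :
    (pT n m 0 1 hm x t).re = -(pTconst n m)⁻¹ * sinI n ⟨0, hm⟩ (‖x‖ ^ 2 / 4) ‖t‖ := by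
  have h := integrable_pT_integrand hn 0 1 (⟨0, hm⟩ : Fin m) (R := ‖x‖ ^ 2 / 4) (by positivity) ‖t‖
  rw [pT_eq, pow_zero, one_mul, pow_one, mul_comm Complex.I, mul_assoc, Complex.re_ofReal_mul, sinI,
    Complex.I_mul_re, neg_mul, mul_neg]
  congr 2
  have h2 := integral_im h
  simp only [RCLike.im_to_complex, im_exp_mul_I] at h2
  rw [← h2]
  congr 1; ext lam; simp; ring

lemma pT_re_two {n : ℕ} (hn : 1 ≤ n) (hm : 0 < m)
    (x : EuclideanSpace ℝ (Fin (2 * n))) (t : EuclideanSpace ℝ (Fin m)) :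
    (pT n m 0 2 hm x t).re = -(pTconst n m)⁻¹ * cosI2 n ⟨0, hm⟩ (‖x‖ ^ 2 / 4) ‖t‖ := by
  have h := integrable_pT_integrand hn 0 2 (⟨0, hm⟩ : Fin m) (R := ‖x‖ ^ 2 / 4) (by positivity) ‖t‖
  rw [pT_eq, pow_zero, one_mul, Complex.I_sq, neg_one_mul, ← Complex.ofReal_neg,
    Complex.re_ofReal_mul, cosI2]
  congr 1
  have h2 := integral_re h
  simp only [RCLike.re_to_complex, re_exp_mul_I] at h2
  rw [← h2]
  congr 1; ext lam; simp; ring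

/-- The potential expressed through the logarithmic derivatives `α = 1 + ∂_R log p` and
`β = -∂_s log p`. -/
lemma four_potV {n : ℕ} (hn : 1 ≤ n) (hm : 0 < m)
    (x : EuclideanSpace ℝ (Fin (2 * n))) (t : EuclideanSpace ℝ (Fin m)) (hx : x ≠ 0) (ht : t ≠ 0)
    {R s α β : ℝ} (hR : R = ‖x‖ ^ 2 / 4) (hs : s = ‖t‖)
    (hp : 0 < cosI n ⟨0, hm⟩ R s 0)
    (hα : cosI n ⟨0, hm⟩ R s 1 = (1 - α) * cosI n ⟨0, hm⟩ R s 0)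
    (hβ : sinI n ⟨0, hm⟩ R s = β * cosI n ⟨0, hm⟩ R s 0) :
    4 * potV n m hm x t = R - R * α ^ 2 - R * β ^ 2 + 2 * s * β - 2 * (n + m)
      + 4 * R * (m - 1) * β / s := by
  have hx' : 0 < ‖x‖ := norm_pos_iff.mpr hx
  have ht' : 0 < ‖t‖ := norm_pos_iff.mpr ht
  have hR0 : 0 < R := by rw [hR]; positivity
  have hs0 : 0 < s := by rw [hs]; exact ht'
  have hheat := heat_identity hn ⟨0, hm⟩ hR0.le hs0.ne'
  unfold potV
  rw [pT_re_zero hn, pT_re_zero hn, pT_re_zero hn, pT_re_one hn, pT_re_two hn, ← hR, ← hs]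
  rw [hα, hβ] at *
  set p := cosI n ⟨0, hm⟩ R s 0
  set K := pTconst n m
  have hK : 0 < K := pTconst_pos n m
  have e2 : cosI n ⟨0, hm⟩ R s 2 = cosI2 n ⟨0, hm⟩ R s + (s * (β * p) - (m + n) * p + R * ((1 - α) * p)
      + n * ((1 - α) * p) + R * (m - 1) / s * (β * p)) / R := by
    field_simp
    field_simp at hheat
    linarith
  rw [e2]
  field_simp
  ring

lemma le_psi (r : ℝ) : 1 + 2 * r ^ 2 / (r ^ 2 + ck 0) ≤ psi r := by
  have h := (psiN_mono (sq_nonneg r)).ge_of_tendsto (tendsto_psiN r) 1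
  simpa [psiN] using h

lemma integrable_fr {n : ℕ} (hn : 1 ≤ n) {R : ℝ} (hR : 0 ≤ R) :
    Integrable (fun lam : EuclideanSpace ℝ (Fin m) => fr n R ‖lam‖) := by
  simpa using (isWeight_fr (m := m) hn hR).int 0

lemma integrable_sq_fr {n : ℕ} (hn : 1 ≤ n) {R : ℝ} (hR : 0 ≤ R) :
    Integrable (fun lam : EuclideanSpace ℝ (Fin m) => ‖lam‖ ^ 2 * fr n R ‖lam‖) := by
  refine integrable_of_poly_bound (C := 1) (q := 1) (isWeight_fr hn hR).int (by fun_prop) (fun lam => ?_)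
  rw [abs_of_nonneg (by positivity)]; simp

lemma integral_fr_pos {n : ℕ} (hn : 1 ≤ n) {R : ℝ} (hR : 0 ≤ R) :
    0 < ∫ lam : EuclideanSpace ℝ (Fin m), fr n R ‖lam‖ := by
  rw [integral_pos_iff_support_of_nonneg (fun x => (fr_pos n R _).le) (integrable_fr hn hR)]
  have : Function.support (fun lam : EuclideanSpace ℝ (Fin m) => fr n R ‖lam‖) = Set.univ := by
    ext x; simp [(fr_pos n R ‖x‖).ne']
  rw [this]
  exact Measure.measure_univ_pos.mpr (NeZero.ne _)

/-- The profile concentrates at the origin as `R → ∞`. -/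
lemma second_moment_small {n : ℕ} (hn : 1 ≤ n) {η : ℝ} (hη : 0 < η) :
    ∃ R0 : ℝ, 0 < R0 ∧ ∀ R, R0 ≤ R → ∫ lam : EuclideanSpace ℝ (Fin m), ‖lam‖ ^ 2 * fr n R ‖lam‖
      ≤ η * ∫ lam : EuclideanSpace ℝ (Fin m), fr n R ‖lam‖ := by
  set κ : ℝ := 2 * (η / 2) / (η / 2 + ck 0) with hκ
  have hc := ck_pos 0
  have hκ0 : 0 < κ := by positivity
  set M := ∫ lam : EuclideanSpace ℝ (Fin m), maj m 1 lam
  have hM : 0 ≤ M := integral_nonneg (maj_nonneg m 1)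
  set δ := Real.sqrt (κ / 2)
  have hδ : 0 < δ := Real.sqrt_pos.mpr (by positivity)
  have hδ2 : δ ^ 2 = κ / 2 := Real.sq_sqrt (by positivity)
  set B : Set (EuclideanSpace ℝ (Fin m)) := Metric.closedBall 0 δ
  set A := Real.exp (-(κ / 4)) ^ n * (volume B).toReal
  have hvB : 0 < (volume B).toReal := ENNReal.toReal_pos
    (Metric.measure_closedBall_pos volume 0 hδ).ne' measure_closedBall_lt_top.ne
  have hA : 0 < A := by positivity
  have lim : Tendsto (fun R : ℝ => M * Real.exp (-(κ / 2 * R))) atTop (𝓝 (M * 0)) :=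
    (Real.tendsto_exp_neg_atTop_nhds_zero.comp (tendsto_id.const_mul_atTop (by positivity))).const_mul M
  rw [mul_zero] at lim
  have ev := (lim.eventually (gt_mem_nhds (show 0 < η / 2 * A by positivity))).and (eventually_ge_atTop 1)
  obtain ⟨R0, hR0⟩ := eventually_atTop.mp ev
  refine ⟨max R0 1, by positivity, fun R hR => ?_⟩
  obtain ⟨h1, h2⟩ := hR0 R ((le_max_left _ _).trans hR)
  have hRnn : 0 ≤ R := by linarith
  have J0 : Real.exp (-(R * (1 + κ / 2))) * A ≤ ∫ lam : EuclideanSpace ℝ (Fin m), fr n R ‖lam‖ := by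
    have s1 : ∫ lam in B, fr n R ‖lam‖ ≤ ∫ lam : EuclideanSpace ℝ (Fin m), fr n R ‖lam‖ :=
      setIntegral_le_integral (integrable_fr hn hRnn) (Eventually.of_forall fun x => (fr_pos n R _).le)
    refine le_trans ?_ s1
    have s2 : ∫ lam in B, Real.exp (-(R * (1 + κ / 2))) * Real.exp (-(κ / 4)) ^ n ≤ ∫ lam in B, fr n R ‖lam‖ := by
      refine setIntegral_mono_on (integrable_const_iff.mpr (Or.inr ⟨by
        rw [Measure.restrict_apply_univ]; exact measure_closedBall_lt_top⟩)) (integrable_fr hn hRnn).integrableOn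
        measurableSet_closedBall (fun x hx => ?_)
      have hx' : ‖x‖ ^ 2 ≤ κ / 2 := by
        rw [← hδ2]; have := mem_closedBall_zero_iff.mp hx; gcongr
      unfold fr
      have := psi_le ‖x‖
      have h3 := exp_neg_sq_le_rs ‖x‖
      gcongr
      · linarith
      · refine le_trans ?_ h3
        rw [Real.exp_le_exp]; linarith
    refine le_trans (le_of_eq ?_) s2
    rw [setIntegral_const, smul_eq_mul]
    simp only [A, Measure.real]; ring
  have J2 : ∫ lam : EuclideanSpace ℝ (Fin m), ‖lam‖ ^ 2 * fr n R ‖lam‖ ≤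
      η / 2 * (∫ lam : EuclideanSpace ℝ (Fin m), fr n R ‖lam‖) + Real.exp (-(R * (1 + κ))) * M := by
    rw [← integral_const_mul, ← integral_const_mul, ← integral_add ((integrable_fr hn hRnn).const_mul _)
      ((integrable_maj m 1).const_mul _)]
    refine integral_mono (integrable_sq_fr hn hRnn) (((integrable_fr hn hRnn).const_mul _).add
      ((integrable_maj m 1).const_mul _)) (fun x => ?_)
    have hf := fr_pos n R ‖x‖
    have hmaj := maj_nonneg m 1 x
    by_cases hx : ‖x‖ ^ 2 ≤ η / 2
    · have : ‖x‖ ^ 2 * fr n R ‖x‖ ≤ η / 2 * fr n R ‖x‖ := by gcongr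
      have : 0 ≤ Real.exp (-(R * (1 + κ))) * maj m 1 x := by positivity
      simp only; linarith
    · push Not at hx
      have hψ : 1 + κ ≤ psi ‖x‖ := by
        refine le_trans ?_ (le_psi ‖x‖)
        rw [hκ, add_le_add_iff_left, div_le_div_iff₀ (by positivity) (by positivity)]
        nlinarith
      have : ‖x‖ ^ 2 * fr n R ‖x‖ ≤ Real.exp (-(R * (1 + κ))) * maj m 1 x := by
        have e1 : Real.exp (-(R * psi ‖x‖)) ≤ Real.exp (-(R * (1 + κ))) := by
          rw [Real.exp_le_exp]; nlinarith
        have e2 : fr n 0 ‖x‖ = rs ‖x‖ ^ n := by simp [fr]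
        have e3 := fr_weight_le_maj (m := m) (q := 1) hn le_rfl x
        rw [e2] at e3
        have e4 : 0 ≤ rs ‖x‖ ^ n := pow_nonneg (rs_nonneg _) _
        unfold fr
        calc ‖x‖ ^ 2 * (Real.exp (-(R * psi ‖x‖)) * rs ‖x‖ ^ n)
            = Real.exp (-(R * psi ‖x‖)) * (‖x‖ ^ 2 * rs ‖x‖ ^ n) := by ring
          _ ≤ Real.exp (-(R * (1 + κ))) * maj m 1 x := by
            refine mul_le_mul e1 ?_ (by positivity) (by positivity)
            refine le_trans ?_ e3
            gcongr; simp
      have : 0 ≤ η / 2 * fr n R ‖x‖ := by positivity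
      simp only; linarith
  have e : Real.exp (-(R * (1 + κ))) = Real.exp (-(R * (1 + κ / 2))) * Real.exp (-(κ / 2 * R)) := by
    rw [← Real.exp_add]; congr 1; ring
  rw [e] at J2
  have hE := Real.exp_pos (-(R * (1 + κ / 2)))
  nlinarith

/-- In the regime of bounded `s` and large `R` the kernel is close to its value at `s = 0`. -/
lemma region_bounded_s {n : ℕ} (hn : 1 ≤ n) (i0 : Fin m) (s0 : ℝ) {ε : ℝ} (hε : 0 < ε) :
    ∃ R0 : ℝ, 0 < R0 ∧ ∀ R s, R0 ≤ R → 0 < s → s ≤ s0 →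
      0 < cosI n i0 R s 0 ∧ |cosI n i0 R s 0 - cosI n i0 R s 1| ≤ ε * cosI n i0 R s 0 ∧
      |sinI n i0 R s| ≤ ε * s * cosI n i0 R s 0 := by
  set η := min (ε / 2) (1 / (1 + s0 ^ 2)) with hη
  have hη0 : 0 < η := by positivity
  obtain ⟨R0, hR0, h⟩ := second_moment_small (m := m) hn hη0
  refine ⟨R0, hR0, fun R s hR hs hss => ?_⟩
  have hRnn : 0 ≤ R := by linarith
  have hJ := h R hR
  have hJ0 := integral_fr_pos (m := m) hn hRnn
  set J0 := ∫ lam : EuclideanSpace ℝ (Fin m), fr n R ‖lam‖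
  set J2 := ∫ lam : EuclideanSpace ℝ (Fin m), ‖lam‖ ^ 2 * fr n R ‖lam‖
  have i0' := integrable_fr (m := m) hn hRnn
  have i2' := integrable_sq_fr (m := m) hn hRnn
  have hc : ∀ lam : EuclideanSpace ℝ (Fin m), lam i0 ^ 2 ≤ ‖lam‖ ^ 2 := by
    intro lam
    rw [← sq_abs]
    have : |lam i0| ≤ ‖lam‖ := by simpa using PiLp.norm_apply_le lam i0
    gcongr
  have hp : J0 - s ^ 2 / 2 * J2 ≤ cosI n i0 R s 0 := by
    rw [cosI, ← integral_const_mul, ← integral_sub i0' (i2'.const_mul _)]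
    refine integral_mono (i0'.sub (i2'.const_mul _)) (integrable_cosI hn i0 hRnn s 0) (fun x => ?_)
    have h1 := Real.one_sub_sq_div_two_le_cos (x := s * x i0)
    have h2 := hc x
    have hf := fr_pos n R ‖x‖
    have h3 : 1 - s ^ 2 / 2 * ‖x‖ ^ 2 ≤ Real.cos (s * x i0) := by
      refine le_trans ?_ h1
      rw [mul_pow]; nlinarith [sq_nonneg s]
    simp only [pow_zero, mul_one]
    nlinarith
  have hs1 : s ^ 2 / 2 * J2 ≤ J0 / 2 := by
    have h1 : s ^ 2 ≤ 1 + s0 ^ 2 := by nlinarith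
    have h2 : J2 ≤ 1 / (1 + s0 ^ 2) * J0 := hJ.trans (by gcongr; exact min_le_right _ _)
    have h3 : 0 ≤ J2 := integral_nonneg (fun x => by have := fr_pos n R ‖x‖; positivity)
    have h4 : (1 + s0 ^ 2) * J2 ≤ J0 := by
      rw [one_div, inv_mul_eq_div, le_div_iff₀ (by positivity)] at h2
      linarith
    nlinarith
  have hpp : J0 / 2 ≤ cosI n i0 R s 0 := by linarith
  have hJ2 : J2 ≤ ε * cosI n i0 R s 0 := by
    have : J2 ≤ ε / 2 * J0 := hJ.trans (by gcongr; exact min_le_left _ _)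
    nlinarith
  refine ⟨by linarith, ?_, ?_⟩
  · refine le_trans ?_ hJ2
    rw [cosI, cosI, ← integral_sub (integrable_cosI hn i0 hRnn s 0) (integrable_cosI hn i0 hRnn s 1)]
    refine (abs_integral_le_integral_abs).trans ?_
    refine integral_mono ((integrable_cosI hn i0 hRnn s 0).sub (integrable_cosI hn i0 hRnn s 1)).abs i2' (fun x => ?_)
    have hf := fr_pos n R ‖x‖
    have h1 := one_le_psi ‖x‖
    have h2 := psi_le ‖x‖
    have h3 := Real.abs_cos_le_one (s * x i0)
    simp only [pow_zero, pow_one, mul_one]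
    rw [← sub_mul, abs_mul, abs_of_pos hf]
    gcongr
    rw [show Real.cos (s * x i0) - Real.cos (s * x i0) * psi ‖x‖ = -(Real.cos (s * x i0) * (psi ‖x‖ - 1)) by ring,
      abs_neg, abs_mul, abs_of_nonneg (by linarith : 0 ≤ psi ‖x‖ - 1)]
    nlinarith
  · have : |sinI n i0 R s| ≤ s * J2 := by
      rw [sinI, ← integral_const_mul]
      refine (abs_integral_le_integral_abs).trans ?_
      refine integral_mono (integrable_sinI hn i0 hRnn s).abs (i2'.const_mul _) (fun x => ?_)
      have hf := fr_pos n R ‖x‖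
      have h1 := hc x
      simp only
      rw [← mul_assoc, abs_mul, abs_of_pos hf]
      gcongr
      have h2 : |Real.sin (s * x i0)| ≤ |s * x i0| := Real.abs_sin_le_abs
      rw [abs_mul]
      rw [abs_mul, abs_of_pos hs] at h2
      calc |x i0| * |Real.sin (s * x i0)| ≤ |x i0| * (s * |x i0|) := by gcongr
        _ = s * x i0 ^ 2 := by rw [← sq_abs (x i0)]; ring
        _ ≤ _ := by gcongr
    refine this.trans ?_
    nlinarith

end

lemma pointwise_small_aux {U e : ℝ} (hU : 0 ≤ U) (h2 : U < 9 / 10) :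
    0 ≤ ((1 - U) ^ 2 * (3 / 4 - 9.87 * U) + 7.6 * U - (3.5 * U - 1.5 * U ^ 2) ^ 2)
      + (0.6 * U + 3 * U ^ 2) * e + (1.9 * U - 1) * e ^ 2 + 2000 * ((1 - U) ^ 2 * e ^ 2) := by
  have hA : 0.2 ≤ (1 - U) ^ 2 * (3 / 4 - 9.87 * U) + 7.6 * U - (3.5 * U - 1.5 * U ^ 2) ^ 2 := by
    have : (1 - U) ^ 2 * (3 / 4 - 9.87 * U) + 7.6 * U - (3.5 * U - 1.5 * U ^ 2) ^ 2
      = 0.2 + ((0.55 - 3.77 * U + 6.6525 * U ^ 2) + 1.395 * (U ^ 2 * (0.9 - U))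
        + 0.332 * U ^ 2 + 2.25 * (U ^ 3 * (0.9 - U))) := by ring
    rw [this]
    have h3 : 0 ≤ 0.9 - U := by linarith
    have h4 : 0 ≤ 0.55 - 3.77 * U + 6.6525 * U ^ 2 := by nlinarith [sq_nonneg (U - 0.2834)]
    have h5 : 0 ≤ U ^ 2 * (0.9 - U) := by positivity
    have h6 : 0 ≤ U ^ 3 * (0.9 - U) := by positivity
    have h7 : 0 ≤ U ^ 2 := by positivity
    linarith
  have hL0 : 0 ≤ 0.6 * U + 3 * U ^ 2 := by positivity
  have hL : 0.6 * U + 3 * U ^ 2 ≤ 3 := by nlinarith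
  have hLe : -(0.2 + 11.25 * e ^ 2) ≤ (0.6 * U + 3 * U ^ 2) * e := by
    generalize 0.6 * U + 3 * U ^ 2 = L at hL0 hL
    have hL2 : L ^ 2 ≤ 9 := by nlinarith
    nlinarith [sq_nonneg (L + 22.5 * e)]
  have h5 : 0.01 ≤ (1 - U) ^ 2 := by nlinarith
  have h6 : 0.01 * e ^ 2 ≤ (1 - U) ^ 2 * e ^ 2 := by gcongr
  have h7 : 0 ≤ U * e ^ 2 := by positivity
  linarith [sq_nonneg e]

lemma pointwise_small {r U : ℝ} (hU : 0 ≤ U) (h2 : U < 9 / 10) :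
    0 ≤ (1 + 19 / 10 * r ^ 2 * U - 9.87 * U - (r - 2 + 3 / 2 * U) ^ 2) - 1 / 4
      + 2000 * (r * (1 - U) - 2) ^ 2 := by
  have h := pointwise_small_aux (e := r * (1 - U) - 2) hU h2
  have hw : 0 < (1 - U) ^ 2 := pow_pos (by linarith) 2
  refine nonneg_of_mul_nonneg_right (a := (1 - U) ^ 2) ?_ hw
  refine h.trans_eq ?_
  ring

/-- The pointwise inequality behind the lower bound of the potential. -/
lemma pointwise_lower {δ : ℝ} (hδ : 0 < δ) : ∃ C : ℝ, 0 < C ∧ ∀ r U : ℝ, 0 ≤ r → 0 ≤ U →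
    1 / 4 - δ * U ^ 4 - C * (r * (1 - U) - 2) ^ 2 ≤
      1 + 19 / 10 * r ^ 2 * U - Real.pi ^ 2 * U - (r - 2 + 3 / 2 * U) ^ 2 := by
  have hpi : Real.pi ^ 2 ≤ 9.87 := by
    have := Real.pi_lt_d6
    have := Real.pi_pos
    nlinarith
  refine ⟨2000 + 225 / δ, by positivity, fun r U hr hU => ?_⟩
  have hpU : Real.pi ^ 2 * U ≤ 9.87 * U := by gcongr
  have hU4 : 0 ≤ δ * U ^ 4 := by positivity
  have hd : 0 < 225 / δ := by positivity
  have hde : 0 ≤ 225 / δ * (r * (1 - U) - 2) ^ 2 := by positivity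
  rcases le_or_gt 1 U with h1 | h1
  · have he2 : 4 ≤ (r * (1 - U) - 2) ^ 2 := by
      have := mul_nonneg hr (by linarith : 0 ≤ U - 1)
      have e1 : (r * (1 - U) - 2) ^ 2 = 4 + 4 * (r * (U - 1)) + (r * (U - 1)) ^ 2 := by ring
      have := sq_nonneg (r * (U - 1))
      linarith
    have hQ : -30 * (1 + U ^ 2) ≤ 1 + 19 / 10 * r ^ 2 * U - 9.87 * U - (r - 2 + 3 / 2 * U) ^ 2 := by
      have h3 : 0 ≤ U - 1 := by linarith
      have : 0 ≤ r ^ 2 * (U - 1) := by positivity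
      nlinarith [sq_nonneg (9 * r - 10 * (3 / 2 * U - 2)), sq_nonneg (U - 1)]
    have h30 : 30 * U ^ 2 ≤ δ * U ^ 4 + 225 / δ := by
      have : δ * U ^ 4 + 225 / δ - 30 * U ^ 2 = (δ * U ^ 2 - 15) ^ 2 / δ := by field_simp; ring
      have : 0 ≤ (δ * U ^ 2 - 15) ^ 2 / δ := by positivity
      linarith
    have h5 : (2000 + 225 / δ) * 4 ≤ (2000 + 225 / δ) * (r * (1 - U) - 2) ^ 2 := by gcongr
    linarith
  rcases le_or_gt (9 / 10) U with h2 | h2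
  · rcases le_or_gt 4 r with h3 | h3
    · have : 0 ≤ (2000 + 225 / δ) * (r * (1 - U) - 2) ^ 2 := by positivity
      have a1 : r ^ 2 * (9 / 10) ≤ r ^ 2 * U := by gcongr
      have a2 : (r - 2 + 3 / 2 * U) ^ 2 ≤ (r - 1 / 2) ^ 2 := by
        apply pow_le_pow_left₀ <;> linarith
      nlinarith
    · have he1 : r * (1 - U) ≤ 4 * (1 / 10) := by
        apply mul_le_mul <;> linarith
      have he2 : 2.56 ≤ (r * (1 - U) - 2) ^ 2 := by
        nlinarith
      have : (r - 2 + 3 / 2 * U) ^ 2 ≤ 4 ^ 2 := by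
        apply sq_le_sq'  <;> linarith
      have : 0 ≤ r ^ 2 * U := by positivity
      have : 2000 * 2.56 ≤ (2000 + 225 / δ) * (r * (1 - U) - 2) ^ 2 := by gcongr; linarith
      linarith
  · have := pointwise_small (r := r) hU h2
    linarith

/-- Joint density of a Poisson variable `j` of mean `2R` and a Gamma variable of shape `n + j`
and rate `c`. -/
noncomputable def dens (n : ℕ) (R c : ℝ) (j : ℕ) (τ : ℝ) : ℝ :=
  Real.exp (-(2 * R)) * ((2 * R) ^ j / j.factorial) *
    (c ^ (n + j) * (τ ^ (n + j - 1) / (n + j - 1).factorial) * Real.exp (-(c * τ)))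

lemma dens_nonneg (n : ℕ) {R c : ℝ} (hR : 0 ≤ R) (hc : 0 ≤ c) (j : ℕ) {τ : ℝ} (hτ : 0 ≤ τ) :
    0 ≤ dens n R c j τ := by unfold dens; positivity

lemma dens_pos (n : ℕ) {R c : ℝ} (hR : 0 < R) (hc : 0 < c) (j : ℕ) {τ : ℝ} (hτ : 0 < τ) :
    0 < dens n R c j τ := by unfold dens; positivity

lemma continuous_dens (n : ℕ) (R c : ℝ) (j : ℕ) : Continuous (dens n R c j) := by
  unfold dens; fun_prop

lemma lintegral_gamma_kernel (k : ℕ) {a : ℝ} (ha : 0 < a) :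
    ∫⁻ τ in Set.Ioi (0 : ℝ), ENNReal.ofReal (τ ^ k / k.factorial * Real.exp (-(a * τ))) =
      ENNReal.ofReal ((a ^ (k + 1))⁻¹) := by
  have h := Real.integral_rpow_mul_exp_neg_mul_Ioi (a := k + 1) (r := a) (by positivity) ha
  have h0 : ∫ τ in Set.Ioi (0 : ℝ), τ ^ k / k.factorial * Real.exp (-(a * τ)) = (a ^ (k + 1))⁻¹ := by
    have h1 : ∫ τ in Set.Ioi (0 : ℝ), τ ^ k / k.factorial * Real.exp (-(a * τ))
        = (k.factorial : ℝ)⁻¹ * ∫ τ in Set.Ioi (0 : ℝ), τ ^ ((k + 1 : ℝ) - 1) * Real.exp (-(a * τ)) := by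
      rw [← integral_const_mul]
      congr 1 with τ
      rw [add_sub_cancel_right, Real.rpow_natCast]
      ring
    rw [h1, h, Real.Gamma_nat_eq_factorial]
    have : ((1 / a) ^ ((k : ℝ) + 1)) = (a ^ (k + 1))⁻¹ := by
      rw [← Nat.cast_succ, Real.rpow_natCast, one_div, inv_pow]
    rw [this]
    field_simp
  rw [← h0, ofReal_integral_eq_lintegral_ofReal]
  · by_contra hn
    rw [integral_undef hn] at h0
    exact absurd h0 (by positivity)
  · exact (ae_restrict_iff' measurableSet_Ioi).mpr (ae_of_all _ (fun τ (hτ : 0 < τ) => by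
      show 0 ≤ _
      positivity))

lemma tsum_lintegral_dens {n : ℕ} (hn : 1 ≤ n) {R c z : ℝ} (hR : 0 ≤ R) (hc : 0 < c)
    (hz : 0 < z + c) :
    ∑' j, ∫⁻ τ in Set.Ioi (0 : ℝ), ENNReal.ofReal (dens n R c j τ * Real.exp (-(z * τ))) =
      ENNReal.ofReal (Real.exp (-(R * (2 * z / (z + c)))) * ((1 + z / c)⁻¹) ^ n) := by
  have h1 : ∀ j, ∫⁻ τ in Set.Ioi (0 : ℝ), ENNReal.ofReal (dens n R c j τ * Real.exp (-(z * τ))) =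
      ENNReal.ofReal ((Real.exp (-(2 * R)) * (c / (z + c)) ^ n) *
        ((2 * R * (c / (z + c))) ^ j / j.factorial)) := by
    intro j
    have e : ∀ τ, dens n R c j τ * Real.exp (-(z * τ)) =
        (Real.exp (-(2 * R)) * ((2 * R) ^ j / j.factorial) * c ^ (n + j)) *
        (τ ^ (n + j - 1) / (n + j - 1).factorial * Real.exp (-((z + c) * τ))) := by
      intro τ
      have : Real.exp (-((z + c) * τ)) = Real.exp (-(c * τ)) * Real.exp (-(z * τ)) := by
        rw [← Real.exp_add]; ring_nf
      rw [this]
      unfold dens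
      ring
    simp_rw [e]
    have hp : 0 ≤ Real.exp (-(2 * R)) * ((2 * R) ^ j / j.factorial) * c ^ (n + j) := by positivity
    simp_rw [ENNReal.ofReal_mul hp]
    rw [lintegral_const_mul' _ _ ENNReal.ofReal_ne_top, lintegral_gamma_kernel _ hz,
      ← ENNReal.ofReal_mul hp]
    congr 1
    have : n + j - 1 + 1 = n + j := by omega
    rw [this, pow_add c, pow_add (z + c), mul_pow (2 * R) (c / (z + c)), div_pow c, div_pow c]
    field_simp
  simp_rw [h1]
  have hs := (NormedSpace.expSeries_div_hasSum_exp (𝔸 := ℝ) (2 * R * (c / (z + c)))).mul_left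
    (Real.exp (-(2 * R)) * (c / (z + c)) ^ n)
  rw [← ENNReal.ofReal_tsum_of_nonneg (fun j => by positivity) hs.summable, hs.tsum_eq,
    ← Real.exp_eq_exp_ℝ]
  congr 1
  have e1 : (1 + z / c)⁻¹ = c / (z + c) := by
    rw [one_add_div hc.ne', inv_div, add_comm]
  have e2 : Real.exp (-(R * (2 * z / (z + c)))) =
      Real.exp (-(2 * R)) * Real.exp (2 * R * (c / (z + c))) := by
    rw [← Real.exp_add]
    congr 1
    field_simp
    ring
  rw [e1, e2]
  ring

/-- Law of a compound Gamma variable. -/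
noncomputable def factorLaw (n : ℕ) (R c : ℝ) : Measure ℝ :=
  Measure.sum (fun j => (volume.restrict (Set.Ioi (0 : ℝ))).withDensity
    (fun τ => ENNReal.ofReal (dens n R c j τ)))

lemma laplace_factorLaw {n : ℕ} (hn : 1 ≤ n) {R c z : ℝ} (hR : 0 ≤ R) (hc : 0 < c)
    (hz : 0 < z + c) :
    ∫⁻ x, ENNReal.ofReal (Real.exp (-(z * x))) ∂(factorLaw n R c) =
      ENNReal.ofReal (Real.exp (-(R * (2 * z / (z + c)))) * ((1 + z / c)⁻¹) ^ n) := by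
  rw [← tsum_lintegral_dens hn hR hc hz, factorLaw, lintegral_sum_measure]
  congr 1 with j
  rw [lintegral_withDensity_eq_lintegral_mul _ ((continuous_dens n R c j).measurable.ennreal_ofReal)
    (by fun_prop)]
  refine setLIntegral_congr_fun measurableSet_Ioi (fun τ (hτ : 0 < τ) => ?_)
  simp only [Pi.mul_apply]
  rw [← ENNReal.ofReal_mul (dens_nonneg n hR hc.le j hτ.le)]

lemma isProbabilityMeasure_factorLaw {n : ℕ} (hn : 1 ≤ n) {R c : ℝ} (hR : 0 ≤ R) (hc : 0 < c) :
    IsProbabilityMeasure (factorLaw n R c) := by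
  constructor
  have := laplace_factorLaw hn hR hc (z := 0) (by linarith)
  simpa using this

lemma ae_nonneg_factorLaw (n : ℕ) (R c : ℝ) : ∀ᵐ x ∂(factorLaw n R c), 0 ≤ x := by
  rw [factorLaw, Measure.ae_sum_iff' measurableSet_Ici]
  intro j
  refine (withDensity_absolutelyContinuous _ _).ae_le ?_
  exact (ae_restrict_iff' measurableSet_Ioi).mpr (ae_of_all _ (fun τ (hτ : 0 < τ) => hτ.le))

/-- Law of the sum of the independent compound Gamma variables with rates `ck 1, …, ck N`. -/
noncomputable def tailLaw (n : ℕ) (R : ℝ) : ℕ → Measure ℝ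
  | 0 => Measure.dirac 0
  | N + 1 => (tailLaw n R N).conv (factorLaw n R (ck (N + 1)))

lemma isProbabilityMeasure_tailLaw {n : ℕ} (hn : 1 ≤ n) {R : ℝ} (hR : 0 ≤ R) (N : ℕ) :
    IsProbabilityMeasure (tailLaw n R N) := by
  induction N with
  | zero => exact Measure.dirac.isProbabilityMeasure
  | succ N ih =>
    have := isProbabilityMeasure_factorLaw hn hR (ck_pos (N + 1))
    unfold tailLaw
    infer_instance

lemma ae_nonneg_tailLaw {n : ℕ} (hn : 1 ≤ n) {R : ℝ} (hR : 0 ≤ R) (N : ℕ) :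
    ∀ᵐ x ∂(tailLaw n R N), 0 ≤ x := by
  induction N with
  | zero => simp [tailLaw]
  | succ N ih =>
    have := isProbabilityMeasure_factorLaw hn hR (ck_pos (N + 1))
    have := isProbabilityMeasure_tailLaw hn hR N
    unfold tailLaw Measure.conv
    rw [ae_map_iff (by fun_prop) measurableSet_Ici]
    rw [Measure.ae_prod_iff_ae_ae (measurableSet_le (by fun_prop) (by fun_prop))]
    filter_upwards [ih] with x hx
    filter_upwards [ae_nonneg_factorLaw n R (ck (N + 1))] with y hy
    exact add_nonneg hx hy

lemma laplace_tailLaw {n : ℕ} (hn : 1 ≤ n) {R : ℝ} (hR : 0 ≤ R) (N : ℕ) {z : ℝ} (hz : -1 ≤ z) :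
    ∫⁻ x, ENNReal.ofReal (Real.exp (-(z * x))) ∂(tailLaw n R N) =
      ENNReal.ofReal (∏ k ∈ Finset.range N, (Real.exp (-(R * (2 * z / (z + ck (k + 1))))) *
        ((1 + z / ck (k + 1))⁻¹) ^ n)) := by
  induction N with
  | zero => simp [tailLaw]
  | succ N ih =>
    have := isProbabilityMeasure_factorLaw hn hR (ck_pos (N + 1))
    have := isProbabilityMeasure_tailLaw hn hR N
    have h9 := nine_lt_ck (N + 1)
    rw [tailLaw, Measure.lintegral_conv (by fun_prop)]
    have e : ∀ x y : ℝ, ENNReal.ofReal (Real.exp (-(z * (x + y)))) =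
        ENNReal.ofReal (Real.exp (-(z * x))) * ENNReal.ofReal (Real.exp (-(z * y))) := by
      intro x y
      rw [← ENNReal.ofReal_mul (Real.exp_pos _).le, ← Real.exp_add]
      ring_nf
    simp_rw [e]
    have h2 : ∀ x : ℝ, ∫⁻ y, ENNReal.ofReal (Real.exp (-(z * x))) * ENNReal.ofReal (Real.exp (-(z * y)))
        ∂(factorLaw n R (ck (N + 1))) = ENNReal.ofReal (Real.exp (-(z * x))) *
        ENNReal.ofReal (Real.exp (-(R * (2 * z / (z + ck (N + 1))))) * ((1 + z / ck (N + 1))⁻¹) ^ n) := by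
      intro x
      rw [lintegral_const_mul' _ _ ENNReal.ofReal_ne_top,
        laplace_factorLaw hn hR (ck_pos (N + 1)) (by linarith)]
    simp_rw [h2]
    rw [lintegral_mul_const' _ _ ENNReal.ofReal_ne_top, ih, ← ENNReal.ofReal_mul, Finset.prod_range_succ]
    refine Finset.prod_nonneg (fun k _ => ?_)
    have h9 := nine_lt_ck (k + 1)
    have : 0 ≤ 1 + z / ck (k + 1) := by
      rw [one_add_div (by linarith)]
      apply div_nonneg <;> linarith
    positivity

/-- The base measure on triples `((j, τ'), τ)`. -/
noncomputable def base (n : ℕ) (R : ℝ) (N : ℕ) : Measure ((ℕ × ℝ) × ℝ) :=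
  ((Measure.count : Measure ℕ).prod (tailLaw n R N)).prod (volume.restrict (Set.Ioi (0 : ℝ)))

lemma measurable_dens (n : ℕ) (R c : ℝ) :
    Measurable (fun ω : (ℕ × ℝ) × ℝ => dens n R c ω.1.1 ω.2) := by
  have : Measurable (fun p : ℕ × ℝ => dens n R c p.1 p.2) :=
    measurable_from_prod_countable_right (fun j => (continuous_dens n R c j).measurable)
  exact this.comp (by fun_prop : Measurable (fun ω : (ℕ × ℝ) × ℝ => (ω.1.1, ω.2)))

lemma lintegral_base {n : ℕ} (hn : 1 ≤ n) {R : ℝ} (hR : 0 ≤ R) (N : ℕ)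
    {f : (ℕ × ℝ) × ℝ → ENNReal} (hf : Measurable f) :
    ∫⁻ ω, f ω ∂(base n R N) =
      ∑' j, ∫⁻ x, (∫⁻ τ in Set.Ioi (0 : ℝ), f ((j, x), τ)) ∂(tailLaw n R N) := by
  have := isProbabilityMeasure_tailLaw hn hR N
  rw [base, lintegral_prod _ hf.aemeasurable,
    lintegral_prod _ hf.lintegral_prod_right'.aemeasurable, lintegral_count]

lemma ae_base {n : ℕ} (hn : 1 ≤ n) {R : ℝ} (hR : 0 ≤ R) (N : ℕ) :
    ∀ᵐ ω ∂(base n R N), 0 ≤ ω.1.2 ∧ 0 < ω.2 := by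
  have := isProbabilityMeasure_tailLaw hn hR N
  have h1 : ∀ᵐ p ∂((Measure.count : Measure ℕ).prod (tailLaw n R N)), 0 ≤ p.2 :=
    Measure.quasiMeasurePreserving_snd.ae (ae_nonneg_tailLaw hn hR N)
  have h2 : ∀ᵐ ω ∂(base n R N), 0 ≤ ω.1.2 := Measure.quasiMeasurePreserving_fst.ae h1
  have h3 : ∀ᵐ ω ∂(base n R N), 0 < ω.2 := Measure.quasiMeasurePreserving_snd.ae
    (ae_restrict_mem (μ := volume) measurableSet_Ioi)
  exact h2.and h3

/-- Laplace transform of the mixing measure: the truncated radial profile. -/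
lemma laplace_base {n : ℕ} (hn : 1 ≤ n) {R : ℝ} (hR : 0 ≤ R) (N : ℕ) {z : ℝ} (hz : -1 ≤ z) :
    ∫⁻ ω, ENNReal.ofReal (dens n R (ck 0) ω.1.1 ω.2 * Real.exp (-(z * (ω.2 + ω.1.2)))) ∂(base n R N) =
      ENNReal.ofReal (Real.exp R * fN n R (N + 1) z) := by
  have h9 := nine_lt_ck 0
  have hmeas : Measurable (fun ω : (ℕ × ℝ) × ℝ =>
      ENNReal.ofReal (dens n R (ck 0) ω.1.1 ω.2 * Real.exp (-(z * (ω.2 + ω.1.2))))) :=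
    ((measurable_dens n R (ck 0)).mul (by fun_prop)).ennreal_ofReal
  rw [lintegral_base hn hR N hmeas]
  have h1 : ∀ j : ℕ, ∀ x : ℝ, ∫⁻ τ in Set.Ioi (0 : ℝ),
      ENNReal.ofReal (dens n R (ck 0) j τ * Real.exp (-(z * (τ + x)))) =
      (∫⁻ τ in Set.Ioi (0 : ℝ), ENNReal.ofReal (dens n R (ck 0) j τ * Real.exp (-(z * τ)))) *
        ENNReal.ofReal (Real.exp (-(z * x))) := by
    intro j x
    rw [← lintegral_mul_const' _ _ ENNReal.ofReal_ne_top]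
    refine setLIntegral_congr_fun measurableSet_Ioi (fun τ (hτ : 0 < τ) => ?_)
    have := dens_nonneg n hR (ck_pos 0).le j hτ.le
    rw [← ENNReal.ofReal_mul (by positivity), mul_assoc, ← Real.exp_add]
    ring_nf
  simp only [h1]
  have h2 : ∀ j : ℕ, ∫⁻ x, (∫⁻ τ in Set.Ioi (0 : ℝ),
        ENNReal.ofReal (dens n R (ck 0) j τ * Real.exp (-(z * τ)))) *
        ENNReal.ofReal (Real.exp (-(z * x))) ∂(tailLaw n R N) =
      (∫⁻ τ in Set.Ioi (0 : ℝ), ENNReal.ofReal (dens n R (ck 0) j τ * Real.exp (-(z * τ)))) *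
        ∫⁻ x, ENNReal.ofReal (Real.exp (-(z * x))) ∂(tailLaw n R N) := by
    intro j
    rw [lintegral_const_mul _ (by fun_prop)]
  simp only [h2]
  rw [ENNReal.tsum_mul_right, tsum_lintegral_dens hn hR (ck_pos 0) (by linarith),
    laplace_tailLaw hn hR N hz, ← ENNReal.ofReal_mul]
  · congr 1
    rw [fN, psiN, prodN, Finset.sum_range_succ', Finset.prod_range_succ', Finset.prod_mul_distrib,
      Finset.prod_pow, ← Real.exp_sum, mul_pow]
    have : Real.exp R * (Real.exp (-(R * (1 + (∑ k ∈ Finset.range N, 2 * z / (z + ck (k + 1))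
        + 2 * z / (z + ck 0)))))) = Real.exp (-(R * (2 * z / (z + ck 0)))) *
        Real.exp (∑ k ∈ Finset.range N, -(R * (2 * z / (z + ck (k + 1))))) := by
      rw [← Real.exp_add, ← Real.exp_add, Finset.sum_neg_distrib, ← Finset.mul_sum]
      congr 1
      ring
    linear_combination ((∏ k ∈ Finset.range N, (1 + z / ck (k + 1))⁻¹) ^ n
      * ((1 + z / ck 0)⁻¹) ^ n) * -this
  · have : 0 ≤ 1 + z / ck 0 := by
      rw [one_add_div (by linarith)]
      apply div_nonneg <;> linarith
    positivity

lemma lintegral_dens_div_le {n : ℕ} (hn : 1 ≤ n) {R c z : ℝ} (hR : 0 ≤ R) (hc : 0 < c)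
    (hz : 0 < z + c) (j : ℕ) :
    ∫⁻ τ in Set.Ioi (0 : ℝ), ENNReal.ofReal (dens n R c j τ * Real.exp (-(z * τ)) *
        (((n : ℝ) + j - 1) / τ)) ≤
      ENNReal.ofReal (z + c) *
        ∫⁻ τ in Set.Ioi (0 : ℝ), ENNReal.ofReal (dens n R c j τ * Real.exp (-(z * τ))) := by
  obtain ⟨k, hk⟩ : ∃ k, n + j = k + 1 := ⟨n + j - 1, by omega⟩
  have hk' : (n : ℝ) + j = k + 1 := by exact_mod_cast hk
  set p := Real.exp (-(2 * R)) * ((2 * R) ^ j / j.factorial) * c ^ (k + 1) with hp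
  have hp0 : 0 ≤ p := by positivity
  have hexp : ∀ τ, Real.exp (-((z + c) * τ)) = Real.exp (-(c * τ)) * Real.exp (-(z * τ)) := by
    intro τ
    rw [← Real.exp_add]; ring_nf
  have e : ∀ τ, dens n R c j τ * Real.exp (-(z * τ)) =
      p * (τ ^ k / k.factorial * Real.exp (-((z + c) * τ))) := by
    intro τ
    rw [hexp]
    unfold dens
    rw [hk, Nat.add_sub_cancel]
    ring
  rcases k with _ | k
  · rw [hk']
    simp
  · have e2 : ∀ τ ∈ Set.Ioi (0 : ℝ), ENNReal.ofReal (dens n R c j τ * Real.exp (-(z * τ)) *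
        (((n : ℝ) + j - 1) / τ)) =
        ENNReal.ofReal p * ENNReal.ofReal (τ ^ k / k.factorial * Real.exp (-((z + c) * τ))) := by
      intro τ hτ
      have hτ : 0 < τ := hτ
      rw [e, hk', ← ENNReal.ofReal_mul hp0]
      congr 1
      rw [Nat.factorial_succ]
      push_cast
      field_simp
      ring
    rw [setLIntegral_congr_fun measurableSet_Ioi e2, lintegral_const_mul' _ _ ENNReal.ofReal_ne_top,
      lintegral_gamma_kernel k hz]
    simp_rw [e, ENNReal.ofReal_mul hp0]
    rw [lintegral_const_mul' _ _ ENNReal.ofReal_ne_top, lintegral_gamma_kernel (k + 1) hz,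
      ← ENNReal.ofReal_mul hp0, ← ENNReal.ofReal_mul hp0, ← ENNReal.ofReal_mul hz.le]
    apply le_of_eq
    congr 1
    rw [pow_succ (z + c) (k + 1)]
    field_simp

lemma laplace_base_div {n : ℕ} (hn : 1 ≤ n) {R : ℝ} (hR : 0 ≤ R) (N : ℕ) {z : ℝ} (hz : -1 ≤ z) :
    ∫⁻ ω, ENNReal.ofReal (dens n R (ck 0) ω.1.1 ω.2 * Real.exp (-(z * (ω.2 + ω.1.2))) *
        (((n : ℝ) + ω.1.1 - 1) / ω.2)) ∂(base n R N) ≤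
      ENNReal.ofReal (z + ck 0) * ENNReal.ofReal (Real.exp R * fN n R (N + 1) z) := by
  have h9 := nine_lt_ck 0
  have hm1 : Measurable (fun ω : (ℕ × ℝ) × ℝ =>
      dens n R (ck 0) ω.1.1 ω.2 * Real.exp (-(z * (ω.2 + ω.1.2)))) :=
    (measurable_dens n R (ck 0)).mul (by fun_prop)
  have hm2 : Measurable (fun ω : (ℕ × ℝ) × ℝ => ((ω.1.1 : ℕ) : ℝ)) :=
    (measurable_from_nat (f := fun k : ℕ => (k : ℝ))).comp (measurable_fst.comp measurable_fst)
  rw [← laplace_base hn hR N hz, lintegral_base hn hR N (hm1.ennreal_ofReal),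
    lintegral_base hn hR N (by fun_prop), ← ENNReal.tsum_mul_left]
  refine ENNReal.tsum_le_tsum (fun j => ?_)
  rw [← lintegral_const_mul' _ _ ENNReal.ofReal_ne_top]
  refine lintegral_mono (fun x => ?_)
  have h1 : ∀ τ : ℝ, Real.exp (-(z * (τ + x))) = Real.exp (-(z * x)) * Real.exp (-(z * τ)) := by
    intro τ
    rw [← Real.exp_add]; ring_nf
  have h2 : ∀ τ : ℝ, dens n R (ck 0) j τ * Real.exp (-(z * (τ + x))) *
      (((n : ℝ) + j - 1) / τ) = Real.exp (-(z * x)) * (dens n R (ck 0) j τ * Real.exp (-(z * τ)) *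
      (((n : ℝ) + j - 1) / τ)) := by
    intro τ; rw [h1]; ring
  have h3 : ∀ τ : ℝ, dens n R (ck 0) j τ * Real.exp (-(z * (τ + x))) =
      Real.exp (-(z * x)) * (dens n R (ck 0) j τ * Real.exp (-(z * τ))) := by
    intro τ; rw [h1]; ring
  simp_rw [h2, h3, ENNReal.ofReal_mul (Real.exp_pos (-(z * x))).le]
  rw [lintegral_const_mul' _ _ ENNReal.ofReal_ne_top, lintegral_const_mul' _ _ ENNReal.ofReal_ne_top]
  rw [← mul_assoc, mul_comm (ENNReal.ofReal (z + ck 0)), mul_assoc]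
  gcongr
  exact lintegral_dens_div_le hn hR (ck_pos 0) (by linarith) j

/-- The (unnormalised) Fourier transform of a Gaussian as a function of the inverse width. -/
noncomputable def gk (m : ℕ) (s T : ℝ) : ℝ := T ^ (-(m : ℝ) / 2) * Real.exp (-(s ^ 2 / (4 * T)))

lemma gk_pos (m : ℕ) (s : ℝ) {T : ℝ} (hT : 0 < T) : 0 < gk m s T := by unfold gk; positivity

lemma measurable_gk (m : ℕ) (s : ℝ) : Measurable (gk m s) := by unfold gk; fun_prop

lemma hasDerivAt_gk (m : ℕ) (s : ℝ) {T : ℝ} (hT : 0 < T) :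
    HasDerivAt (gk m s) (gk m s T * (-(m / (2 * T)) + s ^ 2 / (4 * T ^ 2))) T := by
  have h1 := Real.hasDerivAt_rpow_const (x := T) (p := -(m : ℝ) / 2) (Or.inl hT.ne')
  have h2 : HasDerivAt (fun T : ℝ => -(s ^ 2 / (4 * T))) (s ^ 2 / (4 * T ^ 2)) T := by
    have := ((hasDerivAt_id T).const_mul 4).inv (by simp; positivity)
    have := (this.const_mul (s ^ 2)).neg
    refine this.congr_deriv ?_
    simp
    field_simp
  refine (h1.mul h2.exp).congr_deriv ?_
  rw [Real.rpow_sub_one hT.ne']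
  unfold gk
  field_simp

lemma hasDerivAt_dens {n : ℕ} (hn : 1 ≤ n) (R c : ℝ) (j : ℕ) {τ : ℝ} (hτ : 0 < τ) :
    HasDerivAt (dens n R c j) (dens n R c j τ * (((n : ℝ) + j - 1) / τ - c)) τ := by
  obtain ⟨k, hk⟩ : ∃ k, n + j = k + 1 := ⟨n + j - 1, by omega⟩
  have hk' : (n : ℝ) + j = k + 1 := by exact_mod_cast hk
  unfold dens
  rw [hk, Nat.add_sub_cancel, hk']
  have h1 := (((hasDerivAt_pow k τ).div_const (k.factorial : ℝ)).const_mul (c ^ (k + 1))).mul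
    (((hasDerivAt_id τ).const_mul c).neg.exp)
  refine (h1.const_mul (Real.exp (-(2 * R)) * ((2 * R) ^ j / j.factorial))).congr_deriv ?_
  have : (k : ℝ) * τ ^ (k - 1) = τ ^ k * (k / τ) := by
    rcases k with _ | k
    · simp
    · rw [Nat.add_sub_cancel, pow_succ]; field_simp
  rw [this]
  simp
  ring

lemma exp_mul_pow_le {b u : ℝ} (hb : 0 < b) (hu : 0 ≤ u) (k : ℕ) :
    u ^ k * Real.exp (-(b * u)) ≤ k.factorial / b ^ k := by
  have h := Real.pow_div_factorial_le_exp (b * u) (by positivity) k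
  rw [Real.exp_neg, ← div_eq_mul_inv, div_le_div_iff₀ (Real.exp_pos _) (by positivity)]
  rw [mul_pow, div_le_iff₀ (by positivity)] at h
  linarith

lemma exists_inv_pow_mul_gk_le (m k : ℕ) {s : ℝ} (hs : 0 < s) :
    ∃ A : ℝ, 0 ≤ A ∧ ∀ T : ℝ, 0 < T → (1 / T) ^ k * gk m s T ≤ A := by
  refine ⟨(k.factorial / (s ^ 2 / 4) ^ k) + (k + m).factorial / (s ^ 2 / 4) ^ (k + m),
    by positivity, fun T hT => ?_⟩
  have h1 : T ^ (-(m : ℝ) / 2) ≤ 1 + (1 / T) ^ m := by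
    rw [neg_div, Real.rpow_neg hT.le, ← Real.inv_rpow hT.le, ← one_div]
    have hu : 0 < 1 / T := by positivity
    rcases le_total (1 / T) 1 with h | h
    · have := Real.rpow_le_one hu.le h (by positivity : (0 : ℝ) ≤ (m : ℝ) / 2)
      have : 0 ≤ (1 / T) ^ m := by positivity
      linarith
    · have := Real.rpow_le_rpow_of_exponent_le h (by
        have : (0 : ℝ) ≤ m := Nat.cast_nonneg m
        linarith : (m : ℝ) / 2 ≤ m)
      rw [Real.rpow_natCast] at this
      linarith
  have e1 : Real.exp (-(s ^ 2 / (4 * T))) = Real.exp (-(s ^ 2 / 4 * (1 / T))) := by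
    congr 1; field_simp
  have h2 := exp_mul_pow_le (b := s ^ 2 / 4) (u := 1 / T) (by positivity) (by positivity) k
  have h3 := exp_mul_pow_le (b := s ^ 2 / 4) (u := 1 / T) (by positivity) (by positivity) (k + m)
  rw [← e1] at h2 h3
  calc (1 / T) ^ k * gk m s T
      ≤ (1 / T) ^ k * ((1 + (1 / T) ^ m) * Real.exp (-(s ^ 2 / (4 * T)))) := by
        unfold gk; gcongr
    _ = (1 / T) ^ k * Real.exp (-(s ^ 2 / (4 * T)))
        + (1 / T) ^ (k + m) * Real.exp (-(s ^ 2 / (4 * T))) := by rw [pow_add]; ring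
    _ ≤ _ := add_le_add h2 h3

/-- The unnormalised density of the mixing measure. -/
noncomputable def wt (n m : ℕ) (R s : ℝ) (ω : (ℕ × ℝ) × ℝ) : ℝ :=
  dens n R (ck 0) ω.1.1 ω.2 * gk m s (ω.2 + ω.1.2)

lemma measurable_wt (n m : ℕ) (R s : ℝ) : Measurable (wt n m R s) :=
  (measurable_dens n R (ck 0)).mul ((measurable_gk m s).comp (by fun_prop))

lemma measurable_shape : Measurable (fun ω : (ℕ × ℝ) × ℝ => ((ω.1.1 : ℕ) : ℝ)) :=
  (measurable_from_nat (f := fun k : ℕ => (k : ℝ))).comp (measurable_fst.comp measurable_fst)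

lemma wt_pos {n m : ℕ} {R s : ℝ} (hR : 0 < R) {ω : (ℕ × ℝ) × ℝ} (h1 : 0 ≤ ω.1.2) (h2 : 0 < ω.2) :
    0 < wt n m R s ω :=
  mul_pos (dens_pos n hR (ck_pos 0) _ h2) (gk_pos m s (by linarith))

/-- Functions with a bound of this type are integrable against the mixing measure. -/
lemma integrable_mul_wt {n m : ℕ} (hn : 1 ≤ n) {R s : ℝ} (hR : 0 < R) (hs : 0 < s) (N : ℕ)
    {F : (ℕ × ℝ) × ℝ → ℝ} (hF : Measurable F) (A : ℝ) (k : ℕ)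
    (hb : ∀ j : ℕ, ∀ x τ : ℝ, 0 ≤ x → 0 < τ → |F ((j, x), τ)| ≤
      A * (1 + ((n : ℝ) + j - 1) / τ) * Real.exp (τ + x) * (1 + (1 / (τ + x)) ^ k)) :
    Integrable (fun ω => F ω * wt n m R s ω) (base n R N) := by
  have hm1 : Measurable (fun ω : (ℕ × ℝ) × ℝ =>
      dens n R (ck 0) ω.1.1 ω.2 * Real.exp (-(-1 * (ω.2 + ω.1.2)))) :=
    (measurable_dens n R (ck 0)).mul (by fun_prop)
  have hm2 := measurable_shape
  have i1 : Integrable (fun ω : (ℕ × ℝ) × ℝ =>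
      dens n R (ck 0) ω.1.1 ω.2 * Real.exp (-(-1 * (ω.2 + ω.1.2)))) (base n R N) := by
    refine ⟨hm1.aestronglyMeasurable, ?_⟩
    rw [hasFiniteIntegral_iff_ofReal]
    · rw [laplace_base hn hR.le N le_rfl]
      exact ENNReal.ofReal_lt_top
    · filter_upwards [ae_base hn hR.le N] with ω hω
      have := dens_nonneg n hR.le (ck_pos 0).le ω.1.1 hω.2.le
      simp only [Pi.zero_apply]
      positivity
  have i2 : Integrable (fun ω : (ℕ × ℝ) × ℝ =>
      dens n R (ck 0) ω.1.1 ω.2 * Real.exp (-(-1 * (ω.2 + ω.1.2))) * (((n : ℝ) + ω.1.1 - 1) / ω.2))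
      (base n R N) := by
    refine ⟨(by fun_prop : Measurable _).aestronglyMeasurable, ?_⟩
    rw [hasFiniteIntegral_iff_ofReal]
    · refine (laplace_base_div hn hR.le N le_rfl).trans_lt ?_
      exact ENNReal.mul_lt_top ENNReal.ofReal_lt_top ENNReal.ofReal_lt_top
    · filter_upwards [ae_base hn hR.le N] with ω hω
      have := dens_nonneg n hR.le (ck_pos 0).le ω.1.1 hω.2.le
      have h1 : (1 : ℝ) ≤ n := by exact_mod_cast hn
      have h2 : (0 : ℝ) ≤ ω.1.1 := Nat.cast_nonneg _
      have : 0 ≤ ((n : ℝ) + ω.1.1 - 1) / ω.2 := div_nonneg (by linarith) hω.2.le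
      simp only [Pi.zero_apply]
      positivity
  obtain ⟨A0, hA0, hg0⟩ := exists_inv_pow_mul_gk_le m 0 hs
  obtain ⟨A1, hA1, hg1⟩ := exists_inv_pow_mul_gk_le m k hs
  refine ((i1.add i2).const_mul (|A| * (A0 + A1))).mono'
    (hF.mul (measurable_wt n m R s)).aestronglyMeasurable ?_
  filter_upwards [ae_base hn hR.le N] with ⟨⟨j, x⟩, τ⟩ ⟨hx, hτ⟩
  simp only at hx hτ ⊢
  have hT : 0 < τ + x := by linarith
  have hd := dens_nonneg n hR.le (ck_pos 0).le j hτ.le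
  have hg := (gk_pos m s hT).le
  have h1 : (1 : ℝ) ≤ n := by exact_mod_cast hn
  have h2 : (0 : ℝ) ≤ j := Nat.cast_nonneg _
  have hq : 0 ≤ ((n : ℝ) + j - 1) / τ := div_nonneg (by linarith) hτ.le
  have h3 := hg0 _ hT
  have h4 := hg1 _ hT
  rw [Real.norm_eq_abs, abs_mul, abs_of_nonneg (wt_pos hR hx hτ).le]
  have hT' : 0 < 1 / (τ + x) := by positivity
  calc |F ((j, x), τ)| * wt n m R s ((j, x), τ)
      ≤ (|A| * (1 + ((n : ℝ) + j - 1) / τ) * Real.exp (τ + x) * (1 + (1 / (τ + x)) ^ k)) *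
        wt n m R s ((j, x), τ) := by
        gcongr
        · exact (wt_pos hR hx hτ).le
        · refine (hb j x τ hx hτ).trans ?_
          gcongr
          exact le_abs_self A
    _ = (|A| * (1 + ((n : ℝ) + j - 1) / τ) * Real.exp (τ + x) * dens n R (ck 0) j τ) *
        ((1 / (τ + x)) ^ 0 * gk m s (τ + x) + (1 / (τ + x)) ^ k * gk m s (τ + x)) := by
        unfold wt; ring
    _ ≤ (|A| * (1 + ((n : ℝ) + j - 1) / τ) * Real.exp (τ + x) * dens n R (ck 0) j τ) * (A0 + A1) := by
        gcongr
    _ = _ := by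
        simp only [Pi.add_apply]
        have : -(-1 * (τ + x)) = τ + x := by ring
        rw [this]
        ring

lemma setIntegral_deriv_nonpos {F F' : ℝ → ℝ} (hd : ∀ τ, 0 < τ → HasDerivAt F (F' τ) τ)
    (hF : IntegrableOn F (Set.Ioi 0)) (hF' : IntegrableOn F' (Set.Ioi 0)) (A : ℝ)
    (h0 : ∀ τ, 0 < τ → τ ≤ 1 → -(A * τ) ≤ F τ) : ∫ τ in Set.Ioi (0 : ℝ), F' τ ≤ 0 := by
  have hU : (⋃ k : ℕ, Set.Ioi (1 / ((k : ℝ) + 1))) = Set.Ioi 0 := by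
    ext x
    simp only [Set.mem_iUnion, Set.mem_Ioi]
    constructor
    · rintro ⟨k, hk⟩
      exact lt_trans (by positivity) hk
    · intro hx
      exact exists_nat_one_div_lt hx
  have hmono : Monotone (fun k : ℕ => Set.Ioi (1 / ((k : ℝ) + 1))) := by
    intro a b hab
    exact Set.Ioi_subset_Ioi (Nat.one_div_le_one_div hab)
  have ht := tendsto_setIntegral_of_monotone (μ := volume) (f := F')
    (fun k : ℕ => (measurableSet_Ioi : MeasurableSet (Set.Ioi (1 / ((k : ℝ) + 1))))) hmono
    (by rw [hU]; exact hF')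
  rw [hU] at ht
  have hz : Tendsto F atTop (𝓝 0) := tendsto_zero_of_hasDerivAt_of_integrableOn_Ioi
    (a := 0) (fun x hx => hd x hx) hF' hF
  have hle : ∀ k : ℕ, ∫ τ in Set.Ioi (1 / ((k : ℝ) + 1)), F' τ ≤ A * (1 / ((k : ℝ) + 1)) := by
    intro k
    have hp : 0 < 1 / ((k : ℝ) + 1) := by positivity
    rw [integral_Ioi_of_hasDerivAt_of_tendsto' (fun x hx => hd x (lt_of_lt_of_le hp hx))
      (hF'.mono_set (Set.Ioi_subset_Ioi hp.le)) hz]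
    have := h0 _ hp (by
      rw [div_le_one (by positivity)]
      have : (0 : ℝ) ≤ k := Nat.cast_nonneg k
      linarith)
    linarith
  refine le_of_tendsto_of_tendsto' ht ?_ hle
  simpa using tendsto_one_div_add_atTop_nhds_zero_nat.const_mul A

lemma hasDerivAt_wt {n : ℕ} (hn : 1 ≤ n) (m : ℕ) (R s : ℝ) (j : ℕ) {x τ : ℝ} (hx : 0 ≤ x)
    (hτ : 0 < τ) : HasDerivAt (fun t => wt n m R s ((j, x), t))
      (wt n m R s ((j, x), τ) * (((n : ℝ) + j - 1) / τ +
        ((s / (2 * (τ + x))) ^ 2 - m / (2 * (τ + x)) - ck 0))) τ := by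
  have hT : 0 < τ + x := by linarith
  have h1 := hasDerivAt_dens hn R (ck 0) j hτ
  have h2 := (hasDerivAt_gk m s hT).comp_add_const τ x
  refine (h1.mul h2).congr_deriv ?_
  unfold wt
  simp only
  field_simp
  ring

/-- Integration by parts in the variable `τ`. -/
lemma integral_by_parts {n m : ℕ} (hn : 1 ≤ n) {R s : ℝ} (hR : 0 < R) (hs : 0 < s) (N : ℕ)
    {h h' : (ℕ × ℝ) × ℝ → ℝ}
    (hd : ∀ (j : ℕ) (x τ : ℝ), 0 ≤ x → 0 < τ →
      HasDerivAt (fun t => h ((j, x), t)) (h' ((j, x), τ)) τ)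
    (i1 : Integrable (fun ω => h ω * wt n m R s ω) (base n R N))
    (i2 : Integrable (fun ω => (((n : ℝ) + ω.1.1 - 1) / ω.2 * h ω +
      ((s / (2 * (ω.2 + ω.1.2))) ^ 2 - m / (2 * (ω.2 + ω.1.2)) - ck 0) * h ω + h' ω) * wt n m R s ω)
      (base n R N))
    (A : ℝ) (h0 : ∀ (j : ℕ) (x τ : ℝ), 0 ≤ x → 0 < τ → τ ≤ 1 → -(A * τ) ≤ h ((j, x), τ)) :
    ∫ ω, (((n : ℝ) + ω.1.1 - 1) / ω.2 * h ω +
      ((s / (2 * (ω.2 + ω.1.2))) ^ 2 - m / (2 * (ω.2 + ω.1.2)) - ck 0) * h ω + h' ω) * wt n m R s ω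
      ∂(base n R N) ≤ 0 := by
  have := isProbabilityMeasure_tailLaw hn hR.le N
  have hae : ∀ᵐ p ∂((Measure.count : Measure ℕ).prod (tailLaw n R N)), 0 ≤ p.2 :=
    Measure.quasiMeasurePreserving_snd.ae (ae_nonneg_tailLaw hn hR.le N)
  unfold base at i1 i2 ⊢
  rw [integral_prod _ i2]
  refine integral_nonpos_of_ae ?_
  filter_upwards [hae, i1.prod_right_ae, i2.prod_right_ae] with ⟨j, x⟩ hx j1 j2
  simp only at hx
  obtain ⟨A0, hA0, hg0⟩ := exists_inv_pow_mul_gk_le m 0 hs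
  obtain ⟨C, hC⟩ := (isCompact_Icc (a := (0 : ℝ)) (b := 1)).exists_bound_of_continuousOn
    (continuous_dens n R (ck 0) j).continuousOn
  refine setIntegral_deriv_nonpos (F := fun τ => h ((j, x), τ) * wt n m R s ((j, x), τ))
    (fun τ hτ => ?_) j1 j2 (|A| * (|C| * A0)) (fun τ hτ hτ1 => ?_)
  · refine ((hd j x τ hx hτ).mul (hasDerivAt_wt hn m R s j hx hτ)).congr_deriv ?_
    simp only
    ring
  · have hT : 0 < τ + x := by linarith
    have h1 := h0 j x τ hx hτ hτ1
    have h2 := hC τ ⟨hτ.le, hτ1⟩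
    have hdn := dens_nonneg n hR.le (ck_pos 0).le j hτ.le
    rw [Real.norm_eq_abs, abs_of_nonneg hdn] at h2
    have h3 : wt n m R s ((j, x), τ) ≤ |C| * A0 := by
      unfold wt
      have := hg0 _ hT
      rw [pow_zero, one_mul] at this
      have := (gk_pos m s hT).le
      have := h2.trans (le_abs_self C)
      simp only
      gcongr
    have hw := (wt_pos (n := n) (m := m) (s := s) hR (ω := ((j, x), τ)) hx hτ).le
    have h4 : -(|A| * τ) ≤ h ((j, x), τ) := by
      have : A * τ ≤ |A| * τ := by gcongr; exact le_abs_self A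
      linarith
    have h5 : -(|A| * τ) * wt n m R s ((j, x), τ) ≤ h ((j, x), τ) * wt n m R s ((j, x), τ) := by
      gcongr
    have h6 : |A| * τ * wt n m R s ((j, x), τ) ≤ |A| * τ * (|C| * A0) := by gcongr
    linarith

/-- Total mass of the mixing measure. -/
noncomputable def mass (n m : ℕ) (R s : ℝ) (N : ℕ) : ℝ := ∫ ω, wt n m R s ω ∂(base n R N)

lemma integrable_wt {n m : ℕ} (hn : 1 ≤ n) {R s : ℝ} (hR : 0 < R) (hs : 0 < s) (N : ℕ) :
    Integrable (wt n m R s) (base n R N) := by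
  have := integrable_mul_wt (m := m) hn hR hs N (F := fun _ => 1) measurable_const 1 0 (by
    intro j x τ hx hτ
    have h1 : (1 : ℝ) ≤ n := by exact_mod_cast hn
    have h2 : (0 : ℝ) ≤ j := Nat.cast_nonneg _
    have hq : 0 ≤ ((n : ℝ) + j - 1) / τ := div_nonneg (by linarith) hτ.le
    have := Real.one_le_exp (by linarith : 0 ≤ τ + x)
    simp only [abs_one, one_mul, pow_zero]
    nlinarith [mul_nonneg hq (by linarith : 0 ≤ Real.exp (τ + x))])
  simpa using this

lemma mass_pos {n m : ℕ} (hn : 1 ≤ n) {R s : ℝ} (hR : 0 < R) (hs : 0 < s) (N : ℕ) :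
    0 < mass n m R s N := by
  have := isProbabilityMeasure_tailLaw hn hR.le N
  have hae : ∀ᵐ ω ∂(base n R N), 0 < wt n m R s ω := by
    filter_upwards [ae_base hn hR.le N] with ω hω
    exact wt_pos hR hω.1 hω.2
  have h0 : 0 ≤ᵐ[base n R N] wt n m R s := hae.mono (fun ω h => h.le)
  refine lt_of_le_of_ne (integral_nonneg_of_ae h0) (fun h => ?_)
  have h1 := (integral_eq_zero_iff_of_nonneg_ae h0 (integrable_wt hn hR hs N)).mp h.symm
  have h2 : ∀ᵐ ω ∂(base n R N), False := by
    filter_upwards [hae, h1] with ω ha hb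
    simp only [Pi.zero_apply] at hb
    linarith
  have h3 : base n R N = 0 := by
    rw [ae_iff] at h2
    simpa using h2
  have h4 : base n R N Set.univ = ⊤ := by
    rw [base, ← Set.univ_prod_univ, Measure.prod_prod, ← Set.univ_prod_univ, Measure.prod_prod]
    simp
  rw [h3] at h4
  simp at h4

/-- The mixing probability measure. -/
noncomputable def mix (n m : ℕ) (R s : ℝ) (N : ℕ) : Measure ((ℕ × ℝ) × ℝ) :=
  (base n R N).withDensity (fun ω => ENNReal.ofReal (wt n m R s ω / mass n m R s N))

lemma ae_mix {n m : ℕ} (hn : 1 ≤ n) {R s : ℝ} (hR : 0 < R) (N : ℕ) : ∀ᵐ ω ∂(mix n m R s N), 0 ≤ ω.1.2 ∧ 0 < ω.2 :=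
  (withDensity_absolutelyContinuous _ _).ae_le (ae_base hn hR.le N)

lemma ae_mix_density {n m : ℕ} (hn : 1 ≤ n) {R s : ℝ} (hR : 0 < R) (hs : 0 < s) (N : ℕ) : ∀ᵐ ω ∂(base n R N),
    (ENNReal.ofReal (wt n m R s ω / mass n m R s N)).toReal = wt n m R s ω / mass n m R s N := by
  filter_upwards [ae_base hn hR.le N] with ω hω
  exact ENNReal.toReal_ofReal (div_nonneg (wt_pos hR hω.1 hω.2).le (mass_pos hn hR hs N).le)

lemma integral_mix {n m : ℕ} (hn : 1 ≤ n) {R s : ℝ} (hR : 0 < R) (hs : 0 < s) (N : ℕ)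
    (F : (ℕ × ℝ) × ℝ → ℝ) :
    ∫ ω, F ω ∂(mix n m R s N) = (∫ ω, F ω * wt n m R s ω ∂(base n R N)) / mass n m R s N := by
  rw [mix, integral_withDensity_eq_integral_toReal_smul
    ((measurable_wt n m R s).div_const _).ennreal_ofReal
    (ae_of_all _ (fun _ => ENNReal.ofReal_lt_top)), ← integral_div]
  refine integral_congr_ae ?_
  filter_upwards [ae_mix_density (m := m) hn hR hs N] with ω hω
  rw [hω, smul_eq_mul]
  ring

lemma integrable_mix_iff {n m : ℕ} (hn : 1 ≤ n) {R s : ℝ} (hR : 0 < R) (hs : 0 < s) (N : ℕ)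
    (F : (ℕ × ℝ) × ℝ → ℝ) :
    Integrable F (mix n m R s N) ↔ Integrable (fun ω => F ω * wt n m R s ω) (base n R N) := by
  rw [mix, integrable_withDensity_iff ((measurable_wt n m R s).div_const _).ennreal_ofReal
    (ae_of_all _ (fun _ => ENNReal.ofReal_lt_top))]
  have : (fun ω => F ω * (ENNReal.ofReal (wt n m R s ω / mass n m R s N)).toReal) =ᵐ[base n R N]
      fun ω => F ω * wt n m R s ω * (mass n m R s N)⁻¹ := by
    filter_upwards [ae_mix_density (m := m) hn hR hs N] with ω hω
    rw [hω]; ring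
  rw [integrable_congr this]
  exact integrable_mul_const_iff (mass_pos hn hR hs N).ne'.isUnit.inv _

lemma isProbabilityMeasure_mix {n m : ℕ} (hn : 1 ≤ n) {R s : ℝ} (hR : 0 < R) (hs : 0 < s) (N : ℕ) :
    IsProbabilityMeasure (mix n m R s N) := by
  constructor
  have hm := mass_pos (m := m) hn hR hs N
  rw [mix, withDensity_apply _ MeasurableSet.univ, Measure.restrict_univ,
    ← ofReal_integral_eq_lintegral_ofReal ((integrable_wt hn hR hs N).div_const _), integral_div]
  · change ENNReal.ofReal (mass n m R s N / mass n m R s N) = 1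
    rw [div_self hm.ne', ENNReal.ofReal_one]
  · filter_upwards [ae_base hn hR.le N] with ω hω
    exact div_nonneg (wt_pos hR hω.1 hω.2).le hm.le

/-- The Gamma variable. -/
def tau (ω : (ℕ × ℝ) × ℝ) : ℝ := ω.2

/-- The total inverse width. -/
def tt (ω : (ℕ × ℝ) × ℝ) : ℝ := ω.2 + ω.1.2

/-- The reciprocal of the total inverse width. -/
noncomputable def iT (ω : (ℕ × ℝ) × ℝ) : ℝ := 1 / (ω.2 + ω.1.2)

/-- The reciprocal of the shape of the Gamma variable. -/
noncomputable def iN (n : ℕ) (ω : (ℕ × ℝ) × ℝ) : ℝ := 1 / ((n : ℝ) + ω.1.1)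

/-- The logarithmic derivative of the Gaussian factor in the phase. -/
noncomputable def yv (s : ℝ) (ω : (ℕ × ℝ) × ℝ) : ℝ := s / (2 * (ω.2 + ω.1.2))

/-- Functions of moderate growth in the total inverse width and its reciprocal. -/
class Tame (F : (ℕ × ℝ) × ℝ → ℝ) : Prop where
  meas : Measurable F
  bound : ∃ A : ℝ, 0 ≤ A ∧ ∃ k : ℕ, ∀ (j : ℕ) (x τ : ℝ), 0 ≤ x → 0 < τ →
    |F ((j, x), τ)| ≤ A * ((1 + (τ + x)) * (1 + 1 / (τ + x))) ^ k

lemma one_le_tame_base {T : ℝ} (hT : 0 < T) : 1 ≤ (1 + T) * (1 + 1 / T) := by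
  have : 0 < 1 / T := by positivity
  nlinarith [mul_pos hT this]

instance Tame.const (a : ℝ) : Tame (fun _ => a) :=
  ⟨measurable_const, |a|, abs_nonneg a, 0, fun _ _ _ _ _ => by simp⟩

instance Tame.add (F G : (ℕ × ℝ) × ℝ → ℝ) [hF : Tame F] [hG : Tame G] :
    Tame (fun ω => F ω + G ω) := by
  obtain ⟨A, hA, k, hk⟩ := hF.bound
  obtain ⟨B, hB, l, hl⟩ := hG.bound
  refine ⟨hF.meas.add hG.meas, A + B, by positivity, k + l, fun j x τ hx hτ => ?_⟩
  have h1 := one_le_tame_base (by linarith : 0 < τ + x)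
  calc _ ≤ |F ((j, x), τ)| + |G ((j, x), τ)| := abs_add_le _ _
    _ ≤ A * ((1 + (τ + x)) * (1 + 1 / (τ + x))) ^ k + B * ((1 + (τ + x)) * (1 + 1 / (τ + x))) ^ l :=
      add_le_add (hk j x τ hx hτ) (hl j x τ hx hτ)
    _ ≤ A * ((1 + (τ + x)) * (1 + 1 / (τ + x))) ^ (k + l) +
        B * ((1 + (τ + x)) * (1 + 1 / (τ + x))) ^ (k + l) := by
      have h2 := pow_le_pow_right₀ h1 (Nat.le_add_right k l)
      have h3 := pow_le_pow_right₀ h1 (Nat.le_add_left l k)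
      gcongr
    _ = _ := by ring

instance Tame.mul (F G : (ℕ × ℝ) × ℝ → ℝ) [hF : Tame F] [hG : Tame G] :
    Tame (fun ω => F ω * G ω) := by
  obtain ⟨A, hA, k, hk⟩ := hF.bound
  obtain ⟨B, hB, l, hl⟩ := hG.bound
  refine ⟨hF.meas.mul hG.meas, A * B, by positivity, k + l, fun j x τ hx hτ => ?_⟩
  have h1 := one_le_tame_base (by linarith : 0 < τ + x)
  rw [abs_mul]
  calc _ ≤ (A * ((1 + (τ + x)) * (1 + 1 / (τ + x))) ^ k) *
        (B * ((1 + (τ + x)) * (1 + 1 / (τ + x))) ^ l) :=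
      mul_le_mul (hk j x τ hx hτ) (hl j x τ hx hτ) (abs_nonneg _) ((abs_nonneg _).trans (hk j x τ hx hτ))
    _ = _ := by rw [pow_add]; ring

instance Tame.pow (F : (ℕ × ℝ) × ℝ → ℝ) [hF : Tame F] (k : ℕ) : Tame (fun ω => F ω ^ k) := by
  induction k with
  | zero => simp only [pow_zero]; infer_instance
  | succ k ih => simp only [pow_succ]; exact Tame.mul _ F

instance Tame.neg (F : (ℕ × ℝ) × ℝ → ℝ) [hF : Tame F] : Tame (fun ω => -F ω) := by
  have := @Tame.mul (fun _ => (-1 : ℝ)) F (Tame.const _) hF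
  simpa using this

instance Tame.sub (F G : (ℕ × ℝ) × ℝ → ℝ) [hF : Tame F] [hG : Tame G] :
    Tame (fun ω => F ω - G ω) := by
  simp only [sub_eq_add_neg]; exact Tame.add F _

instance Tame.div_const (F : (ℕ × ℝ) × ℝ → ℝ) (a : ℝ) [hF : Tame F] :
    Tame (fun ω => F ω / a) := by
  simp only [div_eq_mul_inv]; exact Tame.mul F _

instance Tame.tt : Tame tt := by
  refine ⟨by unfold OUPotential.tt; fun_prop, 1, zero_le_one, 1, fun j x τ hx hτ => ?_⟩
  have hT : 0 < τ + x := by linarith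
  unfold OUPotential.tt
  rw [abs_of_pos hT, one_mul, pow_one]
  have : 0 < 1 / (τ + x) := by positivity
  nlinarith [mul_pos hT this]

instance Tame.tau : Tame tau := by
  refine ⟨by unfold OUPotential.tau; fun_prop, 1, zero_le_one, 1, fun j x τ hx hτ => ?_⟩
  have hT : 0 < τ + x := by linarith
  unfold OUPotential.tau
  rw [abs_of_pos hτ, one_mul, pow_one]
  have : 0 < 1 / (τ + x) := by positivity
  nlinarith [mul_pos hT this]

instance Tame.iT : Tame iT := by
  refine ⟨by unfold OUPotential.iT; fun_prop, 1, zero_le_one, 1, fun j x τ hx hτ => ?_⟩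
  have hT : 0 < τ + x := by linarith
  have : 0 < 1 / (τ + x) := by positivity
  unfold OUPotential.iT
  rw [abs_of_pos this, one_mul, pow_one]
  nlinarith [mul_pos hT this]

instance Tame.yv (s : ℝ) : Tame (yv s) := by
  have : OUPotential.yv s = fun ω => s / 2 * OUPotential.iT ω := by
    ext ω
    unfold OUPotential.yv OUPotential.iT
    rw [div_mul_div_comm, mul_one]
  rw [this]
  infer_instance

instance Tame.iN (n : ℕ) : Tame (iN n) := by
  have hm := measurable_shape
  refine ⟨by unfold OUPotential.iN; fun_prop, 1, zero_le_one, 0, fun j x τ hx hτ => ?_⟩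
  unfold OUPotential.iN
  simp only
  rw [pow_zero, mul_one, ← Nat.cast_add, abs_of_nonneg (by positivity)]
  rcases Nat.eq_zero_or_pos (n + j) with h | h
  · simp [h]
  · rw [div_le_one (by exact_mod_cast h)]
    exact_mod_cast h

lemma tame_bound_le {T : ℝ} (hT : 0 < T) (k : ℕ) :
    ((1 + T) * (1 + 1 / T)) ^ k ≤
      (k.factorial * Real.exp 1 * 2 ^ k) * Real.exp T * (1 + (1 / T) ^ k) := by
  have h1 : (1 + T) ^ k ≤ k.factorial * (Real.exp 1 * Real.exp T) := by
    have := Real.pow_div_factorial_le_exp (1 + T) (by positivity) k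
    rw [div_le_iff₀ (by positivity), Real.exp_add] at this
    linarith
  have h2 : (1 + 1 / T) ^ k ≤ 2 ^ k * (1 + (1 / T) ^ k) := by
    refine (add_pow_le zero_le_one (by positivity) k).trans ?_
    rw [one_pow]
    gcongr
    · norm_num
    · omega
  rw [mul_pow]
  calc _ ≤ (k.factorial * (Real.exp 1 * Real.exp T)) * (2 ^ k * (1 + (1 / T) ^ k)) := by gcongr
    _ = _ := by ring

lemma shape_sub_one_nonneg {n : ℕ} (hn : 1 ≤ n) (j : ℕ) : 0 ≤ (n : ℝ) + j - 1 := by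
  have h1 : (1 : ℝ) ≤ n := by exact_mod_cast hn
  have h2 : (0 : ℝ) ≤ j := Nat.cast_nonneg _
  linarith

lemma Tame.integrable {F : (ℕ × ℝ) × ℝ → ℝ} (hF : Tame F) {n m : ℕ} (hn : 1 ≤ n) {R s : ℝ}
    (hR : 0 < R) (hs : 0 < s) (N : ℕ) : Integrable F (mix n m R s N) := by
  rw [integrable_mix_iff hn hR hs N]
  obtain ⟨A, hA, k, hk⟩ := hF.bound
  refine integrable_mul_wt hn hR hs N hF.meas (A * (k.factorial * Real.exp 1 * 2 ^ k)) k
    (fun j x τ hx hτ => (hk j x τ hx hτ).trans ?_)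
  have hT : 0 < τ + x := by linarith
  have hq := div_nonneg (shape_sub_one_nonneg hn j) hτ.le
  have h0 : 0 ≤ A * ((k.factorial * Real.exp 1 * 2 ^ k) * Real.exp (τ + x) * (1 + (1 / (τ + x)) ^ k)) := by
    positivity
  calc _ ≤ A * ((k.factorial * Real.exp 1 * 2 ^ k) * Real.exp (τ + x) * (1 + (1 / (τ + x)) ^ k)) * 1 := by
        rw [mul_one]; gcongr; exact tame_bound_le hT k
    _ ≤ A * ((k.factorial * Real.exp 1 * 2 ^ k) * Real.exp (τ + x) * (1 + (1 / (τ + x)) ^ k)) *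
        (1 + ((n : ℝ) + j - 1) / τ) := by gcongr; linarith
    _ = _ := by ring

lemma Tame.integrable_div {F : (ℕ × ℝ) × ℝ → ℝ} (hF : Tame F) {n m : ℕ} (hn : 1 ≤ n) {R s : ℝ}
    (hR : 0 < R) (hs : 0 < s) (N : ℕ) :
    Integrable (fun ω => ((n : ℝ) + ω.1.1 - 1) / ω.2 * F ω) (mix n m R s N) := by
  rw [integrable_mix_iff hn hR hs N]
  obtain ⟨A, hA, k, hk⟩ := hF.bound
  have hm := measurable_shape
  have hm' := hF.meas
  refine integrable_mul_wt hn hR hs N (by fun_prop) (A * (k.factorial * Real.exp 1 * 2 ^ k)) k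
    (fun j x τ hx hτ => ?_)
  have hT : 0 < τ + x := by linarith
  have hq := div_nonneg (shape_sub_one_nonneg hn j) hτ.le
  rw [abs_mul, abs_of_nonneg hq]
  calc _ ≤ ((n : ℝ) + j - 1) / τ *
        (A * ((k.factorial * Real.exp 1 * 2 ^ k) * Real.exp (τ + x) * (1 + (1 / (τ + x)) ^ k))) := by
        gcongr; exact (hk j x τ hx hτ).trans (by gcongr; exact tame_bound_le hT k)
    _ ≤ (1 + ((n : ℝ) + j - 1) / τ) *
        (A * ((k.factorial * Real.exp 1 * 2 ^ k) * Real.exp (τ + x) * (1 + (1 / (τ + x)) ^ k))) := by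
        gcongr; linarith
    _ = _ := by ring

/-- A normalised positive linear functional on tame functions. -/
structure IsMean (E : ((ℕ × ℝ) × ℝ → ℝ) → ℝ) : Prop where
  add : ∀ (F G : (ℕ × ℝ) × ℝ → ℝ) (_ : Tame F := by infer_instance)
    (_ : Tame G := by infer_instance), E (fun ω => F ω + G ω) = E F + E G
  smul : ∀ (a : ℝ) (F : (ℕ × ℝ) × ℝ → ℝ), E (fun ω => a * F ω) = a * E F
  mono : ∀ (F G : (ℕ × ℝ) × ℝ → ℝ)
    (_ : ∀ (j : ℕ) (x τ : ℝ), 0 ≤ x → 0 < τ → F ((j, x), τ) ≤ G ((j, x), τ))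
    (_ : Tame F := by infer_instance) (_ : Tame G := by infer_instance), E F ≤ E G
  one : ∀ a : ℝ, E (fun _ => a) = a

lemma isMean_mix {n m : ℕ} (hn : 1 ≤ n) {R s : ℝ} (hR : 0 < R) (hs : 0 < s) (N : ℕ) :
    IsMean (fun F => ∫ ω, F ω ∂(mix n m R s N)) := by
  have := isProbabilityMeasure_mix (m := m) hn hR hs N
  refine ⟨fun F G hF hG => integral_add (hF.integrable hn hR hs N) (hG.integrable hn hR hs N),
    fun a F => integral_const_mul a F, fun F G h hF hG => ?_, fun a => by simp⟩
  refine integral_mono_ae (hF.integrable hn hR hs N) (hG.integrable hn hR hs N) ?_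
  filter_upwards [ae_mix (m := m) (s := s) hn hR N] with ω hω
  exact h ω.1.1 ω.1.2 ω.2 hω.1 hω.2

lemma IsMean.sub {E : ((ℕ × ℝ) × ℝ → ℝ) → ℝ} (hE : IsMean E) (F G : (ℕ × ℝ) × ℝ → ℝ)
    (_ : Tame F := by infer_instance) (_ : Tame G := by infer_instance) : E (fun ω => F ω - G ω) = E F - E G := by
  have h := hE.add F (fun ω => -1 * G ω)
  rw [hE.smul] at h
  have e : (fun ω => F ω - G ω) = fun ω => F ω + -1 * G ω := by ext; ring
  rw [e, h]; ring

/-- Integration by parts against the mixing measure. -/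
lemma mix_ibp {n m : ℕ} (hn : 1 ≤ n) {R s : ℝ} (hR : 0 < R) (hs : 0 < s) (N : ℕ)
    (h h' : (ℕ × ℝ) × ℝ → ℝ)
    (hd : ∀ (j : ℕ) (x τ : ℝ), 0 ≤ x → 0 < τ →
      HasDerivAt (fun t => h ((j, x), t)) (h' ((j, x), τ)) τ)
    (A : ℝ) (h0 : ∀ (j : ℕ) (x τ : ℝ), 0 ≤ x → 0 < τ → τ ≤ 1 → -(A * τ) ≤ h ((j, x), τ))
    (hh : Tame h := by infer_instance) (hh' : Tame h' := by infer_instance) :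
    ∫ ω, ((n : ℝ) + ω.1.1 - 1) / ω.2 * h ω ∂(mix n m R s N) +
      ∫ ω, ((yv s ω ^ 2 - m / 2 * iT ω - ck 0) * h ω + h' ω) ∂(mix n m R s N) ≤ 0 := by
  have e : ∀ ω : (ℕ × ℝ) × ℝ, ((n : ℝ) + ω.1.1 - 1) / ω.2 * h ω +
      ((s / (2 * (ω.2 + ω.1.2))) ^ 2 - m / (2 * (ω.2 + ω.1.2)) - ck 0) * h ω + h' ω =
      ((n : ℝ) + ω.1.1 - 1) / ω.2 * h ω + ((yv s ω ^ 2 - m / 2 * iT ω - ck 0) * h ω + h' ω) := by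
    intro ω
    unfold yv iT
    rw [div_mul_div_comm, mul_one, add_assoc]
  have j1 := hh.integrable_div (m := m) hn hR hs N
  have j2 := (inferInstance : Tame (fun ω => ((yv s ω ^ 2 - m / 2 * iT ω - ck 0) * h ω + h' ω))).integrable
    (m := m) hn hR hs N
  have j3 := (integrable_mix_iff hn hR hs N _).mp (j1.add j2)
  have := integral_by_parts (m := m) hn hR hs N hd ((integrable_mix_iff hn hR hs N _).mp
    (hh.integrable hn hR hs N)) (j3.congr (ae_of_all _ fun ω => by
      simp only [Pi.add_apply, e])) A h0
  rw [← integral_add j1 j2, integral_mix hn hR hs N]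
  simp only [e] at this
  exact div_nonpos_of_nonpos_of_nonneg this (mass_pos hn hR hs N).le

lemma integral_div_mul_nonneg {n m : ℕ} (hn : 1 ≤ n) {R s : ℝ} (hR : 0 < R) (N : ℕ)
    {h : (ℕ × ℝ) × ℝ → ℝ}
    (h0 : ∀ (j : ℕ) (x τ : ℝ), 0 ≤ x → 0 < τ → 0 ≤ h ((j, x), τ)) :
    0 ≤ ∫ ω, ((n : ℝ) + ω.1.1 - 1) / ω.2 * h ω ∂(mix n m R s N) := by
  refine integral_nonneg_of_ae ?_
  filter_upwards [ae_mix (m := m) (s := s) hn hR N] with ω hω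
  exact mul_nonneg (div_nonneg (shape_sub_one_nonneg hn _) hω.2.le) (h0 _ _ _ hω.1 hω.2)

/-- Comparison of consecutive Gamma components. -/
lemma balance {n m : ℕ} (hn : 1 ≤ n) {R s : ℝ} (hR : 0 < R) (hs : 0 < s) (N : ℕ)
    {H G : (ℕ × ℝ) × ℝ → ℝ} (iH : Integrable H (mix n m R s N)) (iG : Integrable G (mix n m R s N))
    (hH : ∀ (j : ℕ) (x τ : ℝ), 0 ≤ x → 0 < τ → 0 ≤ H ((j, x), τ))
    (hG : ∀ (j : ℕ) (x τ : ℝ), 0 ≤ x → 0 < τ → 0 ≤ G ((j, x), τ))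
    (mH : Measurable H) (mG : Measurable G)
    (hHG : ∀ (j : ℕ) (x τ : ℝ), 0 ≤ x → 0 < τ →
      ((j : ℝ) + 1) * (n + j) * H ((j, x), τ) ≤ τ * G ((j + 1, x), τ)) :
    2 * ck 0 * R * ∫ ω, H ω ∂(mix n m R s N) ≤ ∫ ω, G ω ∂(mix n m R s N) := by
  have hc := ck_pos 0
  have hm := mass_pos (m := m) hn hR hs N
  rw [integral_mix hn hR hs N, integral_mix hn hR hs N, ← mul_div_assoc]
  refine div_le_div_of_nonneg_right ?_ hm.le
  have jH := (integrable_mix_iff hn hR hs N _).mp iH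
  have jG := (integrable_mix_iff hn hR hs N _).mp iG
  have mw := measurable_wt n m R s
  rw [← integral_const_mul]
  have pH : 0 ≤ᵐ[base n R N] fun ω => 2 * ck 0 * R * (H ω * wt n m R s ω) := by
    filter_upwards [ae_base hn hR.le N] with ω hω
    have := (wt_pos (n := n) (m := m) (s := s) hR hω.1 hω.2).le
    have := hH ω.1.1 _ _ hω.1 hω.2
    simp only [Pi.zero_apply]
    positivity
  have pG : 0 ≤ᵐ[base n R N] fun ω => G ω * wt n m R s ω := by
    filter_upwards [ae_base hn hR.le N] with ω hω
    have := (wt_pos (n := n) (m := m) (s := s) hR hω.1 hω.2).le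
    have := hG ω.1.1 _ _ hω.1 hω.2
    simp only [Pi.zero_apply]
    positivity
  rw [integral_eq_lintegral_of_nonneg_ae pH (jH.const_mul _).aestronglyMeasurable,
    integral_eq_lintegral_of_nonneg_ae pG jG.aestronglyMeasurable]
  refine ENNReal.toReal_mono ?_ ?_
  · exact (jG.lintegral_lt_top).ne
  rw [lintegral_base hn hR.le N (by fun_prop), lintegral_base hn hR.le N (by fun_prop)]
  refine le_trans ?_ (ENNReal.tsum_comp_le_tsum_of_injective Nat.succ_injective _)
  refine ENNReal.tsum_le_tsum fun j => ?_
  refine lintegral_mono_ae ?_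
  filter_upwards [ae_nonneg_tailLaw hn hR.le N] with x hx
  refine setLIntegral_mono' measurableSet_Ioi fun τ hτ => ENNReal.ofReal_le_ofReal ?_
  have hτ : 0 < τ := hτ
  have hT : 0 < τ + x := by linarith
  have hg := gk_pos m s hT
  have hd := dens_nonneg n hR.le hc.le j hτ.le
  have hn' : (0 : ℝ) < n := by exact_mod_cast hn
  have e : dens n R (ck 0) (j + 1) τ * (((j : ℝ) + 1) * (n + j)) =
      dens n R (ck 0) j τ * (2 * R * ck 0 * τ) := by
    obtain ⟨n, rfl⟩ := Nat.exists_eq_add_of_le' hn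
    unfold dens
    have e1 : n + 1 + (j + 1) - 1 = n + j + 1 := by omega
    have e2 : n + 1 + j - 1 = n + j := by omega
    rw [e1, e2, Nat.factorial_succ, Nat.factorial_succ]
    push_cast
    have : ((j : ℝ) + 1) ≠ 0 := by positivity
    have : ((n : ℝ) + j + 1) ≠ 0 := by positivity
    field_simp
    ring
  have h1 := hHG j x τ hx hτ
  have hp : 0 < ((j : ℝ) + 1) * (n + j) := by positivity
  have hd1 := dens_nonneg n hR.le hc.le (j + 1) hτ.le
  unfold wt
  simp only [Nat.succ_eq_add_one]
  refine le_of_mul_le_mul_right ?_ (mul_pos hp hτ)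
  calc _ = (((j : ℝ) + 1) * (n + j) * H ((j, x), τ)) *
        (dens n R (ck 0) j τ * (2 * R * ck 0 * τ)) * gk m s (τ + x) := by ring
    _ ≤ (τ * G ((j + 1, x), τ)) * (dens n R (ck 0) j τ * (2 * R * ck 0 * τ)) * gk m s (τ + x) := by
      gcongr
    _ = _ := by rw [← e]; ring

/-- The moment relations satisfied by the mixing measure. -/
structure MomentBounds (n m : ℕ) (R s : ℝ) (E : ((ℕ × ℝ) × ℝ → ℝ) → ℝ) : Prop where
  mean : IsMean E
  pow_yv : ∀ k : ℕ, E (fun ω => yv s ω ^ (2 * k + 2)) ≤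
    ck 0 * E (fun ω => yv s ω ^ (2 * k)) + (m / 2 + 2 * k) * E (fun ω => yv s ω ^ (2 * k) * iT ω)
  sq_iN : 2 * ck 0 * R * E (fun ω => iN n ω ^ 2) ≤ ck 0 + m / 2 * E iT
  tau_yv : 2 * ck 0 * R * E (fun ω => tau ω * yv s ω ^ 2 * iN n ω ^ 2) ≤ E (fun ω => yv s ω ^ 2)
  tau_sq_yv : 2 * ck 0 * R * E (fun ω => tau ω ^ 2 * yv s ω ^ 2 * iN n ω ^ 2) ≤
    E (fun ω => tau ω * yv s ω ^ 2)
  tau_iN : E (fun ω => 2 * tau ω * iN n ω * (yv s ω ^ 2 - m / 2 * iT ω)) ≤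
    E (fun ω => 2 * ck 0 * tau ω * iN n ω) - 2
  sq_dev : E (fun ω => (1 + iN n ω * tau ω * (yv s ω ^ 2 - m / 2 * iT ω - ck 0)) ^ 2) ≤
    E (iN n) + 2 * E (fun ω => tau ω * yv s ω ^ 2 * iN n ω ^ 2)

lemma hasDerivAt_yv {s : ℝ} (j : ℕ) {x τ : ℝ} (hx : 0 ≤ x) (hτ : 0 < τ) :
    HasDerivAt (fun t => yv s ((j, x), t)) (-(yv s ((j, x), τ) * iT ((j, x), τ))) τ := by
  have hT : τ + x ≠ 0 := by linarith
  unfold yv iT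
  simp only
  refine (((((hasDerivAt_id τ).add_const x).const_mul 2).fun_inv (by simpa using hT)).const_mul
    s).congr_deriv ?_
  simp only [id]
  field_simp

lemma hasDerivAt_iT (j : ℕ) {x τ : ℝ} (hx : 0 ≤ x) (hτ : 0 < τ) :
    HasDerivAt (fun t => iT ((j, x), t)) (-(iT ((j, x), τ) ^ 2)) τ := by
  have hT : τ + x ≠ 0 := by linarith
  unfold iT
  simp only [one_div]
  refine (((hasDerivAt_id τ).add_const x).fun_inv (by simpa using hT)).congr_deriv ?_
  simp only [id]
  field_simp

lemma iN_pos {n : ℕ} (hn : 1 ≤ n) (ω : (ℕ × ℝ) × ℝ) : 0 < iN n ω := by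
  have : (1 : ℝ) ≤ n := by exact_mod_cast hn
  unfold iN; positivity

lemma iN_le_one {n : ℕ} (hn : 1 ≤ n) (ω : (ℕ × ℝ) × ℝ) : iN n ω ≤ 1 := by
  have : (1 : ℝ) ≤ n := by exact_mod_cast hn
  have : (0 : ℝ) ≤ ω.1.1 := Nat.cast_nonneg _
  unfold iN
  rw [div_le_one (by positivity)]
  linarith

lemma shape_mul_iN {n : ℕ} (hn : 1 ≤ n) (ω : (ℕ × ℝ) × ℝ) : ((n : ℝ) + ω.1.1) * iN n ω = 1 := by
  have : (1 : ℝ) ≤ n := by exact_mod_cast hn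
  unfold iN
  field_simp

lemma iT_pos (j : ℕ) {x τ : ℝ} (hx : 0 ≤ x) (hτ : 0 < τ) : 0 < iT ((j, x), τ) := by
  unfold iT; simp only; positivity

lemma tau_mul_iT_le (j : ℕ) {x τ : ℝ} (hx : 0 ≤ x) (hτ : 0 < τ) : τ * iT ((j, x), τ) ≤ 1 := by
  unfold iT; simp only
  rw [mul_one_div, div_le_one (by linarith)]
  linarith

lemma pow_yv_mix {n m : ℕ} (hn : 1 ≤ n) {R s : ℝ} (hR : 0 < R) (hs : 0 < s) (N k : ℕ) :
    ∫ ω, yv s ω ^ (2 * k + 2) ∂(mix n m R s N) ≤ ck 0 * ∫ ω, yv s ω ^ (2 * k) ∂(mix n m R s N) +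
      (m / 2 + 2 * k) * ∫ ω, yv s ω ^ (2 * k) * iT ω ∂(mix n m R s N) := by
  have hE := isMean_mix (m := m) hn hR hs N
  have h0 : ∀ (j : ℕ) (x τ : ℝ), 0 ≤ x → 0 < τ → 0 ≤ yv s ((j, x), τ) ^ (2 * k) := fun j x τ _ _ =>
    (even_two_mul k).pow_nonneg _
  have := mix_ibp (m := m) hn hR hs N (fun ω => yv s ω ^ (2 * k))
    (fun ω => -(2 * k) * (yv s ω ^ (2 * k) * iT ω)) (fun j x τ hx hτ => by
      refine ((hasDerivAt_yv (s := s) j hx hτ).fun_pow (2 * k)).congr_deriv ?_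
      rcases k with _ | k
      · simp
      · have : 2 * (k + 1) - 1 = 2 * k + 1 := by omega
        rw [this]
        push_cast
        ring) 0 (fun j x τ hx hτ _ => by simpa using h0 j x τ hx hτ)
  have h1 := integral_div_mul_nonneg (m := m) (s := s) (h := fun ω => yv s ω ^ (2 * k)) hn hR N h0
  have e : (fun ω => (yv s ω ^ 2 - m / 2 * iT ω - ck 0) * yv s ω ^ (2 * k) +
      -(2 * k) * (yv s ω ^ (2 * k) * iT ω)) = fun ω => yv s ω ^ (2 * k + 2) -
      (ck 0 * yv s ω ^ (2 * k) + (m / 2 + 2 * k) * (yv s ω ^ (2 * k) * iT ω)) := by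
    ext ω; ring
  rw [e] at this
  have h2 := hE.sub (fun ω => yv s ω ^ (2 * k + 2))
    (fun ω => ck 0 * yv s ω ^ (2 * k) + (m / 2 + 2 * k) * (yv s ω ^ (2 * k) * iT ω))
  have h3 := hE.add (fun ω => ck 0 * yv s ω ^ (2 * k)) (fun ω => (m / 2 + 2 * k) * (yv s ω ^ (2 * k) * iT ω))
  rw [hE.smul, hE.smul] at h3
  linarith

lemma sq_iN_mix {n m : ℕ} (hn : 1 ≤ n) {R s : ℝ} (hR : 0 < R) (hs : 0 < s) (N : ℕ) :
    2 * ck 0 * R * ∫ ω, iN n ω ^ 2 ∂(mix n m R s N) ≤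
      ck 0 + m / 2 * ∫ ω, iT ω ∂(mix n m R s N) := by
  have hE := isMean_mix (m := m) hn hR hs N
  have h1 := mix_ibp (m := m) hn hR hs N (fun _ => 1) (fun _ => 0)
    (fun j x τ _ _ => hasDerivAt_const τ 1) 0 (fun j x τ _ _ _ => by simp)
  have h2 := (Tame.const 1).integrable_div (m := m) hn hR hs N
  have hm := measurable_shape
  have h3 := balance hn hR hs N ((inferInstance : Tame (fun ω => iN n ω ^ 2)).integrable (m := m) hn hR hs N) h2
    (fun j x τ _ _ => by positivity)
    (fun j x τ hx hτ => mul_nonneg (div_nonneg (shape_sub_one_nonneg hn j) hτ.le) zero_le_one)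
    (Tame.meas) (by fun_prop) (fun j x τ hx hτ => by
      have a1 := shape_mul_iN hn ((j, x), τ)
      have a2 := iN_pos hn ((j, x), τ)
      have hn' : (1 : ℝ) ≤ n := by exact_mod_cast hn
      have hj : (0 : ℝ) ≤ j := Nat.cast_nonneg _
      simp only at a1
      have : τ * (((n : ℝ) + (j + 1 : ℕ) - 1) / τ * 1) = n + j := by
        push_cast; field_simp; ring
      simp only
      rw [this]
      calc _ = (((n : ℝ) + j) * iN n ((j, x), τ)) * (((j : ℝ) + 1) * iN n ((j, x), τ)) := by ring
        _ ≤ 1 * ((n + j) * iN n ((j, x), τ)) := by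
          rw [a1, one_mul, one_mul, ← a1]; gcongr ?_ * _; linarith
        _ ≤ _ := by rw [a1]; linarith)
  have e : (fun ω => (yv s ω ^ 2 - m / 2 * iT ω - ck 0) * 1 + 0) =
      fun ω => yv s ω ^ 2 - (m / 2 * iT ω + ck 0) := by ext ω; ring
  rw [e] at h1
  have h4 := hE.sub (fun ω => yv s ω ^ 2) (fun ω => m / 2 * iT ω + ck 0)
  have h5 := hE.add (fun ω => m / 2 * iT ω) (fun _ => ck 0)
  rw [hE.smul, hE.one] at h5
  have h6 := hE.mono (fun _ => 0) (fun ω => yv s ω ^ 2) (fun j x τ _ _ => by positivity)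
  rw [hE.one] at h6
  linarith

lemma tau_yv_mix {n m : ℕ} (hn : 1 ≤ n) {R s : ℝ} (hR : 0 < R) (hs : 0 < s) (N i : ℕ) :
    2 * ck 0 * R * ∫ ω, tau ω ^ (i + 1) * yv s ω ^ 2 * iN n ω ^ 2 ∂(mix n m R s N) ≤
      ∫ ω, tau ω ^ i * yv s ω ^ 2 ∂(mix n m R s N) := by
  refine balance hn hR hs N ((inferInstance : Tame (fun ω => tau ω ^ (i + 1) * yv s ω ^ 2 * iN n ω ^ 2)).integrable hn hR hs N)
    ((inferInstance : Tame (fun ω => tau ω ^ i * yv s ω ^ 2)).integrable hn hR hs N)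
    (fun j x τ _ hτ => ?_) (fun j x τ _ hτ => ?_) Tame.meas Tame.meas (fun j x τ hx hτ => ?_)
  · unfold tau; simp only; positivity
  · unfold tau; simp only; positivity
  · have a1 := shape_mul_iN hn ((j, x), τ)
    have a2 := iN_pos hn ((j, x), τ)
    have hn' : (1 : ℝ) ≤ n := by exact_mod_cast hn
    simp only at a1
    have e : yv s ((j + 1, x), τ) = yv s ((j, x), τ) := rfl
    unfold tau
    simp only
    rw [e]
    calc _ = (((n : ℝ) + j) * iN n ((j, x), τ)) * (((j : ℝ) + 1) * iN n ((j, x), τ)) *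
          (τ * (τ ^ i * yv s ((j, x), τ) ^ 2)) := by ring
      _ ≤ 1 * ((n + j) * iN n ((j, x), τ)) * (τ * (τ ^ i * yv s ((j, x), τ) ^ 2)) := by
        rw [a1]; gcongr ?_ * _; rw [one_mul, one_mul, ← a1]; gcongr ?_ * _; linarith
      _ = _ := by rw [a1]; ring

lemma tau_iN_mix {n m : ℕ} (hn : 1 ≤ n) {R s : ℝ} (hR : 0 < R) (hs : 0 < s) (N : ℕ) :
    ∫ ω, 2 * tau ω * iN n ω * (yv s ω ^ 2 - m / 2 * iT ω) ∂(mix n m R s N) ≤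
      ∫ ω, 2 * ck 0 * tau ω * iN n ω ∂(mix n m R s N) - 2 := by
  have hE := isMean_mix (m := m) hn hR hs N
  have h1 := mix_ibp (m := m) hn hR hs N (fun ω => 2 * tau ω * iN n ω) (fun ω => 2 * iN n ω)
    (fun j x τ _ _ => by
      refine (((hasDerivAt_id τ).const_mul 2).mul_const (iN n ((j, x), τ))).congr_deriv ?_
      ring) 0 (fun j x τ hx hτ _ => by
      have := iN_pos hn ((j, x), τ)
      unfold tau
      simp only [zero_mul, neg_zero]
      positivity)
  have e1 : ∫ ω, ((n : ℝ) + ω.1.1 - 1) / ω.2 * (2 * tau ω * iN n ω) ∂(mix n m R s N) =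
      ∫ ω, (2 - 2 * iN n ω) ∂(mix n m R s N) := by
    refine integral_congr_ae ?_
    filter_upwards [ae_mix (m := m) (s := s) hn hR N] with ω hω
    have a1 := shape_mul_iN hn ω
    have hτ := hω.2.ne'
    unfold tau
    field_simp
    linear_combination a1
  rw [e1] at h1
  have h2 := hE.sub (fun _ => 2) (fun ω => 2 * iN n ω)
  rw [hE.one, hE.smul] at h2
  have h3 := hE.add (fun ω => 2 * tau ω * iN n ω * (yv s ω ^ 2 - m / 2 * iT ω) - 2 * ck 0 * tau ω * iN n ω)
    (fun ω => 2 * iN n ω)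
  rw [hE.smul, hE.sub (fun ω => 2 * tau ω * iN n ω * (yv s ω ^ 2 - m / 2 * iT ω))
    (fun ω => 2 * ck 0 * tau ω * iN n ω)] at h3
  have e : (fun ω => (yv s ω ^ 2 - m / 2 * iT ω - ck 0) * (2 * tau ω * iN n ω) + 2 * iN n ω) =
      fun ω => 2 * tau ω * iN n ω * (yv s ω ^ 2 - m / 2 * iT ω) - 2 * ck 0 * tau ω * iN n ω + 2 * iN n ω := by
    ext ω; ring
  rw [e] at h1
  linarith

lemma sq_dev_mix {n m : ℕ} (hn : 1 ≤ n) {R s : ℝ} (hR : 0 < R) (hs : 0 < s) (N : ℕ) :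
    ∫ ω, (1 + iN n ω * tau ω * (yv s ω ^ 2 - m / 2 * iT ω - ck 0)) ^ 2 ∂(mix n m R s N) ≤
      ∫ ω, iN n ω ∂(mix n m R s N) +
        2 * ∫ ω, tau ω * yv s ω ^ 2 * iN n ω ^ 2 ∂(mix n m R s N) := by
  have hE := isMean_mix (m := m) hn hR hs N
  have hc := (ck_pos 0).le
  have h1 := mix_ibp (m := m) hn hR hs N
    (fun ω => tau ω * iN n ω - tau ω * iN n ω ^ 2 +
      tau ω ^ 2 * iN n ω ^ 2 * (yv s ω ^ 2 - m / 2 * iT ω - ck 0))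
    (fun ω => iN n ω - iN n ω ^ 2 + (2 * tau ω * iN n ω ^ 2 * (yv s ω ^ 2 - m / 2 * iT ω - ck 0) +
      tau ω ^ 2 * iN n ω ^ 2 * (-2 * yv s ω ^ 2 * iT ω + m / 2 * iT ω ^ 2)))
    (fun j x τ hx hτ => by
      have d1 := hasDerivAt_yv (s := s) j hx hτ
      have d2 := hasDerivAt_iT j hx hτ
      refine ((((hasDerivAt_id τ).mul_const (iN n ((j, x), τ))).sub
        ((hasDerivAt_id τ).mul_const (iN n ((j, x), τ) ^ 2))).add
        ((((hasDerivAt_id τ).fun_pow 2).mul_const (iN n ((j, x), τ) ^ 2)).mul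
        (((d1.fun_pow 2).sub (d2.const_mul (m / 2 : ℝ))).sub_const (ck 0)))).congr_deriv ?_
      unfold tau
      simp only [id, Pi.sub_apply]
      ring) (m / 2 + ck 0) (fun j x τ hx hτ hτ1 => by
      have a1 := shape_mul_iN hn ((j, x), τ)
      have a2 := iN_pos hn ((j, x), τ)
      have a3 := iN_le_one hn ((j, x), τ)
      have a4 := tau_mul_iT_le j hx hτ
      have a5 := iT_pos j hx hτ
      unfold tau
      simp only
      set v := iN n ((j, x), τ)
      set u := iT ((j, x), τ)
      set y := yv s ((j, x), τ)
      have b1 : 0 ≤ τ * (v - v ^ 2) := by have : 0 ≤ v - v ^ 2 := by nlinarith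
                                          positivity
      have b2 : τ * (m / 2 * u + ck 0) ≤ m / 2 + ck 0 := by
        have : (m / 2 : ℝ) * (τ * u) ≤ m / 2 * 1 := by gcongr
        nlinarith
      have b3 : v ^ 2 ≤ 1 := by nlinarith
      have b4 : τ * v ^ 2 * (τ * (m / 2 * u + ck 0)) ≤ τ * 1 * (m / 2 + ck 0) := by gcongr
      have b5 : 0 ≤ τ ^ 2 * v ^ 2 * y ^ 2 := by positivity
      linarith)
  set F : (ℕ × ℝ) × ℝ → ℝ := fun ω => (1 + iN n ω * tau ω * (yv s ω ^ 2 - m / 2 * iT ω - ck 0)) ^ 2 with hF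
  have e1 : ∫ ω, ((n : ℝ) + ω.1.1 - 1) / ω.2 * (tau ω * iN n ω - tau ω * iN n ω ^ 2 +
      tau ω ^ 2 * iN n ω ^ 2 * (yv s ω ^ 2 - m / 2 * iT ω - ck 0)) ∂(mix n m R s N) =
      ∫ ω, (1 - iN n ω) * (1 + iN n ω * tau ω * (yv s ω ^ 2 - m / 2 * iT ω - ck 0) - iN n ω)
        ∂(mix n m R s N) := by
    refine integral_congr_ae ?_
    filter_upwards [ae_mix (m := m) (s := s) hn hR N] with ω hω
    have a1 := shape_mul_iN hn ω
    have hτ := hω.2.ne'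
    unfold tau
    set v := iN n ω
    set q := 1 + v * ω.2 * (yv s ω ^ 2 - m / 2 * iT ω - ck 0) - v with hq
    have b1 : ω.2 * v - ω.2 * v ^ 2 + ω.2 ^ 2 * v ^ 2 * (yv s ω ^ 2 - m / 2 * iT ω - ck 0) =
      ω.2 * (v * q) := by rw [hq]; ring
    rw [b1]
    field_simp
    linear_combination q * a1
  rw [e1] at h1
  have h2 := hE.add (fun ω => (1 - iN n ω) * (1 + iN n ω * tau ω * (yv s ω ^ 2 - m / 2 * iT ω - ck 0) - iN n ω))
    (fun ω => (yv s ω ^ 2 - m / 2 * iT ω - ck 0) * (tau ω * iN n ω - tau ω * iN n ω ^ 2 +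
      tau ω ^ 2 * iN n ω ^ 2 * (yv s ω ^ 2 - m / 2 * iT ω - ck 0)) + (iN n ω - iN n ω ^ 2 +
      (2 * tau ω * iN n ω ^ 2 * (yv s ω ^ 2 - m / 2 * iT ω - ck 0) +
      tau ω ^ 2 * iN n ω ^ 2 * (-2 * yv s ω ^ 2 * iT ω + m / 2 * iT ω ^ 2))))
  have hFt : Tame F := by rw [hF]; infer_instance
  have h3 := hE.mono (fun ω => F ω - (iN n ω + 2 * (tau ω * yv s ω ^ 2 * iN n ω ^ 2)))
    (fun ω => (1 - iN n ω) * (1 + iN n ω * tau ω * (yv s ω ^ 2 - m / 2 * iT ω - ck 0) - iN n ω) +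
      ((yv s ω ^ 2 - m / 2 * iT ω - ck 0) * (tau ω * iN n ω - tau ω * iN n ω ^ 2 +
      tau ω ^ 2 * iN n ω ^ 2 * (yv s ω ^ 2 - m / 2 * iT ω - ck 0)) + (iN n ω - iN n ω ^ 2 +
      (2 * tau ω * iN n ω ^ 2 * (yv s ω ^ 2 - m / 2 * iT ω - ck 0) +
      tau ω ^ 2 * iN n ω ^ 2 * (-2 * yv s ω ^ 2 * iT ω + m / 2 * iT ω ^ 2))))) (fun j x τ hx hτ => by
    have a4 := tau_mul_iT_le j hx hτ
    have a5 := iT_pos j hx hτ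
    rw [hF]
    unfold tau
    simp only
    set v := iN n ((j, x), τ)
    set u := iT ((j, x), τ)
    set y := yv s ((j, x), τ)
    have b1 : τ * v ^ 2 * y ^ 2 * (τ * u) ≤ τ * v ^ 2 * y ^ 2 * 1 := by gcongr
    have b2 : 0 ≤ τ ^ 2 * v ^ 2 * (m / 2 * u ^ 2) := by positivity
    show _ ≤ (1 - v) * (1 + v * τ * (y ^ 2 - m / 2 * u - ck 0) - v) +
      ((y ^ 2 - m / 2 * u - ck 0) * (τ * v - τ * v ^ 2 +
      τ ^ 2 * v ^ 2 * (y ^ 2 - m / 2 * u - ck 0)) + (v - v ^ 2 +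
      (2 * τ * v ^ 2 * (y ^ 2 - m / 2 * u - ck 0) +
      τ ^ 2 * v ^ 2 * (-2 * y ^ 2 * u + m / 2 * u ^ 2))))
    nlinarith)
  have h4 := hE.sub F (fun ω => iN n ω + 2 * (tau ω * yv s ω ^ 2 * iN n ω ^ 2))
  have h5 := hE.add (iN n) (fun ω => 2 * (tau ω * yv s ω ^ 2 * iN n ω ^ 2))
  rw [hE.smul] at h5
  linarith

lemma momentBounds_mix {n m : ℕ} (hn : 1 ≤ n) {R s : ℝ} (hR : 0 < R) (hs : 0 < s) (N : ℕ) :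
    MomentBounds n m R s (fun F => ∫ ω, F ω ∂(mix n m R s N)) where
  mean := isMean_mix hn hR hs N
  pow_yv := pow_yv_mix hn hR hs N
  sq_iN := sq_iN_mix hn hR hs N
  tau_yv := by simpa using tau_yv_mix (m := m) hn hR hs N 0
  tau_sq_yv := by simpa using tau_yv_mix (m := m) hn hR hs N 1
  tau_iN := tau_iN_mix hn hR hs N
  sq_dev := sq_dev_mix hn hR hs N

lemma fN_neg_one_le (n : ℕ) {R : ℝ} (hR : 0 ≤ R) (N : ℕ) : fN n R N (-1) ≤ Real.exp n := by
  have hs := sum_inv_ck_le N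
  have h9 : ∀ k, (9 : ℝ) < ck k := nine_lt_ck
  have h1 : 0 ≤ psiN N (-1) := by
    unfold psiN
    have : ∀ k ∈ Finset.range N, -(2 * (2 / ck k)) ≤ 2 * (-1) / (-1 + ck k) := fun k _ => by
      have := h9 k
      rw [neg_le, ← neg_div, ← mul_div_assoc, div_le_div_iff₀ (by linarith) (by linarith)]
      linarith
    have := Finset.sum_le_sum this
    rw [Finset.sum_neg_distrib, ← Finset.mul_sum] at this
    linarith
  have h2 : prodN N (-1) ≤ Real.exp 1 := by
    unfold prodN
    have : ∀ k ∈ Finset.range N, (1 + -1 / ck k)⁻¹ ≤ Real.exp (2 / ck k) := fun k _ => by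
      have h0 := h9 k
      have hp : 0 < ck k := by linarith
      have e : (1 : ℝ) + -1 / ck k = (ck k - 1) / ck k := by field_simp; ring
      rw [e, inv_div]
      refine le_trans ?_ (Real.add_one_le_exp _)
      rw [div_add_one (by linarith), div_le_div_iff₀ (by linarith) hp]
      nlinarith
    refine (Finset.prod_le_prod (fun k _ => ?_) this).trans ?_
    · have h0 := h9 k
      have : (1 : ℝ) / ck k ≤ 1 := by rw [div_le_one (by linarith)]; linarith
      rw [neg_div]
      exact inv_nonneg.mpr (by linarith)
    · rw [← Real.exp_sum]
      exact Real.exp_le_exp.mpr (by linarith)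
  have h3 : 0 ≤ prodN N (-1) := by
    unfold prodN
    refine Finset.prod_nonneg fun k _ => ?_
    have h0 := h9 k
    have : (1 : ℝ) / ck k ≤ 1 := by rw [div_le_one (by linarith)]; linarith
    rw [neg_div]
    exact inv_nonneg.mpr (by linarith)
  unfold fN
  calc _ ≤ 1 * Real.exp 1 ^ n := by
        gcongr
        rw [Real.exp_le_one_iff]
        have := mul_nonneg hR h1
        linarith
    _ = _ := by rw [one_mul, ← Real.exp_nat_mul, mul_one]

lemma tailLaw_laplace_lower {n : ℕ} (hn : 1 ≤ n) {R : ℝ} (hR : 0 ≤ R) (N : ℕ) {z : ℝ} (hz : 0 ≤ z) :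
    ENNReal.ofReal (Real.exp (-((2 * R + n) * z))) ≤
      ∫⁻ x, ENNReal.ofReal (Real.exp (-(z * x))) ∂(tailLaw n R N) := by
  rw [laplace_tailLaw hn hR N (by linarith)]
  refine ENNReal.ofReal_le_ofReal ?_
  have h1 : ∀ k ∈ Finset.range N, Real.exp (-((2 * R + n) * z * (1 / ck (k + 1)))) ≤
      Real.exp (-(R * (2 * z / (z + ck (k + 1))))) * ((1 + z / ck (k + 1))⁻¹) ^ n := fun k _ => by
    have hc := ck_pos (k + 1)
    have e : -((2 * R + n) * z * (1 / ck (k + 1))) =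
      -(R * (2 * z / ck (k + 1))) + n * (-(z / ck (k + 1))) := by ring
    rw [e, Real.exp_add, Real.exp_nat_mul]
    gcongr
    · linarith
    · rw [Real.exp_neg]
      gcongr
      linarith [Real.add_one_le_exp (z / ck (k + 1))]
  refine le_trans ?_ (Finset.prod_le_prod (fun k _ => (Real.exp_pos _).le) h1)
  rw [← Real.exp_sum, Real.exp_le_exp, Finset.sum_neg_distrib, ← Finset.mul_sum, neg_le_neg_iff]
  have hs := sum_inv_ck_le (N + 1)
  rw [Finset.sum_range_succ'] at hs
  have h0 := ck_pos 0
  have e : ∑ k ∈ Finset.range N, 2 / ck (k + 1) = 2 * ∑ k ∈ Finset.range N, 1 / ck (k + 1) := by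
    rw [Finset.mul_sum]; exact Finset.sum_congr rfl fun k _ => by ring
  have : 0 ≤ 2 / ck 0 := by positivity
  rw [e] at hs
  have : ∑ k ∈ Finset.range N, 1 / ck (k + 1) ≤ 1 := by linarith
  calc _ ≤ (2 * R + n) * z * 1 := by gcongr
    _ = _ := mul_one _

/-- Uniform lower bound for the mass. -/
lemma exists_le_mass {n : ℕ} (m : ℕ) (hn : 1 ≤ n) : ∃ K : ℝ, 0 < K ∧ ∀ R s : ℝ, 0 < R → 1 ≤ s → ∀ N,
    Real.exp (-(K * (R + s + 1))) ≤ mass n m R s N := by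
  have hc := ck_pos 0
  refine ⟨(n - 1).factorial + 3 + ck 0 + m + n * m, by positivity, fun R s hR hs N => ?_⟩
  have hs0 : 0 < s := by linarith
  have hn' : (1 : ℝ) ≤ n := by exact_mod_cast hn
  have mw := measurable_wt n m R s
  have h0 : 0 ≤ᵐ[base n R N] wt n m R s := by
    filter_upwards [ae_base hn hR.le N] with ω hω
    exact (wt_pos hR hω.1 hω.2).le
  rw [← ENNReal.ofReal_le_ofReal_iff (mass_pos hn hR hs0 N).le, mass,
    ofReal_integral_eq_lintegral_ofReal (integrable_wt hn hR hs0 N) h0,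
    lintegral_base hn hR.le N (by fun_prop)]
  refine le_trans ?_ (ENNReal.le_tsum 0)
  set B : ℝ := Real.exp (-(2 * R)) * (1 / (n - 1).factorial * Real.exp (-(ck 0 * (s + 1)))) *
    (Real.exp (-(m / 2 * (s + 1))) * Real.exp (-s)) with hB
  have hB0 : 0 ≤ B := by positivity
  have key : ∀ᵐ x ∂(tailLaw n R N), ENNReal.ofReal B * ENNReal.ofReal (Real.exp (-(m / 2 * x))) ≤
      ∫⁻ τ in Set.Ioi (0 : ℝ), ENNReal.ofReal (wt n m R s ((0, x), τ)) := by
    filter_upwards [ae_nonneg_tailLaw hn hR.le N] with x hx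
    calc _ = ∫⁻ τ in Set.Ioc s (s + 1), ENNReal.ofReal (B * Real.exp (-(m / 2 * x))) := by
          rw [ENNReal.ofReal_mul hB0]; simp
      _ ≤ ∫⁻ τ in Set.Ioc s (s + 1), ENNReal.ofReal (wt n m R s ((0, x), τ)) := by
          refine setLIntegral_mono' measurableSet_Ioc fun τ hτ => ENNReal.ofReal_le_ofReal ?_
          have hτ1 : 1 ≤ τ := hs.trans hτ.1.le
          have hT : 0 < τ + x := by linarith
          unfold wt dens gk
          simp only [add_zero, pow_zero, Nat.factorial_zero, Nat.cast_one, div_one, mul_one]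
          have g1 : (1 : ℝ) ≤ ck 0 ^ n := one_le_pow₀ (by linarith [nine_lt_ck 0])
          have g2 : (1 : ℝ) ≤ τ ^ (n - 1) := one_le_pow₀ hτ1
          have g3 : Real.exp (-(m / 2 * (s + 1))) * Real.exp (-(m / 2 * x)) ≤ (τ + x) ^ (-(m : ℝ) / 2) := by
            rw [Real.rpow_def_of_pos hT, ← Real.exp_add, Real.exp_le_exp]
            have := Real.log_le_sub_one_of_pos hT
            have hτ2 := hτ.2
            have : (m / 2 : ℝ) * Real.log (τ + x) ≤ m / 2 * (s + 1 + x) := by gcongr; linarith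
            linarith
          have g4 : Real.exp (-s) ≤ Real.exp (-(s ^ 2 / (4 * (τ + x)))) := by
            rw [Real.exp_le_exp, neg_le_neg_iff, div_le_iff₀ (by positivity)]
            have := hτ.1
            nlinarith
          calc B * Real.exp (-(m / 2 * x)) = Real.exp (-(2 * R)) * (1 * (1 / (n - 1).factorial) * Real.exp (-(ck 0 * (s + 1)))) *
            ((Real.exp (-(m / 2 * (s + 1))) * Real.exp (-(m / 2 * x))) * Real.exp (-s)) := by rw [hB]; ring
            _ ≤ _ := by gcongr; exact hτ.2
      _ ≤ _ := lintegral_mono_set fun τ hτ => lt_of_lt_of_le hs0 hτ.1.le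
  refine le_trans ?_ (lintegral_mono_ae key)
  rw [lintegral_const_mul _ (by fun_prop)]
  refine le_trans ?_ (mul_le_mul_right (tailLaw_laplace_lower hn hR.le N (z := m / 2) (by positivity)) _)
  rw [← ENNReal.ofReal_mul hB0]
  refine ENNReal.ofReal_le_ofReal ?_
  have hf : Real.exp (-((n - 1).factorial : ℝ)) ≤ 1 / (n - 1).factorial := by
    rw [Real.exp_neg, ← one_div]
    gcongr
    linarith [Real.add_one_le_exp ((n - 1).factorial : ℝ)]
  calc _ ≤ Real.exp (-(2 * R)) * (Real.exp (-((n - 1).factorial : ℝ)) * Real.exp (-(ck 0 * (s + 1)))) *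
    (Real.exp (-(m / 2 * (s + 1))) * Real.exp (-s)) * Real.exp (-((2 * R + n) * (m / 2))) := by
        simp only [← Real.exp_add]
        rw [Real.exp_le_exp]
        have a1 : 0 ≤ ((n - 1).factorial : ℝ) * (R + s) := by positivity
        have a2 : 0 ≤ ck 0 * R := by positivity
        have a3 : 0 ≤ (m : ℝ) * s := by positivity
        have a4 : 0 ≤ (m : ℝ) * n * (R + s + 1 / 2) := by positivity
        have a5 : 0 ≤ (m : ℝ) := by positivity
        linarith
    _ ≤ _ := by rw [hB]; gcongr

lemma gk_anti (m : ℕ) {s s' T : ℝ} (hT : 0 < T) (hs : 0 ≤ s) (h : s ≤ s') : gk m s' T ≤ gk m s T := by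
  unfold gk; gcongr

/-- The mean total inverse width is at most linear. -/
lemma exists_mean_tt_le {n : ℕ} (m : ℕ) (hn : 1 ≤ n) : ∃ K : ℝ, 0 < K ∧ ∀ R s : ℝ, 0 < R → 1 ≤ s → ∀ N,
    ∫ ω, tt ω ∂(mix n m R s N) ≤ K * (R + s + 1) := by
  obtain ⟨K1, hK1, hm⟩ := exists_le_mass m hn
  obtain ⟨A, hA, hg⟩ := exists_inv_pow_mul_gk_le m 0 one_pos
  refine ⟨K1 + A + 2 + n, by positivity, fun R s hR hs N => ?_⟩
  have hs0 : 0 < s := by linarith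
  have hn' : (1 : ℝ) ≤ n := by exact_mod_cast hn
  have hE := isMean_mix (m := m) hn hR hs0 N
  have hprob := isProbabilityMeasure_mix (m := m) hn hR hs0 N
  have hb : ∀ (j : ℕ) (x τ : ℝ), 0 ≤ x → 0 < τ → |Real.exp (τ + x)| ≤
      1 * (1 + ((n : ℝ) + j - 1) / τ) * Real.exp (τ + x) * (1 + (1 / (τ + x)) ^ 0) := fun j x τ hx hτ => by
    have hq := div_nonneg (shape_sub_one_nonneg hn j) hτ.le
    rw [abs_of_pos (Real.exp_pos _), pow_zero, one_mul]
    nlinarith [mul_nonneg hq (Real.exp_pos (τ + x)).le, Real.exp_pos (τ + x)]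
  have i1 := integrable_mul_wt (m := m) hn hR hs0 N (F := fun ω => Real.exp (ω.2 + ω.1.2)) (by fun_prop) 1 0 hb
  have hmass := mass_pos (m := m) hn hR hs0 N
  have h1 : ∫ ω, Real.exp (ω.2 + ω.1.2) * wt n m R s ω ∂(base n R N) ≤ A * (Real.exp R * Real.exp n) := by
    have h0 : 0 ≤ᵐ[base n R N] fun ω => Real.exp (ω.2 + ω.1.2) * wt n m R s ω := by
      filter_upwards [ae_base hn hR.le N] with ω hω
      exact mul_nonneg (Real.exp_pos _).le (wt_pos hR hω.1 hω.2).le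
    rw [← ENNReal.ofReal_le_ofReal_iff (by positivity), ofReal_integral_eq_lintegral_ofReal i1 h0]
    calc _ ≤ ∫⁻ ω, ENNReal.ofReal A * ENNReal.ofReal (dens n R (ck 0) ω.1.1 ω.2 *
          Real.exp (-((-1) * (ω.2 + ω.1.2)))) ∂(base n R N) := by
          refine lintegral_mono_ae ?_
          filter_upwards [ae_base hn hR.le N] with ω hω
          rw [← ENNReal.ofReal_mul hA]
          refine ENNReal.ofReal_le_ofReal ?_
          have hT : 0 < ω.2 + ω.1.2 := by linarith [hω.1, hω.2]
          have g1 := hg _ hT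
          rw [pow_zero, one_mul] at g1
          have g2 := (gk_anti m hT zero_le_one hs).trans g1
          have hd := dens_nonneg n hR.le (ck_pos 0).le ω.1.1 hω.2.le
          have e : -((-1) * (ω.2 + ω.1.2)) = ω.2 + ω.1.2 := by ring
          rw [e]
          unfold wt
          calc _ = gk m s (ω.2 + ω.1.2) * (dens n R (ck 0) ω.1.1 ω.2 * Real.exp (ω.2 + ω.1.2)) := by ring
            _ ≤ _ := by gcongr
      _ = ENNReal.ofReal A * ENNReal.ofReal (Real.exp R * fN n R (N + 1) (-1)) := by
          rw [lintegral_const_mul' _ _ ENNReal.ofReal_ne_top, laplace_base hn hR.le N le_rfl]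
      _ ≤ _ := by
          rw [← ENNReal.ofReal_mul hA]
          refine ENNReal.ofReal_le_ofReal ?_
          gcongr
          exact fN_neg_one_le n hR.le _
  have h2 : ∫ ω, Real.exp (ω.2 + ω.1.2) ∂(mix n m R s N) ≤ Real.exp ((K1 + A + 1 + n) * (R + s + 1)) := by
    rw [integral_mix hn hR hs0 N, div_le_iff₀ hmass]
    calc _ ≤ A * (Real.exp R * Real.exp n) := h1
      _ ≤ Real.exp A * (Real.exp R * Real.exp n) := by gcongr; linarith [Real.add_one_le_exp A]
      _ ≤ Real.exp ((K1 + A + 1 + n) * (R + s + 1)) * Real.exp (-(K1 * (R + s + 1))) := by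
          simp only [← Real.exp_add]
          rw [Real.exp_le_exp]
          have : 0 ≤ (A + n) * (R + s) := by positivity
          linarith
      _ ≤ _ := by gcongr; exact hm R s hR hs N
  set L := (K1 + A + 1 + n) * (R + s + 1) with hL
  have h3 : ∫ ω, tt ω ∂(mix n m R s N) ≤ ∫ ω, (L + Real.exp (-L) * Real.exp (ω.2 + ω.1.2)) ∂(mix n m R s N) := by
    refine integral_mono (Tame.tt.integrable hn hR hs0 N)
      ((integrable_const _).add (((integrable_mix_iff hn hR hs0 N _).mpr i1).const_mul _)) fun ω => ?_
    simp only
    rw [← Real.exp_add]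
    have := Real.add_one_le_exp (-L + (ω.2 + ω.1.2))
    unfold tt
    linarith
  have e : ∫ ω : (ℕ × ℝ) × ℝ, Real.exp (-L) * Real.exp (ω.2 + ω.1.2) ∂(mix n m R s N) =
      Real.exp (-L) * ∫ ω, Real.exp (ω.2 + ω.1.2) ∂(mix n m R s N) := integral_const_mul _ _
  rw [integral_add (integrable_const _) (((integrable_mix_iff hn hR hs0 N _).mpr i1).const_mul _),
    e] at h3
  simp only [integral_const, probReal_univ, one_smul] at h3
  have h4 : Real.exp (-L) * ∫ ω, Real.exp (ω.2 + ω.1.2) ∂(mix n m R s N) ≤ Real.exp (-L) * Real.exp L := by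
    gcongr
  rw [← Real.exp_add, neg_add_cancel, Real.exp_zero] at h4
  have h5 : (K1 + A + 2 + n) * (R + s + 1) = L + (R + s + 1) := by rw [hL]; ring
  linarith

lemma ck_zero : ck 0 = Real.pi ^ 2 := by simp [ck]

lemma le_of_sq_le_of_one_le {a b : ℝ} (hb : 1 ≤ b) (h : a ^ 2 ≤ b) : a ≤ b := by
  nlinarith

lemma yv_eq (s : ℝ) (ω : (ℕ × ℝ) × ℝ) : yv s ω = s / 2 * iT ω := by
  unfold yv iT
  rw [div_mul_div_comm, mul_one]

lemma yv_pos {s : ℝ} (hs : 0 < s) (j : ℕ) {x τ : ℝ} (hx : 0 ≤ x) (hτ : 0 < τ) :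
    0 < yv s ((j, x), τ) := by
  rw [yv_eq]
  exact mul_pos (by linarith) (iT_pos j hx hτ)

lemma iT_le_yv {s : ℝ} (hs : 1 ≤ s) (j : ℕ) {x τ : ℝ} (hx : 0 ≤ x) (hτ : 0 < τ) :
    iT ((j, x), τ) ≤ 2 * yv s ((j, x), τ) := by
  rw [yv_eq]
  nlinarith [iT_pos j hx hτ]

lemma IsMean.sq_le {E : ((ℕ × ℝ) × ℝ → ℝ) → ℝ} (hE : IsMean E) (F : (ℕ × ℝ) × ℝ → ℝ)
    (_ : Tame F := by infer_instance) : E F ^ 2 ≤ E (fun ω => F ω ^ 2) := by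
  have h := hE.mono (fun ω => (2 * E F) * F ω) (fun ω => F ω ^ 2 + E F ^ 2)
    (fun j x τ _ _ => by nlinarith [sq_nonneg (F ((j, x), τ) - E F)])
  rw [hE.smul, hE.add _ (fun _ => E F ^ 2), hE.one] at h
  nlinarith

lemma MomentBounds.yv_pow_le {n m : ℕ} {R s : ℝ} {E : ((ℕ × ℝ) × ℝ → ℝ) → ℝ}
    (h : MomentBounds n m R s E) (hs : 1 ≤ s) (k : ℕ) :
    E (fun ω => yv s ω ^ (2 * k + 2)) ≤
      (2 * ck 0 + (m + 4 * k) ^ 2) * E (fun ω => yv s ω ^ (2 * k)) := by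
  have hE := h.mean
  have h1 := h.pow_yv k
  have h2 := hE.mono (fun ω => ((m : ℝ) / 2 + 2 * k) * (yv s ω ^ (2 * k) * iT ω))
    (fun ω => 1 / 2 * yv s ω ^ (2 * k + 2) + (1 / 2 * ((m : ℝ) + 4 * k) ^ 2) * yv s ω ^ (2 * k))
    (fun j x τ hx hτ => by
      have hy := yv_pos (by linarith : 0 < s) j hx hτ
      have hu := iT_le_yv hs j hx hτ
      set y := yv s ((j, x), τ)
      set u := iT ((j, x), τ)
      have hp : 0 ≤ y ^ (2 * k) := by positivity
      calc _ ≤ ((m : ℝ) / 2 + 2 * k) * (y ^ (2 * k) * (2 * y)) := by gcongr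
        _ ≤ _ := by
          rw [pow_add]
          nlinarith [mul_nonneg hp (sq_nonneg (y - ((m : ℝ) + 4 * k)))])
  rw [hE.smul, hE.add (fun ω => 1 / 2 * yv s ω ^ (2 * k + 2))
    (fun ω => (1 / 2 * ((m : ℝ) + 4 * k) ^ 2) * yv s ω ^ (2 * k)), hE.smul, hE.smul] at h2
  nlinarith

/-- Uniform bounds on the first moments of the phase. -/
lemma MomentBounds.yv_moments {n m : ℕ} {R s : ℝ} {E : ((ℕ × ℝ) × ℝ → ℝ) → ℝ}
    (h : MomentBounds n m R s E) (hs : 1 ≤ s) {Y : ℝ} (hY : Y = 2 * ck 0 + (m + 12) ^ 2) :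
    0 ≤ E (yv s) ∧ E (yv s) ≤ Y ∧ E (fun ω => yv s ω ^ 2) ≤ Y ∧ E (fun ω => yv s ω ^ 8) ≤ Y ^ 4 := by
  have hE := h.mean
  have hc := ck_pos 0
  have hY1 : 1 ≤ Y := by
    have : (0 : ℝ) ≤ m := Nat.cast_nonneg _
    nlinarith
  have hmono : ∀ k : ℕ, 0 ≤ E (fun ω => yv s ω ^ (2 * k)) := fun k => by
    have := hE.mono (fun _ => 0) (fun ω => yv s ω ^ (2 * k)) (fun j x τ _ _ => by
      rw [pow_mul]; positivity)
    rwa [hE.one] at this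
  have hstep : ∀ k : ℕ, k ≤ 3 → E (fun ω => yv s ω ^ (2 * k + 2)) ≤ Y * E (fun ω => yv s ω ^ (2 * k)) :=
    fun k hk => (h.yv_pow_le hs k).trans (by
      have : (k : ℝ) ≤ 3 := by exact_mod_cast hk
      have := hmono k
      rw [hY]
      gcongr
      linarith)
  have s0 := hstep 0 (by norm_num)
  have s1 := hstep 1 (by norm_num)
  have s2 := hstep 2 (by norm_num)
  have s3 := hstep 3 (by norm_num)
  norm_num at s0 s1 s2 s3
  rw [hE.one] at s0
  have hy0 := hE.mono (fun _ => 0) (yv s) (fun j x τ hx hτ => (yv_pos (by linarith) j hx hτ).le)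
  rw [hE.one] at hy0
  refine ⟨hy0, ?_, by linarith, ?_⟩
  · exact le_of_sq_le_of_one_le hY1 ((hE.sq_le (yv s) (Tame.yv s)).trans (by linarith))
  · calc _ ≤ Y * (Y * (Y * (Y * 1))) := by
          refine s3.trans ?_
          gcongr
          refine s2.trans ?_
          gcongr
          refine s1.trans ?_
          gcongr
      _ = Y ^ 4 := by ring

/-- Lower bound for the mean phase. -/
lemma IsMean.yv_lower {E : ((ℕ × ℝ) × ℝ → ℝ) → ℝ} (hE : IsMean E) {s L : ℝ} (hs : 0 < s) (hL : 0 < L)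
    (h : E tt ≤ L) : s ^ 2 / (2 * L) ≤ s * E (yv s) := by
  have h1 := hE.mono (fun ω => s / 2 * (2 / L) + (-(s / (2 * L ^ 2))) * tt ω) (yv s)
    (fun j x τ hx hτ => by
      have hT : 0 < τ + x := by linarith
      have e : s / (2 * (τ + x)) - (s / 2 * (2 / L) + (-(s / (2 * L ^ 2))) * (τ + x)) =
          s * (τ + x - L) ^ 2 / (2 * (τ + x) * L ^ 2) := by
        field_simp
        ring
      have : 0 ≤ s * (τ + x - L) ^ 2 / (2 * (τ + x) * L ^ 2) := by positivity
      simp only [yv, tt]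
      linarith)
  rw [hE.add (fun _ => s / 2 * (2 / L)) (fun ω => (-(s / (2 * L ^ 2))) * tt ω), hE.one, hE.smul] at h1
  have h2 : s / (2 * L ^ 2) * E tt ≤ s / (2 * L ^ 2) * L := by gcongr
  have e : s ^ 2 / (2 * L) = s * (s / 2 * (2 / L) - s / (2 * L ^ 2) * L) := by
    field_simp
    ring
  rw [e]
  gcongr
  linarith

/-- Averaged form of the small deviation estimate. -/
lemma MomentBounds.deviation {n m : ℕ} {R s : ℝ} {E : ((ℕ × ℝ) × ℝ → ℝ) → ℝ}
    (h : MomentBounds n m R s E) (hn : 1 ≤ n) (hR : 0 < R) (hs : 1 ≤ s) {Y : ℝ}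
    (hY : Y = 2 * ck 0 + (m + 12) ^ 2) :
    R * E (fun ω => iN n ω ^ 2) ≤ 1 + m * Y ∧
    ∀ ε : ℝ, 0 < ε → R * E (fun ω => (2 * ck 0 * tau ω * iN n ω * (1 - yv s ω ^ 2 / ck 0) - 2) ^ 2) ≤
      8 * ε * R + (2 * (1 + m * Y) / ε + 16 * Y + 2 * m ^ 2 * (1 + m * Y)) := by
  have hE := h.mean
  have hc := nine_lt_ck 0
  have hm : (0 : ℝ) ≤ m := Nat.cast_nonneg _
  obtain ⟨y0, y1, y2, -⟩ := h.yv_moments hs hY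
  have hu : E iT ≤ 2 * E (yv s) := by
    rw [← hE.smul]
    exact hE.mono iT (fun ω => 2 * yv s ω) fun j x τ hx hτ => iT_le_yv hs j hx hτ
  have hV : R * E (fun ω => iN n ω ^ 2) ≤ 1 + m * Y := by
    have h1 := h.sq_iN
    have h2 : (m : ℝ) / 2 * E iT ≤ m / 2 * (2 * Y) := by gcongr; linarith
    have h3 : 2 * ck 0 * (R * E (fun ω => iN n ω ^ 2)) ≤ 2 * ck 0 * (1 + m * Y) := by
      have : 0 ≤ m * Y := by nlinarith
      have := mul_le_mul_of_nonneg_right (by linarith : 1 ≤ 2 * ck 0) this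
      linarith
    exact le_of_mul_le_mul_left h3 (by linarith)
  refine ⟨hV, fun ε hε => ?_⟩
  have hW : R * E (fun ω => tau ω * yv s ω ^ 2 * iN n ω ^ 2) ≤ Y := by
    have h1 := h.tau_yv
    have h0 := hE.mono (fun _ => 0) (fun ω => tau ω * yv s ω ^ 2 * iN n ω ^ 2)
      (fun j x τ hx hτ => by unfold tau; positivity)
    rw [hE.one] at h0
    have h2 : 1 * (R * E (fun ω => tau ω * yv s ω ^ 2 * iN n ω ^ 2)) ≤
        2 * ck 0 * (R * E (fun ω => tau ω * yv s ω ^ 2 * iN n ω ^ 2)) :=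
      mul_le_mul_of_nonneg_right (by linarith) (mul_nonneg hR.le h0)
    linarith
  have hv : E (iN n) ≤ ε + 1 / (4 * ε) * E (fun ω => iN n ω ^ 2) := by
    have := hE.mono (iN n) (fun ω => ε + 1 / (4 * ε) * iN n ω ^ 2) (fun j x τ hx hτ => by
      have e : ε + 1 / (4 * ε) * iN n ((j, x), τ) ^ 2 - iN n ((j, x), τ) =
          (iN n ((j, x), τ) - 2 * ε) ^ 2 / (4 * ε) := by field_simp; ring
      have : 0 ≤ (iN n ((j, x), τ) - 2 * ε) ^ 2 / (4 * ε) := by positivity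
      linarith)
    rwa [hE.add (fun _ => ε) (fun ω => 1 / (4 * ε) * iN n ω ^ 2), hE.one, hE.smul] at this
  have hRv : R * E (iN n) ≤ ε * R + (1 + m * Y) / (4 * ε) := by
    calc _ ≤ R * (ε + 1 / (4 * ε) * E (fun ω => iN n ω ^ 2)) := by gcongr
      _ = ε * R + 1 / (4 * ε) * (R * E (fun ω => iN n ω ^ 2)) := by ring
      _ ≤ ε * R + 1 / (4 * ε) * (1 + m * Y) := by gcongr
      _ = _ := by ring
  have hd := h.sq_dev
  have hp := hE.mono (fun ω => (2 * ck 0 * tau ω * iN n ω * (1 - yv s ω ^ 2 / ck 0) - 2) ^ 2)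
    (fun ω => 8 * (1 + iN n ω * tau ω * (yv s ω ^ 2 - m / 2 * iT ω - ck 0)) ^ 2 +
      (2 * (m : ℝ) ^ 2) * iN n ω ^ 2) (fun j x τ hx hτ => by
      have hv0 := iN_pos hn ((j, x), τ)
      have ht : tau ((j, x), τ) * iT ((j, x), τ) ≤ 1 := tau_mul_iT_le j hx hτ
      have ht0 : 0 ≤ tau ((j, x), τ) * iT ((j, x), τ) := mul_nonneg hτ.le (iT_pos j hx hτ).le
      set v := iN n ((j, x), τ)
      set y := yv s ((j, x), τ)
      set u := iT ((j, x), τ)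
      set q := tau ((j, x), τ)
      have e : 2 * ck 0 * q * v * (1 - y ^ 2 / ck 0) - 2 =
          -2 * ((1 + v * q * (y ^ 2 - m / 2 * u - ck 0)) + v * (m / 2 * (q * u))) := by
        field_simp
        ring
      rw [e]
      have h1 : (v * (m / 2 * (q * u))) ^ 2 ≤ (v * (m / 2 * 1)) ^ 2 := by gcongr
      have h2 := add_sq_le (a := 1 + v * q * (y ^ 2 - m / 2 * u - ck 0)) (b := v * (m / 2 * (q * u)))
      rw [mul_pow]
      linarith)
  rw [hE.add (fun ω => 8 * (1 + iN n ω * tau ω * (yv s ω ^ 2 - m / 2 * iT ω - ck 0)) ^ 2)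
    (fun ω => (2 * (m : ℝ) ^ 2) * iN n ω ^ 2), hE.smul, hE.smul] at hp
  calc _ ≤ R * (8 * (E (iN n) + 2 * E (fun ω => tau ω * yv s ω ^ 2 * iN n ω ^ 2)) +
        2 * (m : ℝ) ^ 2 * E (fun ω => iN n ω ^ 2)) := by gcongr; linarith
    _ = 8 * (R * E (iN n)) + 16 * (R * E (fun ω => tau ω * yv s ω ^ 2 * iN n ω ^ 2)) +
        2 * (m : ℝ) ^ 2 * (R * E (fun ω => iN n ω ^ 2)) := by ring
    _ ≤ 8 * (ε * R + (1 + m * Y) / (4 * ε)) + 16 * Y + 2 * (m : ℝ) ^ 2 * (1 + m * Y) := by gcongr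
    _ = _ := by field_simp; ring

set_option maxHeartbeats 1000000 in
/-- The deduction of the lower bound from the moment bounds. -/
lemma exists_lower_of_momentBounds (m : ℕ) {K : ℝ} (hK : 0 < K) :
    ∃ s0 : ℝ, 1 ≤ s0 ∧ ∃ c0 : ℝ, 0 < c0 ∧ ∃ C0 : ℝ, 0 < C0 ∧
      ∀ (n : ℕ) (R s a : ℝ) (E : ((ℕ × ℝ) × ℝ → ℝ) → ℝ), 1 ≤ n → 0 < R → s0 ≤ s →
        MomentBounds n m R s E → E tt ≤ K * (R + s + 1) →
        E (fun ω => 2 * ck 0 * tau ω * iN n ω) - 2 - 3 / (2 * ck 0) * (m / 2 * E iT) ≤ a →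
        a ≤ E (fun ω => 2 * ck 0 * tau ω * iN n ω) - 2 + 3 / (2 * ck 0) * E (fun ω => yv s ω ^ 2) →
        c0 * (R + s) - C0 ≤ R - R * a ^ 2 - R * E (yv s) ^ 2 + 2 * s * E (yv s) ∧
          0 ≤ E (yv s) ∧ E (yv s) ≤ C0 := by
  have hc := nine_lt_ck 0
  have hm : (0 : ℝ) ≤ m := Nat.cast_nonneg _
  obtain ⟨Y, hY⟩ : ∃ Y : ℝ, Y = 2 * ck 0 + (m + 12) ^ 2 := ⟨_, rfl⟩
  have hY1 : 1 ≤ Y := by nlinarith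
  obtain ⟨C, hC, hpt⟩ := pointwise_lower (δ := 1 / (32 * Y ^ 4)) (by positivity)
  set ε := 1 / (256 * C) with hε
  have hε0 : 0 < ε := by positivity
  set D := 2 * (1 + m * Y) / ε + 16 * Y + 2 * m ^ 2 * (1 + m * Y) with hD
  have hD0 : 0 ≤ D := by positivity
  set C1 := C * D + 2 * m ^ 2 * (1 + m * Y) with hC1
  have hC10 : 0 ≤ C1 := by positivity
  refine ⟨1 + 16 * m * Y, by nlinarith [mul_nonneg hm (by linarith : 0 ≤ Y)],
    min (1 / 16) (1 / (120 * K)), by positivity, C1 + Y, by positivity,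
    fun n R s a E hn hR hs h htt ha1 ha2 => ?_⟩
  have hmY : 0 ≤ m * Y := mul_nonneg hm (by linarith)
  have hs1 : 1 ≤ s := by linarith
  have hs0 : 0 < s := by linarith
  have hE := h.mean
  obtain ⟨y0, y1, y2, y8⟩ := h.yv_moments hs1 hY
  obtain ⟨hV, hdev⟩ := h.deviation hn hR hs1 hY
  have hdev := hdev ε hε0
  rw [← hD] at hdev
  refine ⟨?_, y0, by linarith⟩
  -- bounds for the square of `a`
  have hu : E iT = 2 / s * E (yv s) := by
    rw [← hE.smul]
    congr 1
    ext ω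
    rw [yv_eq]
    field_simp
  have hlow : -(m * E (iN n)) ≤ E (fun ω => 2 * ck 0 * tau ω * iN n ω) - 2 := by
    refine le_trans ?_ h.tau_iN
    rw [← neg_mul, ← hE.smul]
    refine hE.mono (fun ω => -(m : ℝ) * iN n ω)
      (fun ω => 2 * tau ω * iN n ω * (yv s ω ^ 2 - m / 2 * iT ω)) fun j x τ hx hτ => ?_
    have hv0 := iN_pos hn ((j, x), τ)
    have ht : tau ((j, x), τ) * iT ((j, x), τ) ≤ 1 := tau_mul_iT_le j hx hτ
    have ht0 : 0 ≤ tau ((j, x), τ) := hτ.le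
    set v := iN n ((j, x), τ)
    set y := yv s ((j, x), τ)
    set u := iT ((j, x), τ)
    set q := tau ((j, x), τ)
    have h1 : 0 ≤ q * v * y ^ 2 := by positivity
    have h2 : m * v * (q * u) ≤ m * v * 1 := by gcongr
    linarith
  have hup : (E (fun ω => 2 * ck 0 * tau ω * iN n ω) - 2 + 3 / (2 * ck 0) * E (fun ω => yv s ω ^ 2)) ^ 2 ≤
      E (fun ω => (2 * ck 0 * tau ω * iN n ω - 2 + 3 / 2 * (yv s ω ^ 2 / ck 0)) ^ 2) := by
    refine le_trans (le_of_eq ?_) (hE.sq_le (fun ω => 2 * ck 0 * tau ω * iN n ω - 2 + 3 / 2 * (yv s ω ^ 2 / ck 0)))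
    rw [hE.add (fun ω => 2 * ck 0 * tau ω * iN n ω - 2) (fun ω => 3 / 2 * (yv s ω ^ 2 / ck 0)),
      hE.sub (fun ω => 2 * ck 0 * tau ω * iN n ω) (fun _ => 2), hE.one, ← hE.smul]
    congr 3
    ext ω
    field_simp
  set A := E (fun ω => (2 * ck 0 * tau ω * iN n ω - 2 + 3 / 2 * (yv s ω ^ 2 / ck 0)) ^ 2) with hA
  have hv2 := hE.sq_le (iN n)
  have hsq : R * a ^ 2 ≤ R * A + 2 * m ^ 2 * (1 + m * Y) + R / 64 := by
    set l := m * E (iN n) + m * Y / s with hl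
    have hal : -l ≤ a := by
      refine le_trans ?_ ha1
      have h1 : 3 / (2 * ck 0) ≤ 1 := by rw [div_le_one (by linarith)]; linarith
      have h2 : (m : ℝ) / 2 * E iT ≤ m * Y / s := by
        rw [hu]
        calc (m : ℝ) / 2 * (2 / s * E (yv s)) ≤ (m : ℝ) / 2 * (2 / s * Y) := by gcongr
          _ = _ := by ring
      have h3 : 0 ≤ (m : ℝ) / 2 * E iT := by rw [hu]; positivity
      have h4 := mul_le_of_le_one_left h3 h1
      linarith
    have ha : a ^ 2 ≤ A + l ^ 2 := by
      rcases le_total 0 a with h0 | h0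
      · have := pow_le_pow_left₀ h0 ha2 2
        linarith [sq_nonneg l]
      · have h1 : a ^ 2 ≤ l ^ 2 := sq_le_sq' hal (by linarith)
        linarith [(sq_nonneg _).trans hup]
    have hms : m * Y / s ≤ 1 / 16 := by
      rw [div_le_iff₀ hs0]; linarith
    have hms0 : 0 ≤ m * Y / s := by positivity
    have hl2 : l ^ 2 ≤ 2 * m ^ 2 * E (fun ω => iN n ω ^ 2) + 1 / 64 := by
      have e1 : l ^ 2 ≤ 2 * (m * E (iN n)) ^ 2 + 2 * (m * Y / s) ^ 2 := by
        rw [hl, ← mul_add]; exact add_sq_le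
      have e2 : (m * Y / s) ^ 2 ≤ (1 / 16) ^ 2 := by gcongr
      have e3 : (m : ℝ) ^ 2 * E (iN n) ^ 2 ≤ m ^ 2 * E (fun ω => iN n ω ^ 2) := by gcongr
      rw [mul_pow] at e1
      linarith
    calc R * a ^ 2 ≤ R * (A + (2 * m ^ 2 * E (fun ω => iN n ω ^ 2) + 1 / 64)) := by gcongr; linarith
      _ = R * A + 2 * m ^ 2 * (R * E (fun ω => iN n ω ^ 2)) + R / 64 := by ring
      _ ≤ _ := by gcongr
  -- the pointwise inequality, averaged
  have hpw := hE.mono (fun ω => 1 / 4 - 1 / (32 * Y ^ 4 * ck 0 ^ 4) * yv s ω ^ 8 -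
      C * (2 * ck 0 * tau ω * iN n ω * (1 - yv s ω ^ 2 / ck 0) - 2) ^ 2)
    (fun ω => 1 + 19 / 10 * (4 * ck 0) * (tau ω ^ 2 * yv s ω ^ 2 * iN n ω ^ 2) - yv s ω ^ 2 -
      (2 * ck 0 * tau ω * iN n ω - 2 + 3 / 2 * (yv s ω ^ 2 / ck 0)) ^ 2) (fun j x τ hx hτ => by
      have hv0 := iN_pos hn ((j, x), τ)
      have ht0 : 0 ≤ tau ((j, x), τ) := hτ.le
      have hq := hpt (2 * ck 0 * tau ((j, x), τ) * iN n ((j, x), τ)) (yv s ((j, x), τ) ^ 2 / ck 0)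
        (by positivity) (by positivity)
      rw [← ck_zero] at hq
      refine (le_of_eq ?_).trans (hq.trans_eq ?_)
      · congr 2
        field_simp
      · field_simp
        ring)
  rw [hE.sub (fun ω => 1 / 4 - 1 / (32 * Y ^ 4 * ck 0 ^ 4) * yv s ω ^ 8)
      (fun ω => C * (2 * ck 0 * tau ω * iN n ω * (1 - yv s ω ^ 2 / ck 0) - 2) ^ 2),
    hE.sub (fun _ => 1 / 4) (fun ω => 1 / (32 * Y ^ 4 * ck 0 ^ 4) * yv s ω ^ 8), hE.one, hE.smul, hE.smul,
    hE.sub (fun ω => 1 + 19 / 10 * (4 * ck 0) * (tau ω ^ 2 * yv s ω ^ 2 * iN n ω ^ 2) - yv s ω ^ 2)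
      (fun ω => (2 * ck 0 * tau ω * iN n ω - 2 + 3 / 2 * (yv s ω ^ 2 / ck 0)) ^ 2), ← hA,
    hE.sub (fun ω => 1 + 19 / 10 * (4 * ck 0) * (tau ω ^ 2 * yv s ω ^ 2 * iN n ω ^ 2)) (fun ω => yv s ω ^ 2),
    hE.add (fun _ => 1) (fun ω => 19 / 10 * (4 * ck 0) * (tau ω ^ 2 * yv s ω ^ 2 * iN n ω ^ 2)),
    hE.one, hE.smul] at hpw
  have h8 : 1 / (32 * Y ^ 4 * ck 0 ^ 4) * E (fun ω => yv s ω ^ 8) ≤ 1 / 32 := by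
    have h1 : 1 ≤ ck 0 ^ 4 := one_le_pow₀ (by linarith)
    calc _ ≤ 1 / (32 * Y ^ 4 * ck 0 ^ 4) * Y ^ 4 := by gcongr
      _ ≤ 1 / (32 * Y ^ 4 * 1) * Y ^ 4 := by gcongr
      _ = 1 / 32 := by field_simp
  have hRpw := mul_le_mul_of_nonneg_left hpw hR.le
  -- the contribution of the phase
  have hty : E (fun ω => tau ω * yv s ω ^ 2) ≤ s / 2 * E (yv s) := by
    rw [← hE.smul]
    refine hE.mono (fun ω => tau ω * yv s ω ^ 2) (fun ω => s / 2 * yv s ω) fun j x τ hx hτ => ?_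
    have ht : tau ((j, x), τ) * iT ((j, x), τ) ≤ 1 := tau_mul_iT_le j hx hτ
    have hy := yv_pos hs0 j hx hτ
    have e : tau ((j, x), τ) * yv s ((j, x), τ) ^ 2 =
        tau ((j, x), τ) * iT ((j, x), τ) * (s / 2 * yv s ((j, x), τ)) := by
      simp only [yv_eq]; ring
    rw [e]
    exact mul_le_of_le_one_left (by positivity) ht
  have hts := h.tau_sq_yv
  have hb2 : E (yv s) ^ 2 ≤ E (fun ω => yv s ω ^ 2) := hE.sq_le (yv s) (Tame.yv s)
  have hb2R := mul_le_mul_of_nonneg_left hb2 hR.le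
  have hCdev : C * (R * E (fun ω => (2 * ck 0 * tau ω * iN n ω * (1 - yv s ω ^ 2 / ck 0) - 2) ^ 2)) ≤
      R / 32 + C * D := by
    calc _ ≤ C * (8 * ε * R + D) := by gcongr
      _ = _ := by rw [hε]; field_simp; ring
  have h8R := mul_le_mul_of_nonneg_left h8 hR.le
  have hmain : R / 8 + 1 / 10 * (s * E (yv s)) - C1 ≤
      R - R * a ^ 2 - R * E (yv s) ^ 2 + 2 * s * E (yv s) := by
    rw [hC1]
    linarith
  have hlo := hE.yv_lower hs0 (by positivity) htt
  have hmin1 := min_le_left (1 / 16 : ℝ) (1 / (120 * K))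
  have hmin2 := min_le_right (1 / 16 : ℝ) (1 / (120 * K))
  set c0 := min (1 / 16 : ℝ) (1 / (120 * K))
  rcases le_total s R with hsR | hsR
  · have : c0 * (R + s) ≤ 1 / 16 * (R + R) := by gcongr
    have : 0 ≤ s * E (yv s) := by positivity
    linarith
  · have h1 : c0 * (R + s) ≤ 1 / (120 * K) * (s + s) := by gcongr
    have h2 : s / (6 * K) ≤ s ^ 2 / (2 * (K * (R + s + 1))) := by
      calc s / (6 * K) = s ^ 2 / (2 * (K * (s + s + s))) := by field_simp; ring
        _ ≤ _ := by gcongr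
    have h3 : 1 / (120 * K) * (s + s) = 1 / 10 * (s / (6 * K)) := by field_simp; ring
    linarith

lemma isWeight_gaussian (m : ℕ) {T : ℝ} (hT : 0 < T) :
    IsWeight (fun lam : EuclideanSpace ℝ (Fin m) => Real.exp (-(‖lam‖ ^ 2 * T)))
      (fun lam => -(2 * T) * Real.exp (-(‖lam‖ ^ 2 * T))) := by
  have hInt : ∀ q : ℕ, Integrable (fun lam : EuclideanSpace ℝ (Fin m) =>
      (1 + ‖lam‖ ^ 2) ^ q * Real.exp (-(‖lam‖ ^ 2 * T))) := by
    intro q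
    have h0 : Integrable (fun lam : EuclideanSpace ℝ (Fin m) => Real.exp (-(‖lam‖ ^ 2 * (T / 2)))) := by
      have h := (GaussianFourier.integrable_cexp_neg_mul_sq_norm_add (V := EuclideanSpace ℝ (Fin m))
        (b := ((T / 2 : ℝ) : ℂ)) (by simpa using hT) 0 0).norm
      refine h.congr (ae_of_all _ fun lam => ?_)
      simp only [Complex.norm_exp]
      congr 1
      norm_cast
      simp [-Complex.ofReal_pow]
      ring
    have hb : ∀ z : ℝ, 0 ≤ z → (1 + z) ^ q * Real.exp (-(z * (T / 2))) ≤
        q.factorial * (2 / T) ^ q * Real.exp (T / 2) := by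
      intro z hz
      have h1 := Real.pow_div_factorial_le_exp ((1 + z) * (T / 2)) (by positivity) q
      rw [div_le_iff₀ (by positivity), mul_pow] at h1
      calc (1 + z) ^ q * Real.exp (-(z * (T / 2))) =
          ((1 + z) ^ q * (T / 2) ^ q) * (2 / T) ^ q * Real.exp (-(z * (T / 2))) := by
            have : (T / 2) ^ q * (2 / T) ^ q = 1 := by
              rw [← mul_pow]
              have : T / 2 * (2 / T) = 1 := by field_simp
              rw [this, one_pow]
            rw [mul_assoc ((1 + z) ^ q), this, mul_one]
        _ ≤ (Real.exp ((1 + z) * (T / 2)) * q.factorial) * (2 / T) ^ q * Real.exp (-(z * (T / 2))) := by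
            gcongr
        _ = q.factorial * (2 / T) ^ q * (Real.exp ((1 + z) * (T / 2)) * Real.exp (-(z * (T / 2)))) := by ring
        _ = _ := by
            rw [← Real.exp_add]
            ring_nf
    refine (h0.const_mul (q.factorial * (2 / T) ^ q * Real.exp (T / 2))).mono'
      (Measurable.aestronglyMeasurable (by fun_prop)) (ae_of_all _ fun lam => ?_)
    rw [Real.norm_of_nonneg (by positivity)]
    have e : Real.exp (-(‖lam‖ ^ 2 * T)) =
        Real.exp (-(‖lam‖ ^ 2 * (T / 2))) * Real.exp (-(‖lam‖ ^ 2 * (T / 2))) := by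
      rw [← Real.exp_add]
      ring_nf
    rw [e, ← mul_assoc]
    exact mul_le_mul_of_nonneg_right (hb _ (by positivity)) (Real.exp_pos _).le
  refine ⟨fun lam i => ?_, hInt, fun q => ?_⟩
  · have h1 : HasFDerivAt (fun x : EuclideanSpace ℝ (Fin m) => ‖x‖ ^ 2) (2 • innerSL ℝ lam) lam :=
      (hasStrictFDerivAt_norm_sq lam).hasFDerivAt
    have h2 := (((h1.mul_const T).neg).exp).hasLineDerivAt (EuclideanSpace.single i 1)
    refine HasDerivAt.congr_deriv h2 ?_
    simp [EuclideanSpace.inner_single_right]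
    ring
  · refine ((hInt q).const_mul (-(2 * T))).congr (ae_of_all _ fun lam => ?_)
    ring

lemma integral_cos_gaussian {m : ℕ} (i0 : Fin m) (s : ℝ) {T : ℝ} (hT : 0 < T) :
    ∫ lam : EuclideanSpace ℝ (Fin m), Real.cos (s * lam i0) * Real.exp (-(‖lam‖ ^ 2 * T)) =
      Real.pi ^ ((m : ℝ) / 2) * gk m s T := by
  have h := GaussianFourier.integral_cexp_neg_mul_sq_norm_add_of_euclideanSpace (b := (T : ℂ))
    (by simpa using hT) (Complex.I * s) (EuclideanSpace.single i0 (1 : ℝ))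
  have hi := GaussianFourier.integrable_cexp_neg_mul_sq_norm_add (V := EuclideanSpace ℝ (Fin m))
    (b := (T : ℂ)) (by simpa using hT) (Complex.I * s) (EuclideanSpace.single i0 (1 : ℝ))
  have h2 := congrArg Complex.re h
  rw [← RCLike.re_eq_complex_re, ← integral_re hi] at h2
  have e1 : ∀ lam : EuclideanSpace ℝ (Fin m), RCLike.re (Complex.exp (-(T : ℂ) * ‖lam‖ ^ 2 +
      Complex.I * s * ((inner ℝ (EuclideanSpace.single i0 (1 : ℝ)) lam : ℝ) : ℂ))) =
      Real.cos (s * lam i0) * Real.exp (-(‖lam‖ ^ 2 * T)) := by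
    intro lam
    rw [RCLike.re_eq_complex_re, Complex.exp_re, EuclideanSpace.inner_single_left]
    have a1 : (-(T : ℂ) * ‖lam‖ ^ 2 + Complex.I * s * (((starRingEnd ℝ) 1 * lam i0 : ℝ) : ℂ)).re =
        -(‖lam‖ ^ 2 * T) := by
      norm_cast
      simp [-Complex.ofReal_pow]
      ring
    have a2 : (-(T : ℂ) * ‖lam‖ ^ 2 + Complex.I * s * (((starRingEnd ℝ) 1 * lam i0 : ℝ) : ℂ)).im =
        s * lam i0 := by
      norm_cast
      simp [-Complex.ofReal_pow]
    rw [a1, a2]; ring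
  simp only [e1] at h2
  rw [h2]
  have e2 : ((Real.pi : ℂ) / T) ^ ((Fintype.card (Fin m) : ℂ) / 2) *
      Complex.exp ((Complex.I * s) ^ 2 * (‖(EuclideanSpace.single i0 (1 : ℝ))‖ : ℝ) ^ 2 / (4 * T)) =
      (((Real.pi / T) ^ ((m : ℝ) / 2) * Real.exp (-(s ^ 2 / (4 * T))) : ℝ) : ℂ) := by
    rw [Fintype.card_fin, mul_pow, Complex.I_sq, Complex.ofReal_mul,
      Complex.ofReal_cpow (by positivity), Complex.ofReal_exp]
    push_cast
    congr 2
    simp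
    ring
  rw [RCLike.re_eq_complex_re, e2, Complex.ofReal_re, gk, Real.div_rpow Real.pi_pos.le hT.le, neg_div,
    Real.rpow_neg hT.le]
  ring

lemma integral_sin_gaussian {m : ℕ} (i0 : Fin m) (s : ℝ) {T : ℝ} (hT : 0 < T) :
    ∫ lam : EuclideanSpace ℝ (Fin m), lam i0 * Real.sin (s * lam i0) * Real.exp (-(‖lam‖ ^ 2 * T)) =
      Real.pi ^ ((m : ℝ) / 2) * (s / (2 * T) * gk m s T) := by
  have hw := isWeight_gaussian m hT
  have h := hw.coord_identity i0 s
  have i1 := integrable_of_poly_bound hw.int (A := fun lam => Real.cos (s * lam i0)) (by fun_prop)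
    (C := 1) (q := 0) (fun lam => by simpa using Real.abs_cos_le_one _)
  have i2 := integrable_of_poly_bound hw.int (A := fun lam => lam i0 * Real.sin (s * lam i0)) (by fun_prop)
    (C := 1) (q := 1) (fun lam => by
      rw [abs_mul, pow_one, one_mul]
      exact (mul_le_of_le_one_right (abs_nonneg _) (Real.abs_sin_le_one _)).trans (abs_coord_le lam i0))
  have e : ∀ lam : EuclideanSpace ℝ (Fin m), s * Real.cos (s * lam i0) * Real.exp (-(‖lam‖ ^ 2 * T)) +
      lam i0 * Real.sin (s * lam i0) * (-(2 * T) * Real.exp (-(‖lam‖ ^ 2 * T))) =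
      s * (Real.cos (s * lam i0) * Real.exp (-(‖lam‖ ^ 2 * T))) +
      (-(2 * T)) * (lam i0 * Real.sin (s * lam i0) * Real.exp (-(‖lam‖ ^ 2 * T))) := fun lam => by ring
  simp only [e] at h
  rw [integral_add (i1.const_mul _) (i2.const_mul _), integral_const_mul, integral_const_mul,
    integral_cos_gaussian i0 s hT] at h
  generalize (∫ lam : EuclideanSpace ℝ (Fin m),
    lam i0 * Real.sin (s * lam i0) * Real.exp (-(‖lam‖ ^ 2 * T))) = I at h ⊢
  have : I = s * (Real.pi ^ ((m : ℝ) / 2) * gk m s T) / (2 * T) := by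
    rw [eq_div_iff (by positivity)]
    linarith
  rw [this]
  ring

lemma integral_sq_cos_gaussian {m : ℕ} (i0 : Fin m) (s : ℝ) {T : ℝ} (hT : 0 < T) :
    ∫ lam : EuclideanSpace ℝ (Fin m), Real.cos (s * lam i0) * ‖lam‖ ^ 2 * Real.exp (-(‖lam‖ ^ 2 * T)) =
      Real.pi ^ ((m : ℝ) / 2) * ((m / 2 * (1 / T) - (s / (2 * T)) ^ 2) * gk m s T) := by
  have hw := isWeight_gaussian m hT
  have h := hw.euler_identity i0 s
  have i1 := integrable_of_poly_bound hw.int (A := fun lam => Real.cos (s * lam i0)) (by fun_prop)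
    (C := 1) (q := 0) (fun lam => by simpa using Real.abs_cos_le_one _)
  have i2 := integrable_of_poly_bound hw.int (A := fun lam => lam i0 * Real.sin (s * lam i0)) (by fun_prop)
    (C := 1) (q := 1) (fun lam => by
      rw [abs_mul, pow_one, one_mul]
      exact (mul_le_of_le_one_right (abs_nonneg _) (Real.abs_sin_le_one _)).trans (abs_coord_le lam i0))
  have i3 := integrable_of_poly_bound hw.int (A := fun lam => Real.cos (s * lam i0) * ‖lam‖ ^ 2)
    (by fun_prop) (C := 1) (q := 1) (fun lam => by
      rw [abs_mul, pow_one, one_mul, abs_of_nonneg (by positivity : 0 ≤ ‖lam‖ ^ 2)]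
      nlinarith [Real.abs_cos_le_one (s * lam i0), sq_nonneg ‖lam‖])
  have e : ∀ lam : EuclideanSpace ℝ (Fin m), (m * Real.cos (s * lam i0) -
      s * (lam i0 * Real.sin (s * lam i0))) * Real.exp (-(‖lam‖ ^ 2 * T)) +
      ‖lam‖ ^ 2 * Real.cos (s * lam i0) * (-(2 * T) * Real.exp (-(‖lam‖ ^ 2 * T))) =
      m * (Real.cos (s * lam i0) * Real.exp (-(‖lam‖ ^ 2 * T))) +
      ((-s) * (lam i0 * Real.sin (s * lam i0) * Real.exp (-(‖lam‖ ^ 2 * T))) +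
      (-(2 * T)) * (Real.cos (s * lam i0) * ‖lam‖ ^ 2 * Real.exp (-(‖lam‖ ^ 2 * T)))) := fun lam => by ring
  simp only [e] at h
  rw [integral_add (i1.const_mul _) ((i2.const_mul _).fun_add (i3.const_mul _)),
    integral_add (i2.const_mul _) (i3.const_mul _), integral_const_mul, integral_const_mul,
    integral_const_mul, integral_cos_gaussian i0 s hT, integral_sin_gaussian i0 s hT] at h
  generalize (∫ lam : EuclideanSpace ℝ (Fin m),
    Real.cos (s * lam i0) * ‖lam‖ ^ 2 * Real.exp (-(‖lam‖ ^ 2 * T))) = I at h ⊢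
  have : I = (m * (Real.pi ^ ((m : ℝ) / 2) * gk m s T) -
      s * (Real.pi ^ ((m : ℝ) / 2) * (s / (2 * T) * gk m s T))) / (2 * T) := by
    rw [eq_div_iff (by positivity)]
    linarith
  rw [this]
  field_simp

/-- Exchange of a Laplace mixture with an integral against a radial profile. -/
lemma integral_laplace_mixture {Ω : Type*} [MeasurableSpace Ω] {μ : Measure Ω} [SFinite μ] {D T : Ω → ℝ}
    (hD : Measurable D) (hT : Measurable T) (hD0 : ∀ᵐ ω ∂μ, 0 ≤ D ω) {F : ℝ → ℝ}
    (hF0 : ∀ z, 0 ≤ z → 0 ≤ F z)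
    (hF : ∀ z, 0 ≤ z → ∫⁻ ω, ENNReal.ofReal (D ω * Real.exp (-(z * T ω))) ∂μ = ENNReal.ofReal (F z))
    {m : ℕ} {u : EuclideanSpace ℝ (Fin m) → ℝ} (hu : Measurable u)
    (hi : Integrable (fun lam => u lam * F (‖lam‖ ^ 2))) :
    Integrable (fun ω => D ω * ∫ lam : EuclideanSpace ℝ (Fin m), u lam * Real.exp (-(‖lam‖ ^ 2 * T ω))) μ ∧
      ∫ lam : EuclideanSpace ℝ (Fin m), u lam * F (‖lam‖ ^ 2) =
        ∫ ω, D ω * (∫ lam : EuclideanSpace ℝ (Fin m), u lam * Real.exp (-(‖lam‖ ^ 2 * T ω))) ∂μ := by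
  have hz : ∀ lam : EuclideanSpace ℝ (Fin m), 0 ≤ ‖lam‖ ^ 2 := fun lam => by positivity
  have hm : ∀ z : ℝ, Measurable (fun ω => D ω * Real.exp (-(z * T ω))) := fun z => by fun_prop
  have hn : ∀ z : ℝ, 0 ≤ᵐ[μ] fun ω => D ω * Real.exp (-(z * T ω)) := fun z => by
    filter_upwards [hD0] with ω hω
    exact mul_nonneg hω (Real.exp_pos _).le
  have h1 : ∀ z, 0 ≤ z → Integrable (fun ω => D ω * Real.exp (-(z * T ω))) μ := fun z h =>
    (lintegral_ofReal_ne_top_iff_integrable (hm z).aestronglyMeasurable (hn z)).mp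
      (by rw [hF z h]; exact ENNReal.ofReal_ne_top)
  have h2 : ∀ z, 0 ≤ z → ∫ ω, D ω * Real.exp (-(z * T ω)) ∂μ = F z := fun z h => by
    rw [integral_eq_lintegral_of_nonneg_ae (hn z) (hm z).aestronglyMeasurable, hF z h,
      ENNReal.toReal_ofReal (hF0 z h)]
  set Φ : EuclideanSpace ℝ (Fin m) → Ω → ℝ := fun lam ω => u lam * (D ω * Real.exp (-(‖lam‖ ^ 2 * T ω))) with hΦ
  have hmΦ : Measurable (Function.uncurry Φ) := by
    simp only [hΦ, Function.uncurry_def]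
    fun_prop
  have hiΦ : Integrable (Function.uncurry Φ) (volume.prod μ) := by
    rw [integrable_prod_iff hmΦ.aestronglyMeasurable]
    refine ⟨ae_of_all _ fun lam => by
      simpa [Function.uncurry, hΦ] using (h1 _ (hz lam)).const_mul (u lam), hi.norm.congr (ae_of_all _ fun lam => ?_)⟩
    simp only [Function.uncurry, hΦ, norm_mul]
    rw [integral_const_mul, Real.norm_of_nonneg (hF0 _ (hz lam)), ← h2 _ (hz lam)]
    congr 1
    refine integral_congr_ae ?_
    filter_upwards [hD0] with ω hω
    rw [Real.norm_of_nonneg hω, Real.norm_of_nonneg (Real.exp_pos _).le]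
  have e : ∀ ω, ∫ lam : EuclideanSpace ℝ (Fin m), Φ lam ω =
      D ω * ∫ lam : EuclideanSpace ℝ (Fin m), u lam * Real.exp (-(‖lam‖ ^ 2 * T ω)) := fun ω => by
    rw [← integral_const_mul]
    congr 1
    ext lam
    simp only [hΦ]
    ring
  constructor
  · have := hiΦ.integral_prod_right
    exact this.congr (ae_of_all _ e)
  · have := integral_integral_swap hiΦ
    simp only [e] at this
    rw [← this]
    congr 1
    ext lam
    simp only [hΦ]
    rw [integral_const_mul, h2 _ (hz lam)]

/-- Laplace transform of the mixture weighted by the reduced Gamma variable. -/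
lemma laplace_base_tau {n : ℕ} (hn : 1 ≤ n) {R : ℝ} (hR : 0 ≤ R) (N : ℕ) {z : ℝ} (hz : 0 ≤ z) :
    ∫⁻ ω, ENNReal.ofReal (dens n R (ck 0) ω.1.1 ω.2 * (2 * ck 0 * tau ω * iN n ω) *
        Real.exp (-(z * (ω.2 + ω.1.2)))) ∂(base n R N) =
      ENNReal.ofReal (2 * ck 0 / (z + ck 0) * (Real.exp R * fN n R (N + 1) z)) := by
  have h9 := nine_lt_ck 0
  have hc := ck_pos 0
  have hm1 : Measurable (fun ω : (ℕ × ℝ) × ℝ =>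
      dens n R (ck 0) ω.1.1 ω.2 * Real.exp (-(z * (ω.2 + ω.1.2)))) :=
    (measurable_dens n R (ck 0)).mul (by fun_prop)
  have hm2 : Measurable (fun ω : (ℕ × ℝ) × ℝ => dens n R (ck 0) ω.1.1 ω.2 * (2 * ck 0 * tau ω * iN n ω) *
        Real.exp (-(z * (ω.2 + ω.1.2)))) :=
    ((measurable_dens n R (ck 0)).mul
      (inferInstance : Tame (fun ω => 2 * ck 0 * tau ω * iN n ω)).meas).mul (by fun_prop)
  rw [ENNReal.ofReal_mul (by positivity), ← laplace_base hn hR N (by linarith), lintegral_base hn hR N hm1.ennreal_ofReal,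
    lintegral_base hn hR N hm2.ennreal_ofReal, ← ENNReal.tsum_mul_left]
  congr 1
  ext j
  rw [← lintegral_const_mul' _ _ ENNReal.ofReal_ne_top]
  congr 1
  ext x
  have hnj : ((n : ℝ) + j) ≠ 0 := by
    have : (1 : ℝ) ≤ n := by exact_mod_cast hn
    positivity
  have key : ∀ (k : ℕ) (a : ℝ), 0 ≤ a → ∫⁻ τ in Set.Ioi (0 : ℝ), ENNReal.ofReal (a * (τ ^ k / k.factorial *
      Real.exp (-((z + ck 0) * τ)))) = ENNReal.ofReal (a * ((z + ck 0) ^ (k + 1))⁻¹) := fun k a ha => by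
    simp_rw [ENNReal.ofReal_mul ha]
    rw [lintegral_const_mul' _ _ ENNReal.ofReal_ne_top, lintegral_gamma_kernel k (by linarith)]
  obtain ⟨q, hq⟩ : ∃ q, n + j = q + 1 := ⟨n + j - 1, by omega⟩
  have hq' : (n : ℝ) + j = q + 1 := by exact_mod_cast hq
  set a := Real.exp (-(2 * R)) * ((2 * R) ^ j / j.factorial) * ck 0 ^ (q + 1) * Real.exp (-(z * x)) with ha
  have ha0 : 0 ≤ a := by positivity
  have e1 : ∀ τ : ℝ, dens n R (ck 0) j τ * (2 * ck 0 * tau ((j, x), τ) * iN n ((j, x), τ)) *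
      Real.exp (-(z * (τ + x))) =
      (2 * ck 0 * a) * (τ ^ (q + 1) / (q + 1).factorial * Real.exp (-((z + ck 0) * τ))) := fun τ => by
    have : Real.exp (-((z + ck 0) * τ)) = Real.exp (-(ck 0 * τ)) * Real.exp (-(z * τ)) := by
      rw [← Real.exp_add]; ring_nf
    have h2 : Real.exp (-(z * (τ + x))) = Real.exp (-(z * τ)) * Real.exp (-(z * x)) := by
      rw [← Real.exp_add]; ring_nf
    simp only [dens, tau, iN, ha, hq', hq, Nat.add_sub_cancel, Nat.factorial_succ, this, h2]
    push_cast
    field_simp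
    ring
  have e2 : ∀ τ : ℝ, dens n R (ck 0) j τ * Real.exp (-(z * (τ + x))) =
      a * (τ ^ q / q.factorial * Real.exp (-((z + ck 0) * τ))) := fun τ => by
    have : Real.exp (-((z + ck 0) * τ)) = Real.exp (-(ck 0 * τ)) * Real.exp (-(z * τ)) := by
      rw [← Real.exp_add]; ring_nf
    have h2 : Real.exp (-(z * (τ + x))) = Real.exp (-(z * τ)) * Real.exp (-(z * x)) := by
      rw [← Real.exp_add]; ring_nf
    simp only [dens, ha, hq, Nat.add_sub_cancel, this, h2]
    ring
  simp only [e1, e2]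
  rw [key _ _ (by positivity), key _ _ ha0, ← ENNReal.ofReal_mul (by positivity)]
  congr 1
  have : z + ck 0 ≠ 0 := by positivity
  field_simp
  ring

lemma dens_le_shift (n : ℕ) {R c : ℝ} (hR : 0 ≤ R) (hc : 0 ≤ c) (j : ℕ) {τ v : ℝ} (hτ : 0 ≤ τ) (hv : 0 ≤ v) :
    dens n R c j τ ≤ Real.exp (c * v) * dens n R c j (τ + v) := by
  unfold dens
  have h : Real.exp (-(c * τ)) = Real.exp (c * v) * Real.exp (-(c * (τ + v))) := by
    rw [← Real.exp_add]; ring_nf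
  rw [h]
  have h2 : τ ^ (n + j - 1) ≤ (τ + v) ^ (n + j - 1) := by gcongr; linarith
  calc Real.exp (-(2 * R)) * ((2 * R) ^ j / j.factorial) * (c ^ (n + j) * (τ ^ (n + j - 1) /
        (n + j - 1).factorial) * (Real.exp (c * v) * Real.exp (-(c * (τ + v)))))
      ≤ Real.exp (-(2 * R)) * ((2 * R) ^ j / j.factorial) * (c ^ (n + j) * ((τ + v) ^ (n + j - 1) /
        (n + j - 1).factorial) * (Real.exp (c * v) * Real.exp (-(c * (τ + v))))) := by gcongr
    _ = _ := by ring

lemma lintegral_dens_shift_le {n : ℕ} (hn : 1 ≤ n) {R : ℝ} (hR : 0 ≤ R) (N : ℕ) {v : ℝ} (hv : 0 ≤ v)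
    {H : ℝ → ENNReal} (hH : Measurable H) :
    ∫⁻ ω, ENNReal.ofReal (dens n R (ck 0) ω.1.1 ω.2) * H (ω.2 + ω.1.2 + v) ∂(base n R N) ≤
      ENNReal.ofReal (Real.exp (ck 0 * v)) *
        ∫⁻ ω, ENNReal.ofReal (dens n R (ck 0) ω.1.1 ω.2) * H (ω.2 + ω.1.2) ∂(base n R N) := by
  have hd := (measurable_dens n R (ck 0)).ennreal_ofReal
  have hm1 : Measurable (fun ω : (ℕ × ℝ) × ℝ =>
      ENNReal.ofReal (dens n R (ck 0) ω.1.1 ω.2) * H (ω.2 + ω.1.2 + v)) := hd.mul (hH.comp (by fun_prop))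
  have hm2 : Measurable (fun ω : (ℕ × ℝ) × ℝ =>
      ENNReal.ofReal (dens n R (ck 0) ω.1.1 ω.2) * H (ω.2 + ω.1.2)) := hd.mul (hH.comp (by fun_prop))
  rw [lintegral_base hn hR N hm1, lintegral_base hn hR N hm2, ← ENNReal.tsum_mul_left]
  refine ENNReal.tsum_le_tsum fun j => ?_
  rw [← lintegral_const_mul' _ _ ENNReal.ofReal_ne_top]
  refine lintegral_mono fun x => ?_
  simp only
  rw [← lintegral_const_mul' _ _ ENNReal.ofReal_ne_top]
  set g : ℝ → ENNReal := fun τ => ENNReal.ofReal (Real.exp (ck 0 * v)) *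
    (ENNReal.ofReal (dens n R (ck 0) j τ) * H (τ + x)) with hg
  calc ∫⁻ τ in Set.Ioi (0 : ℝ), ENNReal.ofReal (dens n R (ck 0) j τ) * H (τ + x + v)
      ≤ ∫⁻ τ in Set.Ioi (0 : ℝ), g (τ + v) := by
        refine setLIntegral_mono' measurableSet_Ioi fun τ hτ => ?_
        simp only [hg]
        rw [← mul_assoc, ← ENNReal.ofReal_mul (Real.exp_pos _).le, add_right_comm τ v x]
        gcongr
        exact dens_le_shift n hR (ck_pos 0).le j (le_of_lt hτ) hv
    _ ≤ ∫⁻ τ, (Set.Ioi (0 : ℝ)).indicator g (τ + v) := by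
        rw [← lintegral_indicator measurableSet_Ioi]
        refine lintegral_mono fun τ => ?_
        simp only [Set.indicator_apply, Set.mem_Ioi]
        split_ifs with h1 h2
        · exact le_rfl
        · exact absurd (by linarith) h2
        · exact zero_le
        · exact le_rfl
    _ = ∫⁻ τ in Set.Ioi (0 : ℝ), g τ := by
        rw [lintegral_add_right_eq_self, lintegral_indicator measurableSet_Ioi]

lemma integral_dens_shift_le {n : ℕ} (hn : 1 ≤ n) {R : ℝ} (hR : 0 ≤ R) (N : ℕ) {v : ℝ} (hv : 0 ≤ v)
    {h : ℝ → ℝ} (hm : Measurable h) (h0 : ∀ T, 0 < T → 0 ≤ h T)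
    (hi : Integrable (fun ω => dens n R (ck 0) ω.1.1 ω.2 * h (ω.2 + ω.1.2)) (base n R N)) :
    Integrable (fun ω => dens n R (ck 0) ω.1.1 ω.2 * h (ω.2 + ω.1.2 + v)) (base n R N) ∧
    ∫ ω, dens n R (ck 0) ω.1.1 ω.2 * h (ω.2 + ω.1.2 + v) ∂(base n R N) ≤
      Real.exp (ck 0 * v) * ∫ ω, dens n R (ck 0) ω.1.1 ω.2 * h (ω.2 + ω.1.2) ∂(base n R N) := by
  have key := lintegral_dens_shift_le hn hR N hv hm.ennreal_ofReal
  have hd := measurable_dens n R (ck 0)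
  have hnn : ∀ w, 0 ≤ w → 0 ≤ᵐ[base n R N] fun ω => dens n R (ck 0) ω.1.1 ω.2 * h (ω.2 + ω.1.2 + w) := by
    intro w hw
    filter_upwards [ae_base hn hR N] with ω hω
    exact mul_nonneg (dens_nonneg n hR (ck_pos 0).le _ hω.2.le) (h0 _ (by linarith [hω.1, hω.2]))
  have e : ∀ w, ∫⁻ ω, ENNReal.ofReal (dens n R (ck 0) ω.1.1 ω.2) * ENNReal.ofReal (h (ω.2 + ω.1.2 + w)) ∂(base n R N) =
      ∫⁻ ω, ENNReal.ofReal (dens n R (ck 0) ω.1.1 ω.2 * h (ω.2 + ω.1.2 + w)) ∂(base n R N) := by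
    intro w
    refine lintegral_congr_ae ?_
    filter_upwards [ae_base hn hR N] with ω hω
    rw [ENNReal.ofReal_mul (dens_nonneg n hR (ck_pos 0).le _ hω.2.le)]
  have e0 := e 0
  have hnn0 := hnn 0 le_rfl
  simp only [add_zero] at e0 hnn0
  rw [e v, e0, ← ofReal_integral_eq_lintegral_ofReal hi hnn0, ← ENNReal.ofReal_mul (Real.exp_pos _).le] at key
  have hmv : Measurable (fun ω : (ℕ × ℝ) × ℝ => dens n R (ck 0) ω.1.1 ω.2 * h (ω.2 + ω.1.2 + v)) :=
    hd.mul (hm.comp (by fun_prop))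
  have hiv : Integrable (fun ω => dens n R (ck 0) ω.1.1 ω.2 * h (ω.2 + ω.1.2 + v)) (base n R N) :=
    (lintegral_ofReal_ne_top_iff_integrable hmv.aestronglyMeasurable (hnn v hv)).mp
      (ne_top_of_le_ne_top ENNReal.ofReal_ne_top key)
  refine ⟨hiv, ?_⟩
  rw [← ofReal_integral_eq_lintegral_ofReal hiv (hnn v hv)] at key
  exact (ENNReal.ofReal_le_ofReal_iff (mul_nonneg (Real.exp_pos _).le (integral_nonneg_of_ae hnn0))).mp key

lemma sfinite_base {n : ℕ} (hn : 1 ≤ n) {R : ℝ} (hR : 0 ≤ R) (N : ℕ) : SFinite (base n R N) := by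
  have := isProbabilityMeasure_tailLaw hn hR N
  unfold base
  infer_instance

lemma ae_dens_nonneg {n : ℕ} (hn : 1 ≤ n) {R : ℝ} (hR : 0 ≤ R) (N : ℕ) :
    ∀ᵐ ω ∂(base n R N), 0 ≤ dens n R (ck 0) ω.1.1 ω.2 := by
  filter_upwards [ae_base hn hR N] with ω hω
  exact dens_nonneg n hR (ck_pos 0).le _ hω.2.le

/-- The Gaussian mixture representation of an integral against the truncated profile. -/
lemma integral_fN {n : ℕ} (hn : 1 ≤ n) {R : ℝ} (hR : 0 ≤ R) (N : ℕ) {m : ℕ}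
    {u : EuclideanSpace ℝ (Fin m) → ℝ} (hu : Measurable u)
    (hi : Integrable (fun lam => u lam * (Real.exp R * fN n R (N + 1) (‖lam‖ ^ 2)))) :
    ∫ lam, u lam * (Real.exp R * fN n R (N + 1) (‖lam‖ ^ 2)) =
      ∫ ω, dens n R (ck 0) ω.1.1 ω.2 *
        (∫ lam : EuclideanSpace ℝ (Fin m), u lam * Real.exp (-(‖lam‖ ^ 2 * (ω.2 + ω.1.2)))) ∂(base n R N) := by
  have := sfinite_base hn hR N
  exact (integral_laplace_mixture (F := fun z => Real.exp R * fN n R (N + 1) z)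
    (measurable_dens n R (ck 0)) (by fun_prop) (ae_dens_nonneg hn hR N)
    (fun z hz => mul_nonneg (Real.exp_pos _).le (fN_pos n R (N + 1) hz).le)
    (fun z hz => laplace_base hn hR N (by linarith)) hu hi).2

/-- Polynomially bounded functions are integrable against the truncated profile. -/
lemma integrable_fN {n : ℕ} (hn : 1 ≤ n) {R : ℝ} (hR : 0 ≤ R) {N m q : ℕ} (hN : q + m ≤ N)
    {u : EuclideanSpace ℝ (Fin m) → ℝ} (hu : Measurable u)
    (hb : ∀ lam, |u lam| ≤ (1 + ‖lam‖ ^ 2) ^ q) :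
    Integrable (fun lam => u lam * (Real.exp R * fN n R (N + 1) (‖lam‖ ^ 2))) := by
  refine ((integrable_maj m q).const_mul (Real.exp R)).mono' ?_ (ae_of_all _ fun lam => ?_)
  · have : Measurable (fun lam : EuclideanSpace ℝ (Fin m) => fN n R (N + 1) (‖lam‖ ^ 2)) := by
      unfold fN psiN prodN
      fun_prop
    exact (hu.mul (this.const_mul _)).aestronglyMeasurable
  · have h1 := fN_pos n R (N + 1) (sq_nonneg ‖lam‖)
    rw [norm_mul, Real.norm_eq_abs, Real.norm_of_nonneg (mul_nonneg (Real.exp_pos _).le h1.le)]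
    have h2 := fN_weight_le_maj (q := q) hn hR (by omega : q + m + 1 ≤ N + 1) lam
    calc _ ≤ (1 + ‖lam‖ ^ 2) ^ q * (Real.exp R * fN n R (N + 1) (‖lam‖ ^ 2)) := by
          gcongr; exact hb lam
      _ = Real.exp R * ((1 + ‖lam‖ ^ 2) ^ q * fN n R (N + 1) (‖lam‖ ^ 2)) := by ring
      _ ≤ _ := by gcongr

lemma integral_cos_fN {n : ℕ} (hn : 1 ≤ n) {R s : ℝ} (hR : 0 < R) {N m : ℕ} (hN : m ≤ N) (i0 : Fin m) :
    ∫ lam : EuclideanSpace ℝ (Fin m), Real.cos (s * lam i0) * (Real.exp R * fN n R (N + 1) (‖lam‖ ^ 2)) =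
      Real.pi ^ ((m : ℝ) / 2) * mass n m R s N := by
  rw [integral_fN hn hR.le N (by fun_prop) (integrable_fN (q := 0) hn hR.le (by omega) (by fun_prop)
    fun lam => by simpa using Real.abs_cos_le_one _), mass, ← integral_const_mul]
  refine integral_congr_ae ?_
  filter_upwards [ae_base hn hR.le N] with ω hω
  rw [integral_cos_gaussian i0 s (by linarith [hω.1, hω.2] : 0 < ω.2 + ω.1.2), wt]
  ring

lemma integral_sin_fN {n : ℕ} (hn : 1 ≤ n) {R s : ℝ} (hR : 0 < R) {N m : ℕ} (hN : 1 + m ≤ N) (i0 : Fin m) :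
    ∫ lam : EuclideanSpace ℝ (Fin m), lam i0 * Real.sin (s * lam i0) *
        (Real.exp R * fN n R (N + 1) (‖lam‖ ^ 2)) =
      Real.pi ^ ((m : ℝ) / 2) * ∫ ω, yv s ω * wt n m R s ω ∂(base n R N) := by
  rw [integral_fN hn hR.le N (by fun_prop) (integrable_fN (q := 1) hn hR.le hN (by fun_prop)
    fun lam => ?_), ← integral_const_mul]
  · refine integral_congr_ae ?_
    filter_upwards [ae_base hn hR.le N] with ω hω
    rw [integral_sin_gaussian i0 s (by linarith [hω.1, hω.2] : 0 < ω.2 + ω.1.2), wt, yv]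
    ring
  · rw [abs_mul, pow_one]
    exact (mul_le_of_le_one_right (abs_nonneg _) (Real.abs_sin_le_one _)).trans (abs_coord_le lam i0)

lemma integral_cos_first_fN {n : ℕ} (hn : 1 ≤ n) {R s : ℝ} (hR : 0 < R) {N m : ℕ} (hN : m ≤ N) (i0 : Fin m) :
    ∫ lam : EuclideanSpace ℝ (Fin m), Real.cos (s * lam i0) *
        (2 * ck 0 / (‖lam‖ ^ 2 + ck 0) * (Real.exp R * fN n R (N + 1) (‖lam‖ ^ 2))) =
      Real.pi ^ ((m : ℝ) / 2) * ∫ ω, 2 * ck 0 * tau ω * iN n ω * wt n m R s ω ∂(base n R N) := by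
  have hc := ck_pos 0
  have := sfinite_base hn hR.le N
  have hi : Integrable (fun lam : EuclideanSpace ℝ (Fin m) => Real.cos (s * lam i0) *
        (2 * ck 0 / (‖lam‖ ^ 2 + ck 0) * (Real.exp R * fN n R (N + 1) (‖lam‖ ^ 2)))) := by
    have := (integrable_fN (q := 0) (u := fun lam : EuclideanSpace ℝ (Fin m) => Real.cos (s * lam i0) *
      (ck 0 / (‖lam‖ ^ 2 + ck 0))) hn hR.le (by omega : 0 + m ≤ N) (by fun_prop) fun lam => by
        have h1 : ck 0 / (‖lam‖ ^ 2 + ck 0) ≤ 1 := by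
          rw [div_le_one (by positivity)]
          linarith [sq_nonneg ‖lam‖]
        rw [abs_mul, abs_of_nonneg (by positivity : 0 ≤ ck 0 / (‖lam‖ ^ 2 + ck 0)), pow_zero]
        exact mul_le_one₀ (Real.abs_cos_le_one _) (by positivity) h1).const_mul 2
    refine this.congr (ae_of_all _ fun lam => ?_)
    simp only
    ring
  have h := (integral_laplace_mixture (μ := base n R N) (F := fun z => 2 * ck 0 / (z + ck 0) * (Real.exp R * fN n R (N + 1) z))
    (D := fun ω => dens n R (ck 0) ω.1.1 ω.2 * (2 * ck 0 * tau ω * iN n ω)) (T := fun ω => ω.2 + ω.1.2)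
    ((measurable_dens n R (ck 0)).mul (inferInstance : Tame (fun ω => 2 * ck 0 * tau ω * iN n ω)).meas)
    (by fun_prop) (by
      filter_upwards [ae_base hn hR.le N] with ω hω
      have h1 := dens_nonneg n hR.le hc.le ω.1.1 hω.2.le
      have h2 := iN_pos hn ω
      have h3 : 0 < tau ω := hω.2
      positivity)
    (fun z hz => by have := fN_pos n R (N + 1) hz; positivity)
    (fun z hz => laplace_base_tau hn hR.le N hz) (by fun_prop) hi).2
  rw [h, ← integral_const_mul]
  refine integral_congr_ae ?_
  filter_upwards [ae_base hn hR.le N] with ω hω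
  rw [integral_cos_gaussian i0 s (by linarith [hω.1, hω.2] : 0 < ω.2 + ω.1.2), wt]
  ring

/-- The exponentially damped second moment of the truncated profile. -/
lemma integral_damped_bounds {n : ℕ} (hn : 1 ≤ n) {R s : ℝ} (hR : 0 < R) (hs : 0 < s) {N m : ℕ} (hN : 1 + m ≤ N)
    (i0 : Fin m) {v : ℝ} (hv : 0 ≤ v) :
    -(Real.exp (ck 0 * v) * (Real.pi ^ ((m : ℝ) / 2) * ∫ ω, yv s ω ^ 2 * wt n m R s ω ∂(base n R N))) ≤
      ∫ lam : EuclideanSpace ℝ (Fin m), Real.cos (s * lam i0) * ‖lam‖ ^ 2 *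
        (Real.exp R * fN n R (N + 1) (‖lam‖ ^ 2)) * Real.exp (-(‖lam‖ ^ 2 * v)) ∧
    ∫ lam : EuclideanSpace ℝ (Fin m), Real.cos (s * lam i0) * ‖lam‖ ^ 2 *
        (Real.exp R * fN n R (N + 1) (‖lam‖ ^ 2)) * Real.exp (-(‖lam‖ ^ 2 * v)) ≤
      Real.exp (ck 0 * v) * (Real.pi ^ ((m : ℝ) / 2) * ∫ ω, m / 2 * iT ω * wt n m R s ω ∂(base n R N)) := by
  set u : EuclideanSpace ℝ (Fin m) → ℝ := fun lam => Real.cos (s * lam i0) * ‖lam‖ ^ 2 * Real.exp (-(‖lam‖ ^ 2 * v)) with hu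
  have hum : Measurable u := by fun_prop
  have hub : ∀ lam, |u lam| ≤ (1 + ‖lam‖ ^ 2) ^ 1 := fun lam => by
    have h1 : Real.exp (-(‖lam‖ ^ 2 * v)) ≤ 1 := by
      rw [Real.exp_le_one_iff]
      have : 0 ≤ ‖lam‖ ^ 2 * v := by positivity
      linarith
    simp only [hu]
    rw [abs_mul, abs_mul, abs_of_pos (Real.exp_pos _), pow_one, abs_of_nonneg (sq_nonneg ‖lam‖)]
    calc |Real.cos (s * lam i0)| * ‖lam‖ ^ 2 * Real.exp (-(‖lam‖ ^ 2 * v)) ≤ 1 * ‖lam‖ ^ 2 * 1 := by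
          gcongr
          exact Real.abs_cos_le_one _
      _ ≤ _ := by linarith
  have e0 : ∀ lam : EuclideanSpace ℝ (Fin m), Real.cos (s * lam i0) * ‖lam‖ ^ 2 *
        (Real.exp R * fN n R (N + 1) (‖lam‖ ^ 2)) * Real.exp (-(‖lam‖ ^ 2 * v)) =
      u lam * (Real.exp R * fN n R (N + 1) (‖lam‖ ^ 2)) := fun lam => by simp only [hu]; ring
  simp only [e0]
  rw [integral_fN hn hR.le N hum (integrable_fN hn hR.le hN hum hub)]
  set h1 : ℝ → ℝ := fun T => m / 2 * (1 / T) * gk m s T with hh1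
  set h2 : ℝ → ℝ := fun T => (s / (2 * T)) ^ 2 * gk m s T with hh2
  have hgm := measurable_gk m s
  have i1 : Integrable (fun ω => dens n R (ck 0) ω.1.1 ω.2 * h1 (ω.2 + ω.1.2)) (base n R N) := by
    refine ((integrable_mix_iff (m := m) hn hR hs N _).mp
      ((inferInstance : Tame (fun ω => m / 2 * iT ω)).integrable hn hR hs N)).congr (ae_of_all _ fun ω => ?_)
    simp only [hh1, wt, iT]
    ring
  have i2 : Integrable (fun ω => dens n R (ck 0) ω.1.1 ω.2 * h2 (ω.2 + ω.1.2)) (base n R N) := by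
    refine ((integrable_mix_iff (m := m) hn hR hs N _).mp
      ((Tame.pow (yv s) (hF := Tame.yv s) 2).integrable hn hR hs N)).congr (ae_of_all _ fun ω => ?_)
    simp only [hh2, wt, yv]
    ring
  obtain ⟨j1, k1⟩ := integral_dens_shift_le hn hR.le N hv (h := h1) (by fun_prop)
    (fun T hT => by have := gk_pos m s hT; positivity) i1
  obtain ⟨j2, k2⟩ := integral_dens_shift_le hn hR.le N hv (h := h2) (by fun_prop)
    (fun T hT => by have := gk_pos m s hT; positivity) i2
  have e1 : ∫ ω, dens n R (ck 0) ω.1.1 ω.2 *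
        (∫ lam : EuclideanSpace ℝ (Fin m), u lam * Real.exp (-(‖lam‖ ^ 2 * (ω.2 + ω.1.2)))) ∂(base n R N) =
      Real.pi ^ ((m : ℝ) / 2) * (∫ ω, dens n R (ck 0) ω.1.1 ω.2 * h1 (ω.2 + ω.1.2 + v) ∂(base n R N) -
        ∫ ω, dens n R (ck 0) ω.1.1 ω.2 * h2 (ω.2 + ω.1.2 + v) ∂(base n R N)) := by
    rw [← integral_sub j1 j2, ← integral_const_mul]
    refine integral_congr_ae ?_
    filter_upwards [ae_base hn hR.le N] with ω hω
    have hT : 0 < ω.2 + ω.1.2 + v := by linarith [hω.1, hω.2]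
    have := integral_sq_cos_gaussian i0 s hT
    have e2 : ∀ lam : EuclideanSpace ℝ (Fin m), u lam * Real.exp (-(‖lam‖ ^ 2 * (ω.2 + ω.1.2))) =
        Real.cos (s * lam i0) * ‖lam‖ ^ 2 * Real.exp (-(‖lam‖ ^ 2 * (ω.2 + ω.1.2 + v))) := fun lam => by
      simp only [hu]
      rw [mul_assoc, ← Real.exp_add]
      ring_nf
    simp only [e2, this, hh1, hh2]
    ring
  have e3 : ∫ ω, dens n R (ck 0) ω.1.1 ω.2 * h1 (ω.2 + ω.1.2) ∂(base n R N) =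
      ∫ ω, m / 2 * iT ω * wt n m R s ω ∂(base n R N) := by
    congr 1; ext ω; simp only [hh1, wt, iT]; ring
  have e4 : ∫ ω, dens n R (ck 0) ω.1.1 ω.2 * h2 (ω.2 + ω.1.2) ∂(base n R N) =
      ∫ ω, yv s ω ^ 2 * wt n m R s ω ∂(base n R N) := by
    congr 1; ext ω; simp only [hh2, wt, yv]; ring
  rw [e3] at k1
  rw [e4] at k2
  have hnn : ∀ h : ℝ → ℝ, (∀ T, 0 < T → 0 ≤ h T) →
      0 ≤ ∫ ω, dens n R (ck 0) ω.1.1 ω.2 * h (ω.2 + ω.1.2 + v) ∂(base n R N) := fun h hh => by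
    refine integral_nonneg_of_ae ?_
    filter_upwards [ae_base hn hR.le N] with ω hω
    exact mul_nonneg (dens_nonneg n hR.le (ck_pos 0).le _ hω.2.le) (hh _ (by linarith [hω.1, hω.2]))
  have n1 := hnn h1 (fun T hT => by have := gk_pos m s hT; positivity)
  have n2 := hnn h2 (fun T hT => by have := gk_pos m s hT; positivity)
  have hπ : 0 < Real.pi ^ ((m : ℝ) / 2) := by positivity
  rw [e1]
  constructor
  · have := mul_le_mul_of_nonneg_left (sub_le_sub n1 k2) hπ.le
    linarith
  · have := mul_le_mul_of_nonneg_left (sub_le_sub k1 n2) hπ.le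
    linarith

lemma integral_two_mul_exp {a : ℝ} (ha : 0 < a) : ∫ v in Set.Ioi (0 : ℝ), 2 * Real.exp (-(a * v)) = 2 / a := by
  have := integral_exp_mul_Ioi (by linarith : -a < 0) 0
  rw [integral_const_mul]
  simp only [neg_mul] at this
  rw [this]
  simp
  ring

lemma integrableOn_two_mul_exp {a : ℝ} (ha : 0 < a) : IntegrableOn (fun v => 2 * Real.exp (-(a * v))) (Set.Ioi 0) := by
  have := (integrableOn_exp_mul_Ioi (by linarith : -a < 0) 0).const_mul 2
  simpa only [neg_mul, IntegrableOn] using this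

/-- Bounds for the higher terms of the partial fraction expansion. -/
lemma integral_fraction_bounds {n : ℕ} (hn : 1 ≤ n) {R s : ℝ} (hR : 0 < R) (hs : 0 < s) {N m : ℕ} (hN : 1 + m ≤ N)
    (i0 : Fin m) {b : ℝ} (hb : ck 0 < b) :
    -(2 / (b - ck 0) * (Real.pi ^ ((m : ℝ) / 2) * ∫ ω, yv s ω ^ 2 * wt n m R s ω ∂(base n R N))) ≤
      ∫ lam : EuclideanSpace ℝ (Fin m), Real.cos (s * lam i0) *
        (2 * ‖lam‖ ^ 2 / (‖lam‖ ^ 2 + b) * (Real.exp R * fN n R (N + 1) (‖lam‖ ^ 2))) ∧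
    ∫ lam : EuclideanSpace ℝ (Fin m), Real.cos (s * lam i0) *
        (2 * ‖lam‖ ^ 2 / (‖lam‖ ^ 2 + b) * (Real.exp R * fN n R (N + 1) (‖lam‖ ^ 2))) ≤
      2 / (b - ck 0) * (Real.pi ^ ((m : ℝ) / 2) * ∫ ω, m / 2 * iT ω * wt n m R s ω ∂(base n R N)) := by
  have hc := ck_pos 0
  have hb0 : 0 < b := hc.trans hb
  set u : EuclideanSpace ℝ (Fin m) → ℝ := fun lam => Real.cos (s * lam i0) * ‖lam‖ ^ 2 *
    (Real.exp R * fN n R (N + 1) (‖lam‖ ^ 2)) with hu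
  have hum : Measurable u := by
    simp only [hu]
    unfold fN psiN prodN
    fun_prop
  have hi : Integrable (fun lam => u lam * (2 / (‖lam‖ ^ 2 + b))) := by
    have := (integrable_fN (q := 1) (u := fun lam : EuclideanSpace ℝ (Fin m) => Real.cos (s * lam i0) *
      (‖lam‖ ^ 2 / (‖lam‖ ^ 2 + b))) hn hR.le hN (by fun_prop) fun lam => by
        have h1 : ‖lam‖ ^ 2 / (‖lam‖ ^ 2 + b) ≤ 1 := by
          rw [div_le_one (by positivity)]
          linarith
        rw [abs_mul, abs_of_nonneg (by positivity : 0 ≤ ‖lam‖ ^ 2 / (‖lam‖ ^ 2 + b)), pow_one]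
        have := mul_le_one₀ (Real.abs_cos_le_one (s * lam i0)) (by positivity) h1
        linarith [sq_nonneg ‖lam‖]).const_mul 2
    refine this.congr (ae_of_all _ fun lam => ?_)
    simp only [hu]
    ring
  have h := integral_laplace_mixture (μ := volume.restrict (Set.Ioi (0 : ℝ))) (F := fun z => 2 / (z + b))
    (D := fun v => 2 * Real.exp (-(b * v))) (T := fun v => v) (by fun_prop) (by fun_prop)
    (ae_of_all _ fun v => by positivity) (fun z hz => by positivity) (fun z hz => by
      have ha : 0 < z + b := by linarith
      have e : ∀ v, 2 * Real.exp (-(b * v)) * Real.exp (-(z * v)) = 2 * Real.exp (-((z + b) * v)) := fun v => by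
        rw [mul_assoc, ← Real.exp_add]; ring_nf
      simp only [e]
      rw [← ofReal_integral_eq_lintegral_ofReal (integrableOn_two_mul_exp ha)
        (ae_of_all _ fun v => by positivity), integral_two_mul_exp ha]) hum hi
  have e0 : ∀ lam : EuclideanSpace ℝ (Fin m), Real.cos (s * lam i0) *
        (2 * ‖lam‖ ^ 2 / (‖lam‖ ^ 2 + b) * (Real.exp R * fN n R (N + 1) (‖lam‖ ^ 2))) =
      u lam * (2 / (‖lam‖ ^ 2 + b)) := fun lam => by simp only [hu]; ring
  simp only [e0]
  rw [h.2]
  have ha : 0 < b - ck 0 := by linarith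
  have e : ∀ v A : ℝ, 2 * Real.exp (-(b * v)) * (Real.exp (ck 0 * v) * A) = 2 * Real.exp (-((b - ck 0) * v)) * A :=
    fun v A => by
      have : Real.exp (-((b - ck 0) * v)) = Real.exp (-(b * v)) * Real.exp (ck 0 * v) := by
        rw [← Real.exp_add]; ring_nf
      rw [this]; ring
  have hex := integrableOn_two_mul_exp ha
  constructor
  · rw [← integral_two_mul_exp ha, ← integral_mul_const, ← integral_neg]
    refine setIntegral_mono_on (hex.mul_const _).neg h.1 measurableSet_Ioi fun v hv => ?_
    have := mul_le_mul_of_nonneg_left (integral_damped_bounds (s := s) hn hR hs hN i0 (le_of_lt hv)).1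
      (by positivity : 0 ≤ 2 * Real.exp (-(b * v)))
    rw [mul_neg, e] at this
    exact this
  · rw [← integral_two_mul_exp ha, ← integral_mul_const]
    refine setIntegral_mono_on h.1 (hex.mul_const _) measurableSet_Ioi fun v hv => ?_
    have := mul_le_mul_of_nonneg_left (integral_damped_bounds (s := s) hn hR hs hN i0 (le_of_lt hv)).2
      (by positivity : 0 ≤ 2 * Real.exp (-(b * v)))
    rw [e] at this
    exact this

lemma sum_inv_ck_sub_le (N : ℕ) : ∑ k ∈ Finset.range N, 2 / (ck (k + 1) - ck 0) ≤ 3 / (2 * ck 0) := by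
  have h : ∀ N : ℕ, ∑ k ∈ Finset.range N, 2 / (ck (k + 1) - ck 0) =
      (3 / 2 - 1 / ((N : ℝ) + 1) - 1 / ((N : ℝ) + 2)) / Real.pi ^ 2 := by
    intro N
    induction N with
    | zero => simp; norm_num
    | succ N ih =>
      rw [Finset.sum_range_succ, ih]
      have : ck (N + 1) - ck 0 = ((N : ℝ) + 1) * ((N : ℝ) + 3) * Real.pi ^ 2 := by
        unfold ck; push_cast; ring
      rw [this]
      push_cast
      have hp := Real.pi_pos
      field_simp
      ring
  rw [h, ck_zero, ← div_div]
  have h1 : 0 ≤ 1 / ((N : ℝ) + 1) := by positivity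
  have h2 : 0 ≤ 1 / ((N : ℝ) + 2) := by positivity
  gcongr
  linarith

lemma integrable_cos_fraction {n : ℕ} (hn : 1 ≤ n) {R : ℝ} (s : ℝ) (hR : 0 < R) {N m : ℕ} (hN : m ≤ N)
    (i0 : Fin m) {b : ℝ} (hb : 0 < b) (a : ℝ) {w : ℝ → ℝ} (hw : Measurable w)
    (hw1 : ∀ z, 0 ≤ z → 0 ≤ w z ∧ w z ≤ z + b) :
    Integrable (fun lam : EuclideanSpace ℝ (Fin m) => Real.cos (s * lam i0) *
      (a * w (‖lam‖ ^ 2) / (‖lam‖ ^ 2 + b) * (Real.exp R * fN n R (N + 1) (‖lam‖ ^ 2)))) := by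
  have := (integrable_fN (q := 0) (u := fun lam : EuclideanSpace ℝ (Fin m) => Real.cos (s * lam i0) *
      (w (‖lam‖ ^ 2) / (‖lam‖ ^ 2 + b))) hn hR.le (by omega : 0 + m ≤ N) (by fun_prop) fun lam => by
        obtain ⟨h1, h2⟩ := hw1 (‖lam‖ ^ 2) (by positivity)
        have h3 : 0 ≤ w (‖lam‖ ^ 2) / (‖lam‖ ^ 2 + b) := by positivity
        rw [abs_mul, abs_of_nonneg h3, pow_zero]
        refine mul_le_one₀ (Real.abs_cos_le_one _) h3 ?_
        rw [div_le_one (by positivity)]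
        exact h2).const_mul a
  refine this.congr (ae_of_all _ fun lam => ?_)
  simp only
  ring

/-- The truncated integrals in terms of the means of the mixing measure. -/
lemma truncated_bounds {n : ℕ} (hn : 1 ≤ n) {R s : ℝ} (hR : 0 < R) (hs : 0 < s) {N m : ℕ} (hN : 1 + m ≤ N)
    (i0 : Fin m) : ∃ a : ℝ,
    ∫ lam : EuclideanSpace ℝ (Fin m), Real.cos (s * lam i0) * (psiN (N + 1) (‖lam‖ ^ 2) *
        (Real.exp R * fN n R (N + 1) (‖lam‖ ^ 2))) = (1 - a) * (Real.pi ^ ((m : ℝ) / 2) * mass n m R s N) ∧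
    (∫ ω, 2 * ck 0 * tau ω * iN n ω ∂(mix n m R s N)) - 2 -
      3 / (2 * ck 0) * (m / 2 * ∫ ω, iT ω ∂(mix n m R s N)) ≤ a ∧
    a ≤ (∫ ω, 2 * ck 0 * tau ω * iN n ω ∂(mix n m R s N)) - 2 +
      3 / (2 * ck 0) * ∫ ω, yv s ω ^ 2 ∂(mix n m R s N) := by
  have hM := mass_pos (m := m) hn hR hs N
  have hπ : 0 < Real.pi ^ ((m : ℝ) / 2) := by positivity
  set P := Real.pi ^ ((m : ℝ) / 2) * mass n m R s N with hP
  have hP0 : 0 < P := mul_pos hπ hM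
  set X : ℕ → ℝ := fun k => ∫ lam : EuclideanSpace ℝ (Fin m), Real.cos (s * lam i0) *
    (2 * ‖lam‖ ^ 2 / (‖lam‖ ^ 2 + ck (k + 1)) * (Real.exp R * fN n R (N + 1) (‖lam‖ ^ 2))) with hX
  have hck : ∀ k : ℕ, 0 < ck (k + 1) - ck 0 := fun k => by
    have : ck (k + 1) - ck 0 = ((k : ℝ) + 1) * ((k : ℝ) + 3) * Real.pi ^ 2 := by
      unfold ck; push_cast; ring
    rw [this]
    positivity
  have hE : ∀ F : (ℕ × ℝ) × ℝ → ℝ, Real.pi ^ ((m : ℝ) / 2) * ∫ ω, F ω * wt n m R s ω ∂(base n R N) =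
      P * ∫ ω, F ω ∂(mix n m R s N) := fun F => by
    rw [integral_mix hn hR hs N F, hP]
    field_simp
  have hXb : ∀ k, -(2 / (ck (k + 1) - ck 0) * (P * ∫ ω, yv s ω ^ 2 ∂(mix n m R s N))) ≤ X k ∧
      X k ≤ 2 / (ck (k + 1) - ck 0) * (P * (m / 2 * ∫ ω, iT ω ∂(mix n m R s N))) := fun k => by
    have := integral_fraction_bounds hn hR hs hN i0 (sub_pos.mp (hck k))
    rwa [hE (fun ω => yv s ω ^ 2), hE (fun ω => m / 2 * iT ω), integral_const_mul] at this
  have hi : ∀ k, Integrable (fun lam : EuclideanSpace ℝ (Fin m) => Real.cos (s * lam i0) *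
    (2 * ‖lam‖ ^ 2 / (‖lam‖ ^ 2 + ck (k + 1)) * (Real.exp R * fN n R (N + 1) (‖lam‖ ^ 2)))) := fun k =>
    integrable_cos_fraction (w := fun z => z) hn s hR (by omega) i0 (ck_pos _) 2 measurable_id
      (fun z hz => ⟨hz, by linarith [ck_pos (k + 1)]⟩)
  have hi0 : Integrable (fun lam : EuclideanSpace ℝ (Fin m) => Real.cos (s * lam i0) *
    (2 * ck 0 / (‖lam‖ ^ 2 + ck 0) * (Real.exp R * fN n R (N + 1) (‖lam‖ ^ 2)))) :=
    integrable_cos_fraction (w := fun _ => ck 0) hn s hR (by omega) i0 (ck_pos _) 2 measurable_const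
      (fun z hz => ⟨(ck_pos 0).le, by linarith⟩)
  have hi1 : Integrable (fun lam : EuclideanSpace ℝ (Fin m) => Real.cos (s * lam i0) *
    (Real.exp R * fN n R (N + 1) (‖lam‖ ^ 2))) :=
    integrable_fN (q := 0) hn hR.le (by omega) (by fun_prop) fun lam => by simpa using Real.abs_cos_le_one _
  have e : ∀ lam : EuclideanSpace ℝ (Fin m), Real.cos (s * lam i0) * (psiN (N + 1) (‖lam‖ ^ 2) *
        (Real.exp R * fN n R (N + 1) (‖lam‖ ^ 2))) =
      (3 * (Real.cos (s * lam i0) * (Real.exp R * fN n R (N + 1) (‖lam‖ ^ 2))) +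
      (-1) * (Real.cos (s * lam i0) *
        (2 * ck 0 / (‖lam‖ ^ 2 + ck 0) * (Real.exp R * fN n R (N + 1) (‖lam‖ ^ 2))))) +
      ∑ k ∈ Finset.range N, Real.cos (s * lam i0) *
        (2 * ‖lam‖ ^ 2 / (‖lam‖ ^ 2 + ck (k + 1)) * (Real.exp R * fN n R (N + 1) (‖lam‖ ^ 2))) := fun lam => by
    have h1 : 2 * ‖lam‖ ^ 2 / (‖lam‖ ^ 2 + ck 0) = 2 - 2 * ck 0 / (‖lam‖ ^ 2 + ck 0) := by
      have := ck_pos 0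
      have : ‖lam‖ ^ 2 + ck 0 ≠ 0 := by positivity
      field_simp
      ring
    rw [psiN, Finset.sum_range_succ', h1, ← Finset.mul_sum, ← Finset.sum_mul]
    ring
  have hsum : ∫ lam : EuclideanSpace ℝ (Fin m), Real.cos (s * lam i0) * (psiN (N + 1) (‖lam‖ ^ 2) *
        (Real.exp R * fN n R (N + 1) (‖lam‖ ^ 2))) =
      3 * P - P * (∫ ω, 2 * ck 0 * tau ω * iN n ω ∂(mix n m R s N)) + ∑ k ∈ Finset.range N, X k := by
    simp only [e]
    rw [integral_add ((hi1.const_mul _).fun_add (hi0.const_mul _)) (integrable_finsetSum _ fun k _ => hi k),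
      integral_add (hi1.const_mul _) (hi0.const_mul _), integral_const_mul, integral_const_mul,
      integral_finsetSum _ (fun k _ => hi k), integral_cos_fN hn hR (by omega) i0,
      integral_cos_first_fN hn hR (by omega) i0, hE]
    ring
  have hs1 := sum_inv_ck_sub_le N
  have hiT : 0 ≤ ∫ ω, iT ω ∂(mix n m R s N) := by
    refine integral_nonneg_of_ae ?_
    filter_upwards [ae_mix (m := m) (s := s) hn hR N] with ω hω
    exact (iT_pos ω.1.1 hω.1 hω.2).le
  have hy2 : 0 ≤ ∫ ω, yv s ω ^ 2 ∂(mix n m R s N) := integral_nonneg fun ω => by positivity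
  refine ⟨(∫ ω, 2 * ck 0 * tau ω * iN n ω ∂(mix n m R s N)) - 2 - (∑ k ∈ Finset.range N, X k) / P, ?_, ?_, ?_⟩
  · rw [hsum]
    field_simp
    ring
  · have h1 : ∑ k ∈ Finset.range N, X k ≤ 3 / (2 * ck 0) * (P * (m / 2 * ∫ ω, iT ω ∂(mix n m R s N))) := by
      refine (Finset.sum_le_sum fun k _ => (hXb k).2).trans ?_
      rw [← Finset.sum_mul]
      gcongr
    have h2 : (∑ k ∈ Finset.range N, X k) / P ≤ 3 / (2 * ck 0) * (m / 2 * ∫ ω, iT ω ∂(mix n m R s N)) := by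
      rw [div_le_iff₀ hP0]
      linarith
    linarith
  · have h1 : -(3 / (2 * ck 0) * (P * ∫ ω, yv s ω ^ 2 ∂(mix n m R s N))) ≤ ∑ k ∈ Finset.range N, X k := by
      refine le_trans ?_ (Finset.sum_le_sum fun k _ => (hXb k).1)
      rw [Finset.sum_neg_distrib, ← Finset.sum_mul]
      gcongr
    have h2 : -(3 / (2 * ck 0) * ∫ ω, yv s ω ^ 2 ∂(mix n m R s N)) ≤ (∑ k ∈ Finset.range N, X k) / P := by
      rw [le_div_iff₀ hP0]
      linarith
    linarith

lemma tendsto_integral_fN {n : ℕ} (hn : 1 ≤ n) {R : ℝ} (hR : 0 < R) {m q : ℕ}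
    {w : ℕ → EuclideanSpace ℝ (Fin m) → ℝ} {w0 : EuclideanSpace ℝ (Fin m) → ℝ}
    (hw : ∀ N, Measurable (w N)) (hb : ∀ N lam, |w N lam| ≤ (1 + ‖lam‖ ^ 2) ^ q)
    (hl : ∀ lam, Tendsto (fun N => w N lam) atTop (𝓝 (w0 lam))) :
    Tendsto (fun N => ∫ lam, w N lam * (Real.exp R * fN n R (N + 1) (‖lam‖ ^ 2))) atTop
      (𝓝 (Real.exp R * ∫ lam, w0 lam * fr n R ‖lam‖)) := by
  have h := tendsto_integral_filter_of_dominated_convergence (μ := volume) (l := atTop)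
    (F := fun N lam => w N lam * fN n R (N + 1) (‖lam‖ ^ 2)) (f := fun lam => w0 lam * fr n R ‖lam‖)
    (maj m q) ?_ ?_ (integrable_maj m q) ?_
  · refine (h.const_mul (Real.exp R)).congr fun N => ?_
    rw [← integral_const_mul]
    congr 1
    ext lam
    ring
  · refine Eventually.of_forall fun N => ?_
    have : Measurable (fun lam : EuclideanSpace ℝ (Fin m) => fN n R (N + 1) (‖lam‖ ^ 2)) := by
      unfold fN psiN prodN
      fun_prop
    exact ((hw N).mul this).aestronglyMeasurable
  · filter_upwards [eventually_ge_atTop (q + m)] with N hN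
    refine ae_of_all _ fun lam => ?_
    have h1 := fN_pos n R (N + 1) (sq_nonneg ‖lam‖)
    rw [norm_mul, Real.norm_eq_abs, Real.norm_of_nonneg h1.le]
    exact (mul_le_mul_of_nonneg_right (hb N lam) h1.le).trans
      (fN_weight_le_maj hn hR.le (by omega) lam)
  · refine ae_of_all _ fun lam => ?_
    exact (hl lam).mul ((tendsto_fN n R ‖lam‖).comp (tendsto_add_atTop_nat 1))

/-- The lower bound for large second variable. -/
lemma exists_lower_large {n : ℕ} (hn : 1 ≤ n) {m : ℕ} (i0 : Fin m) :
    ∃ s0 : ℝ, 1 ≤ s0 ∧ ∃ c0 : ℝ, 0 < c0 ∧ ∃ C0 : ℝ, 0 < C0 ∧ ∀ R s : ℝ, 0 < R → s0 ≤ s →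
      0 < cosI n i0 R s 0 ∧ ∃ α β : ℝ, cosI n i0 R s 1 = (1 - α) * cosI n i0 R s 0 ∧
        sinI n i0 R s = β * cosI n i0 R s 0 ∧
        c0 * (R + s) - C0 ≤ R - R * α ^ 2 - R * β ^ 2 + 2 * s * β ∧ 0 ≤ β ∧ β ≤ C0 := by
  obtain ⟨K, hK, htt⟩ := exists_mean_tt_le m hn
  obtain ⟨K', hK', hmass⟩ := exists_le_mass m hn
  obtain ⟨s0, hs0, c0, hc0, C0, hC0, H⟩ := exists_lower_of_momentBounds m hK
  refine ⟨s0, hs0, c0, hc0, C0, hC0, fun R s hR hs => ?_⟩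
  have hs1 : 1 ≤ s := hs0.trans hs
  have hsp : 0 < s := by linarith
  have hπ : 0 < Real.pi ^ ((m : ℝ) / 2) := by positivity
  have hN : ∀ᶠ N in atTop, 1 + m ≤ N := eventually_ge_atTop _
  set A : ℕ → ℝ := fun N => ∫ lam : EuclideanSpace ℝ (Fin m), Real.cos (s * lam i0) *
    (Real.exp R * fN n R (N + 1) (‖lam‖ ^ 2)) with hA
  set B : ℕ → ℝ := fun N => ∫ lam : EuclideanSpace ℝ (Fin m), Real.cos (s * lam i0) * psiN (N + 1) (‖lam‖ ^ 2) *
    (Real.exp R * fN n R (N + 1) (‖lam‖ ^ 2)) with hB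
  set S : ℕ → ℝ := fun N => ∫ lam : EuclideanSpace ℝ (Fin m), lam i0 * Real.sin (s * lam i0) *
    (Real.exp R * fN n R (N + 1) (‖lam‖ ^ 2)) with hS
  have tA : Tendsto A atTop (𝓝 (Real.exp R * cosI n i0 R s 0)) := by
    have := tendsto_integral_fN (q := 0) (w := fun _ lam => Real.cos (s * lam i0)) hn hR
      (fun _ => by fun_prop) (fun _ lam => by simpa using Real.abs_cos_le_one _)
      (fun lam => tendsto_const_nhds)
    simpa only [cosI, pow_zero, mul_one] using this
  have tB : Tendsto B atTop (𝓝 (Real.exp R * cosI n i0 R s 1)) := by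
    have := tendsto_integral_fN (q := 1) (w := fun N lam => Real.cos (s * lam i0) * psiN (N + 1) (‖lam‖ ^ 2))
      (w0 := fun lam => Real.cos (s * lam i0) * psi ‖lam‖) hn hR
      (fun _ => by unfold psiN; fun_prop) (fun N lam => by
        have h1 := one_le_psiN (sq_nonneg ‖lam‖) (N + 1)
        have h2 := psiN_le (sq_nonneg ‖lam‖) (N + 1)
        rw [abs_mul, abs_of_nonneg (by linarith : 0 ≤ psiN (N + 1) (‖lam‖ ^ 2)), pow_one]
        exact (mul_le_of_le_one_left (by linarith) (Real.abs_cos_le_one _)).trans h2)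
      (fun lam => ((tendsto_psiN ‖lam‖).comp (tendsto_add_atTop_nat 1)).const_mul _)
    simpa only [cosI, pow_one] using this
  have tS : Tendsto S atTop (𝓝 (Real.exp R * sinI n i0 R s)) :=
    tendsto_integral_fN (q := 1) (w := fun _ lam => lam i0 * Real.sin (s * lam i0)) hn hR
      (fun _ => by fun_prop) (fun _ lam => by
        rw [abs_mul, pow_one]
        exact (mul_le_of_le_one_right (abs_nonneg _) (Real.abs_sin_le_one _)).trans (abs_coord_le lam i0))
      (fun lam => tendsto_const_nhds)
  have eA : ∀ᶠ N in atTop, A N = Real.pi ^ ((m : ℝ) / 2) * mass n m R s N :=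
    hN.mono fun N h => integral_cos_fN hn hR (by omega) i0
  have hpos : 0 < Real.exp R * cosI n i0 R s 0 := by
    refine lt_of_lt_of_le (by positivity : 0 < Real.pi ^ ((m : ℝ) / 2) * Real.exp (-(K' * (R + s + 1))))
      (ge_of_tendsto tA ?_)
    filter_upwards [eA] with N h
    rw [h]
    exact mul_le_mul_of_nonneg_left (hmass R s hR hs1 N) hπ.le
  have hp : 0 < cosI n i0 R s 0 := (mul_pos_iff_of_pos_left (Real.exp_pos R)).mp hpos
  have tα : Tendsto (fun N => 1 - B N / A N) atTop (𝓝 (1 - cosI n i0 R s 1 / cosI n i0 R s 0)) := by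
    have := (tB.div tA hpos.ne').const_sub 1
    rwa [mul_div_mul_left _ _ (Real.exp_pos R).ne'] at this
  have tβ : Tendsto (fun N => S N / A N) atTop (𝓝 (sinI n i0 R s / cosI n i0 R s 0)) := by
    have := tS.div tA hpos.ne'
    rwa [mul_div_mul_left _ _ (Real.exp_pos R).ne'] at this
  have key : ∀ᶠ N in atTop, c0 * (R + s) - C0 ≤ R - R * (1 - B N / A N) ^ 2 - R * (S N / A N) ^ 2 +
      2 * s * (S N / A N) ∧ 0 ≤ S N / A N ∧ S N / A N ≤ C0 := by
    filter_upwards [hN, eA] with N h1 h2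
    have hM := mass_pos (m := m) hn hR hsp N
    have hP : 0 < Real.pi ^ ((m : ℝ) / 2) * mass n m R s N := mul_pos hπ hM
    obtain ⟨a, ha, ha1, ha2⟩ := truncated_bounds hn hR hsp h1 i0
    have e1 : 1 - B N / A N = a := by
      have : B N = (1 - a) * (Real.pi ^ ((m : ℝ) / 2) * mass n m R s N) := by
        rw [← ha, hB]
        simp only [mul_assoc]
      rw [this, h2, mul_div_cancel_right₀ _ hP.ne']
      ring
    have e2 : S N / A N = ∫ ω, yv s ω ∂(mix n m R s N) := by
      rw [h2, hS]
      simp only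
      rw [integral_sin_fN hn hR h1 i0, integral_mix hn hR hsp N]
      field_simp
    rw [e1, e2]
    exact H n R s a (fun F => ∫ ω, F ω ∂(mix n m R s N)) hn hR hs (momentBounds_mix hn hR hsp N)
      (htt R s hR hs1 N) ha1 ha2
  refine ⟨hp, 1 - cosI n i0 R s 1 / cosI n i0 R s 0, sinI n i0 R s / cosI n i0 R s 0, ?_, ?_, ?_, ?_, ?_⟩
  · field_simp
    ring
  · field_simp
  · refine ge_of_tendsto ?_ (key.mono fun N h => h.1)
    exact ((((tα.pow 2).const_mul R).const_sub R).sub ((tβ.pow 2).const_mul R)).add (tβ.const_mul (2 * s))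
  · exact ge_of_tendsto tβ (key.mono fun N h => h.2.1)
  · exact le_of_tendsto tβ (key.mono fun N h => h.2.2)

lemma theta_eq {y : ℝ} (hy : y ≠ 0) :
    theta y = (y - Real.sin y * Real.cos y) / Real.sin y ^ 2 := by
  rw [theta, if_neg hy, Real.sin_two_mul, ← mul_div_mul_left _ (Real.sin y ^ 2) two_ne_zero]
  ring

lemma sq_le_four_mul_sin_sq_add {y : ℝ} (hy : 0 < y) (hπ : y < π) :
    y ^ 2 ≤ 4 * Real.sin y ^ 2 + 4 * (y - Real.sin y * Real.cos y) := by
  have hs : 0 < Real.sin y := Real.sin_pos_of_pos_of_lt_pi hy hπ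
  have hsy : Real.sin y ≤ y := Real.sin_le hy.le
  rcases le_or_gt y (π / 2) with h | h
  · have h1 := Real.mul_le_sin hy.le h
    have h2 : y ≤ 2 * Real.sin y := by
      have h3 : y = π / 2 * (2 / π * y) := by field_simp
      have h4 := mul_le_mul_of_nonneg_left h1 (by positivity : (0 : ℝ) ≤ π / 2)
      have h5 : π / 2 * Real.sin y ≤ 2 * Real.sin y :=
        mul_le_mul_of_nonneg_right (by linarith [Real.pi_le_four]) hs.le
      linarith
    have h6 : Real.sin y * Real.cos y ≤ y :=
      (mul_le_of_le_one_right hs.le (Real.cos_le_one y)).trans hsy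
    have h7 : y ^ 2 ≤ (2 * Real.sin y) ^ 2 := pow_le_pow_left₀ hy.le h2 2
    linarith
  · have hc : Real.cos y ≤ 0 := Real.cos_nonpos_of_pi_div_two_le_of_le h.le (by linarith)
    have h1 : Real.sin y * Real.cos y ≤ 0 := mul_nonpos_of_nonneg_of_nonpos hs.le hc
    have h2 : y * y ≤ 4 * y := mul_le_mul_of_nonneg_right (by linarith [Real.pi_le_four]) hy.le
    have h3 := sq_nonneg (Real.sin y)
    linarith

lemma sin_sq_add_le_five_mul_sq {y : ℝ} (hy : 0 < y) :
    Real.sin y ^ 2 + (y - Real.sin y * Real.cos y) ≤ 5 * y ^ 2 := by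
  have h1 : Real.sin y ^ 2 ≤ y ^ 2 := Real.sin_sq_le_sq
  have h2 : Real.sin y * Real.cos y = Real.sin (2 * y) / 2 := by rw [Real.sin_two_mul]; ring
  rcases le_or_gt (2 * y) 1 with h | h
  · have h3 := Real.sin_gt_sub_cube (by linarith : 0 < 2 * y)
    have h4 : y * y ^ 2 ≤ 1 * y ^ 2 := mul_le_mul_of_nonneg_right (by linarith) (sq_nonneg y)
    have h5 := sq_nonneg y
    linarith
  · have h3 := Real.neg_one_le_sin (2 * y)
    have h4 : 1 * (2 * y) ≤ 2 * y * (2 * y) := mul_le_mul_of_nonneg_right h.le (by linarith)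
    linarith

lemma dist_sq_bounds {r s y d : ℝ} (hr : 0 < r) (hs : 0 < s) (hy : y ∈ Set.Ico 0 π)
    (hθ : theta y = 4 * s / r ^ 2) (hd : d = r * y / Real.sin y) :
    4 / 5 * (r ^ 2 / 4 + s) ≤ d ^ 2 ∧ d ^ 2 ≤ 16 * (r ^ 2 / 4 + s) := by
  have hy0 : y ≠ 0 := by
    rintro rfl
    have : 0 < 4 * s / r ^ 2 := by positivity
    rw [← hθ] at this
    simp [theta] at this
  have hyp : 0 < y := lt_of_le_of_ne hy.1 hy0.symm
  have hsin : 0 < Real.sin y := Real.sin_pos_of_pos_of_lt_pi hyp hy.2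
  rw [theta_eq hy0, div_eq_div_iff (by positivity) (by positivity)] at hθ
  have hd2 : d ^ 2 = r ^ 2 * y ^ 2 / Real.sin y ^ 2 := by rw [hd, div_pow, mul_pow]
  have h1 := mul_le_mul_of_nonneg_left (sq_le_four_mul_sin_sq_add hyp hy.2) (sq_nonneg r)
  have h2 := mul_le_mul_of_nonneg_left (sin_sq_add_le_five_mul_sq hyp) (sq_nonneg r)
  rw [hd2]
  constructor
  · rw [le_div_iff₀ (by positivity)]
    linarith
  · rw [div_le_iff₀ (by positivity)]
    linarith

lemma small_bounds {k R s s0 α β ε E : ℝ} (hk : 0 ≤ k) (hR : 0 < R) (hs : 0 < s)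
    (hss : s ≤ s0) (hs0 : 1 ≤ s0) (hε0 : 0 < ε) (hε : ε * (4 * (s0 + 1 + 4 * k)) ≤ 1)
    (hα : |α| ≤ ε) (hβ : |β| ≤ ε * s)
    (hE : E = R - R * α ^ 2 - R * β ^ 2 + 2 * s * β + 4 * R * k * β / s) :
    R / 8 - 2 * s0 ≤ E ∧ E ≤ 2 * R + 2 * s0 := by
  have hk4 : 0 ≤ ε * k := by positivity
  have hse : ε * s ≤ ε * s0 := mul_le_mul_of_nonneg_left hss hε0.le
  have hes0 : ε * s0 ≤ 1 / 4 := by linarith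
  have he4 : ε ≤ 1 / 4 := by nlinarith
  have hαsq : α ^ 2 ≤ (1 / 4) ^ 2 := sq_le_sq' (by linarith [neg_abs_le α]) (by linarith [le_abs_self α])
  have hβ4 : |β| ≤ 1 / 4 := by linarith
  have hβsq : β ^ 2 ≤ (1 / 4) ^ 2 := sq_le_sq' (by linarith [neg_abs_le β]) (by linarith [le_abs_self β])
  have h1 : R * α ^ 2 ≤ R * (1 / 4) ^ 2 := mul_le_mul_of_nonneg_left hαsq hR.le
  have h2 : R * β ^ 2 ≤ R * (1 / 4) ^ 2 := mul_le_mul_of_nonneg_left hβsq hR.le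
  have h3 : |s * β| ≤ s0 * (1 / 4) := by
    rw [abs_mul, abs_of_pos hs]
    exact mul_le_mul hss hβ4 (abs_nonneg _) (by linarith)
  have h4 : |4 * R * k * β / s| ≤ R / 4 := by
    rw [abs_div, abs_of_pos hs, div_le_iff₀ hs, abs_mul, abs_of_nonneg (by positivity : 0 ≤ 4 * R * k)]
    have h5 : 4 * R * k * |β| ≤ 4 * R * k * (ε * s) := mul_le_mul_of_nonneg_left hβ (by positivity)
    have h6 : ε * k * (4 * R * s) ≤ 1 / 16 * (4 * R * s) := by
      refine mul_le_mul_of_nonneg_right ?_ (by positivity)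
      have : 0 < ε * s0 := by positivity
      linarith
    linarith
  have h7 := abs_le.mp h3
  have h8 := abs_le.mp h4
  have h9 : 0 ≤ R * α ^ 2 := by positivity
  have h10 : 0 ≤ R * β ^ 2 := by positivity
  constructor <;> linarith [h7.1, h7.2, h8.1, h8.2]

lemma large_bounds {k R s α β c0 C0 E : ℝ} (hk : 0 ≤ k) (hR : 0 < R) (hs : 1 ≤ s)
    (h : c0 * (R + s) - C0 ≤ R - R * α ^ 2 - R * β ^ 2 + 2 * s * β) (hβ0 : 0 ≤ β) (hβ : β ≤ C0)
    (hE : E = R - R * α ^ 2 - R * β ^ 2 + 2 * s * β + 4 * R * k * β / s) :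
    c0 * (R + s) - C0 ≤ E ∧ E ≤ (1 + 2 * C0 + 4 * k * C0) * (R + s) := by
  have hsp : 0 < s := by linarith
  have h1 : 0 ≤ 4 * R * k * β / s := by positivity
  have h2 : 4 * R * k * β / s ≤ 4 * R * k * C0 := by
    refine (div_le_self (by positivity) hs).trans ?_
    exact mul_le_mul_of_nonneg_left hβ (by positivity)
  have h3 : s * β ≤ s * C0 := mul_le_mul_of_nonneg_left hβ hsp.le
  have h4 : 0 ≤ R * α ^ 2 := by positivity
  have h5 : 0 ≤ R * β ^ 2 := by positivity
  have hC : 0 ≤ C0 := hβ0.trans hβ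
  have h6 : 0 ≤ R * C0 := by positivity
  have h7 : 0 ≤ s * k * C0 := by positivity
  constructor
  · linarith
  · linarith

lemma four_potV_comparable {n m : ℕ} (hn : 1 ≤ n) (hm : 0 < m) :
    ∃ c : ℝ, 0 < c ∧ ∃ C : ℝ, 0 < C ∧ ∃ M : ℝ, 0 < M ∧
      ∀ (x : EuclideanSpace ℝ (Fin (2 * n))) (t : EuclideanSpace ℝ (Fin m)),
        x ≠ 0 → t ≠ 0 → M ≤ ‖x‖ ^ 2 + ‖t‖ →
        c * (‖x‖ ^ 2 / 4 + ‖t‖) ≤ 4 * potV n m hm x t ∧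
          4 * potV n m hm x t ≤ C * (‖x‖ ^ 2 / 4 + ‖t‖) := by
  obtain ⟨s0, hs0, c0, hc0, C0, hC0, hlarge⟩ := exists_lower_large (n := n) (m := m) hn ⟨0, hm⟩
  have hk : (0 : ℝ) ≤ (m : ℝ) - 1 := by
    have : (1 : ℝ) ≤ m := by exact_mod_cast hm
    linarith
  set k : ℝ := (m : ℝ) - 1 with hkdef
  set D : ℝ := 2 * ((n : ℝ) + m) with hD
  have hD0 : 0 ≤ D := by positivity
  set ε : ℝ := 1 / (4 * (s0 + 1 + 4 * k)) with hε
  have hε0 : 0 < ε := by positivity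
  have hε1 : ε * (4 * (s0 + 1 + 4 * k)) ≤ 1 := by
    rw [hε, div_mul_cancel₀]
    positivity
  obtain ⟨R0, hR0, hsmall⟩ := region_bounded_s (n := n) (m := m) hn ⟨0, hm⟩ s0 hε0
  set c1 : ℝ := min c0 (1 / 8) with hc1
  have hc1p : 0 < c1 := lt_min hc0 (by norm_num)
  set B : ℝ := C0 + 4 * s0 + D with hB
  have hBp : 0 < B := by positivity
  refine ⟨c1 / 2, by positivity, 3 + 2 * s0 + 2 * C0 + 4 * k * C0, by positivity,
    4 * (R0 + s0 + 2 * B / c1 + 1), by positivity, fun x t hx ht hM => ?_⟩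
  have hxp : 0 < ‖x‖ := norm_pos_iff.mpr hx
  have hs : 0 < ‖t‖ := norm_pos_iff.mpr ht
  obtain ⟨R, hR⟩ : ∃ R, R = ‖x‖ ^ 2 / 4 := ⟨_, rfl⟩
  obtain ⟨s, hst⟩ : ∃ s, s = ‖t‖ := ⟨_, rfl⟩
  have hRp : 0 < R := by rw [hR]; positivity
  have hV := fun {α β : ℝ} => four_potV hn hm x t hx ht (α := α) (β := β) hR hst
  have hM' : 4 * (R0 + s0 + 2 * B / c1 + 1) ≤ 4 * R + s := by rw [hR, hst]; linarith
  rw [← hR, ← hst]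
  rw [← hst] at hs
  have hBc : 0 < 2 * B / c1 := by positivity
  have hX : 2 * B / c1 ≤ R + s := by linarith
  have hX1 : 1 ≤ R + s := by linarith
  have hX2 : B ≤ c1 / 2 * (R + s) := by
    rw [div_le_iff₀ hc1p] at hX
    linarith
  have hCk : 0 ≤ k * C0 := by positivity
  suffices h : c1 * (R + s) - B ≤ 4 * potV n m hm x t ∧
      4 * potV n m hm x t ≤ (3 + 2 * s0 + 2 * C0 + 4 * k * C0) * (R + s) by
    exact ⟨by linarith [h.1], h.2⟩
  rcases le_or_gt s s0 with h | h
  · obtain ⟨hp, h1, h2⟩ := hsmall R s (by linarith) hs h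
    set I0 := cosI n (⟨0, hm⟩ : Fin m) R s 0
    have e := hV (α := 1 - cosI n ⟨0, hm⟩ R s 1 / I0) (β := sinI n ⟨0, hm⟩ R s / I0) hp
      (by field_simp; ring) (by field_simp)
    obtain ⟨l, u⟩ := small_bounds hk hRp hs h hs0 hε0 hε1
      (α := 1 - cosI n ⟨0, hm⟩ R s 1 / I0) (β := sinI n ⟨0, hm⟩ R s / I0)
      (by
        rw [← div_self hp.ne', ← sub_div, abs_div, abs_of_pos hp, div_le_iff₀ hp]
        exact h1)
      (by
        rw [abs_div, abs_of_pos hp, div_le_iff₀ hp]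
        exact h2) rfl
    have h3 : c1 * (R + s) ≤ 1 / 8 * (R + s) :=
      mul_le_mul_of_nonneg_right (min_le_right _ _) (by linarith)
    have h4 : (2 + 2 * s0) * 1 ≤ (2 + 2 * s0) * (R + s) :=
      mul_le_mul_of_nonneg_left hX1 (by linarith)
    have h5 : 0 ≤ (1 + 2 * C0 + 4 * (k * C0)) * (R + s) := by positivity
    have h6 : 2 * s0 * 1 ≤ 2 * s0 * (R + s) := mul_le_mul_of_nonneg_left hX1 (by linarith)
    constructor <;> linarith
  · obtain ⟨hp, α, β, h1, h2, h3, h4, h5⟩ := hlarge R s hRp h.le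
    have e := hV hp h1 h2
    obtain ⟨l, u⟩ := large_bounds hk hRp (hs0.trans h.le) h3 h4 h5 rfl
    have h6 : c1 * (R + s) ≤ c0 * (R + s) :=
      mul_le_mul_of_nonneg_right (min_le_left _ _) (by linarith)
    have h7 : 0 ≤ (2 + 2 * s0) * (R + s) := by positivity
    constructor <;> linarith

end OUPotential

/-- The Ornstein–Uhlenbeck potential V₁ is comparable to d(x,t)² at infinity. -/
theorem potential_comparable_to_distance_sq (n m : ℕ) (hn : 1 ≤ n) (hm : 0 < m) :
    ∃ c : ℝ, 0 < c ∧ ∃ C : ℝ, 0 < C ∧ ∃ M : ℝ, 0 < M ∧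
      ∀ (x : EuclideanSpace ℝ (Fin (2 * n))) (t : EuclideanSpace ℝ (Fin m)) (yω d : ℝ),
        x ≠ 0 → t ≠ 0 → M ≤ ‖x‖ ^ 2 + ‖t‖ →
        yω ∈ Set.Ico 0 π → theta yω = 4 * ‖t‖ / ‖x‖ ^ 2 →
        d = ‖x‖ * yω / Real.sin yω →
        c * d ^ 2 ≤ potV n m hm x t ∧ potV n m hm x t ≤ C * d ^ 2 := by
  obtain ⟨c, hc, C, hC, M, hM, H⟩ := OUPotential.four_potV_comparable hn hm
  refine ⟨c / 64, by positivity, 5 * C / 16, by positivity, M, hM,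
    fun x t y d hx ht hxt hy hθ hd => ?_⟩
  obtain ⟨h1, h2⟩ := OUPotential.dist_sq_bounds (norm_pos_iff.mpr hx) (norm_pos_iff.mpr ht) hy hθ hd
  obtain ⟨h3, h4⟩ := H x t hx ht hxt
  have h5 := mul_le_mul_of_nonneg_left h1 hC.le
  have h6 := mul_le_mul_of_nonneg_left h2 hc.le
  constructor <;> linarith
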